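/- Let N ≥ 4 be a real number, T > 0, n ∈ ℕ, M > 0. Let b₂, b₁, b₀ ∈ C^∞([0,T]×[0,1]) satisfy |b₂ − 1| ≤ 1/2 everywhere and |b⃗|₆^T ≤ M, where b⃗ = (b₂,b₁,b₀). Let τ₂ ∈ (0,T), let g ∈ C^∞([0,T]×[0,1]) vanish for 0 ≤ t ≤ τ₂ and satisfy ‖g‖₁^T ≤ M, and let h ∈ C^∞([0,T]×[0,1]) satisfy ∂_t²h + 𝒜h = g on [0,T]×(0,1), h(t,1) = 0 for all t, and h(t,·) = 0 for 0 ≤ t ≤ τ₂. Then there is a constant C_n = C_n(T, M, N) such that: ‖h‖_{n+2}^T ≤ C_n·( 1 + ‖g‖_{n+1}^T + |b⃗|_{n+5}^T ). -/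

import Mathlib

open MeasureTheory Real Set

noncomputable section

/-- The degenerate operator `Δy(z) = z y''(z) + (N/2) y'(z)`. -/
def Del (N : ℝ) (f : ℝ → ℝ) : ℝ → ℝ :=
  fun z => z * deriv (deriv f) z + (N / 2) * deriv f z

/-- Iterates `Δ^m`. -/
def DelIter (N : ℝ) : ℕ → (ℝ → ℝ) → ℝ → ℝ
  | 0 => fun f => f
  | m + 1 => fun f => Del N (DelIter N m f)

/-- `Ḋ = √z d/dz`. -/
def Ddot (f : ℝ → ℝ) : ℝ → ℝ := fun z => Real.sqrt z * deriv f z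

/-- The weighted L² norm on (0,1). -/
def Xnorm (N : ℝ) (f : ℝ → ℝ) : ℝ :=
  Real.sqrt (∫ z in (0:ℝ)..1, (f z) ^ 2 * z ^ (N / 2 - 1))

/-- Graded seminorms `(y)_ℓ`. -/
def gnorm (N : ℝ) (ℓ : ℕ) (f : ℝ → ℝ) : ℝ :=
  if ℓ % 2 = 0 then Xnorm N (DelIter N (ℓ / 2) f)
  else Xnorm N (Ddot (DelIter N (ℓ / 2) f))

/-- Graded norm `‖y‖_n`. -/
def normN (N : ℝ) (n : ℕ) (f : ℝ → ℝ) : ℝ :=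
  Real.sqrt (∑ ℓ ∈ Finset.range (n + 1), (gnorm N ℓ f) ^ 2)

/-- Sup norm on [0,1]. -/
def supN (f : ℝ → ℝ) : ℝ := ⨆ z : Icc (0:ℝ) 1, |f z.1|

/-- `|y|_n = ∑_{ℓ≤n} ‖Ḋ^ℓ y‖_{L^∞(0,1)}`. -/
def supLow (n : ℕ) (f : ℝ → ℝ) : ℝ := ∑ ℓ ∈ Finset.range (n + 1), supN (Ddot^[ℓ] f)

/-- Time derivative of a function of (t,z). -/
def dt (y : ℝ → ℝ → ℝ) : ℝ → ℝ → ℝ := fun t z => deriv (fun s => y s z) t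

/-- Sup norm on [0,T]×[0,1]. -/
def supT (T : ℝ) (y : ℝ → ℝ → ℝ) : ℝ :=
  ⨆ (t : Icc (0:ℝ) T) (z : Icc (0:ℝ) 1), |y t.1 z.1|

/-- `|y|_n^T = sup_{j+k≤n} ‖∂_t^j Ḋ^k y‖_{L^∞([0,T]×[0,1])}`. -/
def supNT (T : ℝ) (n : ℕ) (y : ℝ → ℝ → ℝ) : ℝ :=
  ⨆ p : {p : ℕ × ℕ // p.1 + p.2 ≤ n}, supT T (fun t => Ddot^[p.1.2] (dt^[p.1.1] y t))

/-- `‖y‖_n^T`. -/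
def normT (N T : ℝ) (n : ℕ) (y : ℝ → ℝ → ℝ) : ℝ :=
  Real.sqrt (∑ j ∈ Finset.range (n + 1), ∑ k ∈ Finset.range (n + 1 - j),
    ∫ t in (0:ℝ)..T, (normN N k (dt^[j] y t)) ^ 2)

/-- `Z_n(H)(t) = ∑_{j+k=n} ‖∂_t^j H(t,·)‖_k`. -/
def ZZ (N : ℝ) (n : ℕ) (H : ℝ → ℝ → ℝ) (t : ℝ) : ℝ :=
  ∑ j ∈ Finset.range (n + 1), normN N (n - j) (dt^[j] H t)

/-- The operator `𝒜h = -b₂ Δh + b₁ Ďh + b₀ h` with time-dependent coefficients. -/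
def opA (N : ℝ) (b₂ b₁ b₀ : ℝ → ℝ → ℝ) (H : ℝ → ℝ → ℝ) : ℝ → ℝ → ℝ :=
  fun t z => -(b₂ t z) * Del N (H t) z + b₁ t z * (z * deriv (H t) z) + b₀ t z * H t z

end


open MeasureTheory Real Set

/-! ### Smooth functions of two variables -/

/-- Joint smoothness of a function of two variables. -/
def Sm (y : ℝ → ℝ → ℝ) : Prop := ContDiff ℝ (⊤ : ℕ∞) (fun p : ℝ × ℝ => y p.1 p.2)

/-- The space derivative. -/
noncomputable def dz (y : ℝ → ℝ → ℝ) : ℝ → ℝ → ℝ := fun t => deriv (y t)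

theorem Sm.hasDerivAt_t {y : ℝ → ℝ → ℝ} (hy : Sm y) (t z : ℝ) :
    HasDerivAt (fun s => y s z) (dt y t z) t := by
  have h1 : DifferentiableAt ℝ (fun s => y s z) t := by
    have : ContDiff ℝ (⊤ : ℕ∞) (fun s : ℝ => y s z) :=
      hy.comp (contDiff_id.prodMk contDiff_const)
    exact (this.differentiable (by simp)).differentiableAt
  exact h1.hasDerivAt

theorem Sm.slice {y : ℝ → ℝ → ℝ} (hy : Sm y) (t : ℝ) : ContDiff ℝ (⊤ : ℕ∞) (y t) :=
  hy.comp (contDiff_const.prodMk contDiff_id)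

theorem Sm.hasDerivAt_z {y : ℝ → ℝ → ℝ} (hy : Sm y) (t z : ℝ) :
    HasDerivAt (y t) (dz y t z) z :=
  ((hy.slice t).differentiable (by simp)).differentiableAt.hasDerivAt

theorem Sm.diff {y : ℝ → ℝ → ℝ} (hy : Sm y) : Differentiable ℝ (fun p : ℝ × ℝ => y p.1 p.2) :=
  ContDiff.differentiable hy (by simp)

theorem Sm.dt_eq {y : ℝ → ℝ → ℝ} (hy : Sm y) (t z : ℝ) :
    dt y t z = fderiv ℝ (fun p : ℝ × ℝ => y p.1 p.2) (t, z) (1, 0) := by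
  have h1 := (hy.diff (t, z)).hasFDerivAt
  have h2 : HasDerivAt (fun s : ℝ => (s, z)) ((1 : ℝ), (0 : ℝ)) t :=
    (hasDerivAt_id t).prodMk (hasDerivAt_const t z)
  exact (hy.hasDerivAt_t t z).unique (HasFDerivAt.comp_hasDerivAt (f := fun s : ℝ => (s, z)) t h1 h2)

theorem Sm.dz_eq {y : ℝ → ℝ → ℝ} (hy : Sm y) (t z : ℝ) :
    dz y t z = fderiv ℝ (fun p : ℝ × ℝ => y p.1 p.2) (t, z) (0, 1) := by
  have h1 := (hy.diff (t, z)).hasFDerivAt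
  have h2 : HasDerivAt (fun s : ℝ => (t, s)) ((0 : ℝ), (1 : ℝ)) z :=
    (hasDerivAt_const z t).prodMk (hasDerivAt_id z)
  exact (hy.hasDerivAt_z t z).unique (HasFDerivAt.comp_hasDerivAt (f := fun s : ℝ => (t, s)) z h1 h2)

theorem Sm.fderiv_apply {y : ℝ → ℝ → ℝ} (hy : Sm y) (v : ℝ × ℝ) :
    ContDiff ℝ (⊤ : ℕ∞) (fun p : ℝ × ℝ => fderiv ℝ (fun p : ℝ × ℝ => y p.1 p.2) p v) :=
  (ContDiff.fderiv_right (m := (⊤ : ℕ∞)) hy (by simp)).clm_apply contDiff_const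

theorem Sm.dt {y : ℝ → ℝ → ℝ} (hy : Sm y) : Sm (dt y) := by
  have := hy.fderiv_apply (1, 0)
  unfold Sm
  convert this using 2 with p
  exact hy.dt_eq p.1 p.2

theorem Sm.dz {y : ℝ → ℝ → ℝ} (hy : Sm y) : Sm (dz y) := by
  have := hy.fderiv_apply (0, 1)
  unfold Sm
  convert this using 2 with p
  exact hy.dz_eq p.1 p.2

theorem Sm.cont {y : ℝ → ℝ → ℝ} (hy : Sm y) : Continuous (fun p : ℝ × ℝ => y p.1 p.2) :=
  ContDiff.continuous hy

theorem Sm.dt_dz {y : ℝ → ℝ → ℝ} (hy : Sm y) : _root_.dt (_root_.dz y) = _root_.dz (_root_.dt y) := by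
  funext t z
  rw [hy.dz.dt_eq, hy.dt.dz_eq]
  have e1 : (fun p : ℝ × ℝ => _root_.dz y p.1 p.2)
      = fun p => fderiv ℝ (fun p : ℝ × ℝ => y p.1 p.2) p (0, 1) := by
    funext p; exact hy.dz_eq p.1 p.2
  have e2 : (fun p : ℝ × ℝ => _root_.dt y p.1 p.2)
      = fun p => fderiv ℝ (fun p : ℝ × ℝ => y p.1 p.2) p (1, 0) := by
    funext p; exact hy.dt_eq p.1 p.2
  have hd : DifferentiableAt ℝ (fderiv ℝ (fun p : ℝ × ℝ => y p.1 p.2)) (t, z) :=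
    ((ContDiff.fderiv_right (m := (⊤ : ℕ∞)) hy (by simp)).differentiable (by simp)) _
  rw [e1, e2, fderiv_clm_apply hd (differentiableAt_const _),
    fderiv_clm_apply hd (differentiableAt_const _)]
  have hs : IsSymmSndFDerivAt ℝ (fun p : ℝ × ℝ => y p.1 p.2) (t, z) :=
    (ContDiff.contDiffAt hy).isSymmSndFDerivAt (by
      simp only [minSmoothness_of_isRCLikeNormedField]
      exact (show ((2 : ℕ∞) : WithTop ℕ∞) ≤ _ from WithTop.coe_le_coe.2 le_top))
  simp [hs.eq (1, 0) (0, 1)]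

theorem Sm.dt_iter {y : ℝ → ℝ → ℝ} (hy : Sm y) (j : ℕ) : Sm (_root_.dt^[j] y) := by
  induction j with
  | zero => exact hy
  | succ j ih => rw [Function.iterate_succ_apply']; exact ih.dt

theorem Sm.dz_iter {y : ℝ → ℝ → ℝ} (hy : Sm y) (j : ℕ) : Sm (_root_.dz^[j] y) := by
  induction j with
  | zero => exact hy
  | succ j ih => rw [Function.iterate_succ_apply']; exact ih.dz

/-- Mixed derivative `∂_z^q ∂_t^j`. -/
noncomputable def DD (q j : ℕ) (y : ℝ → ℝ → ℝ) : ℝ → ℝ → ℝ := dz^[q] (dt^[j] y)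

theorem Sm.DD {y : ℝ → ℝ → ℝ} (hy : Sm y) (q j : ℕ) : Sm (DD q j y) :=
  (hy.dt_iter j).dz_iter q

theorem Sm.dt_dz_iter {y : ℝ → ℝ → ℝ} (hy : Sm y) (q : ℕ) :
    _root_.dt (_root_.dz^[q] y) = _root_.dz^[q] (_root_.dt y) := by
  induction q with
  | zero => rfl
  | succ q ih =>
    rw [Function.iterate_succ_apply', Function.iterate_succ_apply', (hy.dz_iter q).dt_dz, ih]

theorem Sm.dt_iter_dz {y : ℝ → ℝ → ℝ} (hy : Sm y) (j : ℕ) :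
    _root_.dt^[j] (_root_.dz y) = _root_.dz (_root_.dt^[j] y) := by
  induction j with
  | zero => rfl
  | succ q ih =>
    rw [Function.iterate_succ_apply', Function.iterate_succ_apply', ih, (hy.dt_iter q).dt_dz]

theorem Sm.dt_DD {y : ℝ → ℝ → ℝ} (hy : Sm y) (q j : ℕ) :
    _root_.dt (_root_.DD q j y) = _root_.DD q (j + 1) y := by
  unfold _root_.DD
  rw [(hy.dt_iter j).dt_dz_iter, Function.iterate_succ_apply']

theorem dz_DD (y : ℝ → ℝ → ℝ) (q j : ℕ) : dz (DD q j y) = DD (q + 1) j y := by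
  unfold DD
  rw [Function.iterate_succ_apply']

theorem Sm.add {y w : ℝ → ℝ → ℝ} (hy : Sm y) (hw : Sm w) : Sm (fun t z => y t z + w t z) :=
  ContDiff.add hy hw

theorem Sm.sub {y w : ℝ → ℝ → ℝ} (hy : Sm y) (hw : Sm w) : Sm (fun t z => y t z - w t z) :=
  ContDiff.sub hy hw

theorem Sm.mul {y w : ℝ → ℝ → ℝ} (hy : Sm y) (hw : Sm w) : Sm (fun t z => y t z * w t z) :=
  ContDiff.mul hy hw

theorem Sm.const (c : ℝ) : Sm (fun _ _ => c) := contDiff_const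

theorem Sm.zmul {y : ℝ → ℝ → ℝ} (hy : Sm y) : Sm (fun t z => z * y t z) :=
  ContDiff.mul contDiff_snd hy

theorem Sm.cmul {y : ℝ → ℝ → ℝ} (c : ℝ) (hy : Sm y) : Sm (fun t z => c * y t z) :=
  ContDiff.mul contDiff_const hy

theorem Sm.sum {ι : Type*} {s : Finset ι} {y : ι → ℝ → ℝ → ℝ} (hy : ∀ i, Sm (y i)) :
    Sm (fun t z => ∑ i ∈ s, y i t z) :=
  ContDiff.sum (fun i _ => hy i)

theorem dt_add {y w : ℝ → ℝ → ℝ} (hy : Sm y) (hw : Sm w) :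
    dt (fun t z => y t z + w t z) = fun t z => dt y t z + dt w t z := by
  funext t z; exact ((hy.hasDerivAt_t t z).add (hw.hasDerivAt_t t z)).deriv

theorem dz_add {y w : ℝ → ℝ → ℝ} (hy : Sm y) (hw : Sm w) :
    dz (fun t z => y t z + w t z) = fun t z => dz y t z + dz w t z := by
  funext t z; exact ((hy.hasDerivAt_z t z).add (hw.hasDerivAt_z t z)).deriv

theorem dt_mul {y w : ℝ → ℝ → ℝ} (hy : Sm y) (hw : Sm w) :
    dt (fun t z => y t z * w t z) = fun t z => dt y t z * w t z + y t z * dt w t z := by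
  funext t z; exact ((hy.hasDerivAt_t t z).mul (hw.hasDerivAt_t t z)).deriv

theorem dz_mul {y w : ℝ → ℝ → ℝ} (hy : Sm y) (hw : Sm w) :
    dz (fun t z => y t z * w t z) = fun t z => dz y t z * w t z + y t z * dz w t z := by
  funext t z; exact ((hy.hasDerivAt_z t z).mul (hw.hasDerivAt_z t z)).deriv

theorem dt_cmul {y : ℝ → ℝ → ℝ} (c : ℝ) (hy : Sm y) :
    dt (fun t z => c * y t z) = fun t z => c * dt y t z := by
  funext t z; exact ((hy.hasDerivAt_t t z).const_mul c).deriv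

theorem dz_cmul {y : ℝ → ℝ → ℝ} (c : ℝ) (hy : Sm y) :
    dz (fun t z => c * y t z) = fun t z => c * dz y t z := by
  funext t z; exact ((hy.hasDerivAt_z t z).const_mul c).deriv

theorem dt_zmul {y : ℝ → ℝ → ℝ} (hy : Sm y) :
    dt (fun t z => z * y t z) = fun t z => z * dt y t z := by
  funext t z; exact ((hy.hasDerivAt_t t z).const_mul z).deriv

theorem dz_zmul {y : ℝ → ℝ → ℝ} (hy : Sm y) :
    dz (fun t z => z * y t z) = fun t z => y t z + z * dz y t z := by
  funext t z
  have := ((hasDerivAt_id z).mul (hy.hasDerivAt_z t z)).deriv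
  simp at this
  exact this

theorem DD_add {y w : ℝ → ℝ → ℝ} (hy : Sm y) (hw : Sm w) (q j : ℕ) :
    DD q j (fun t z => y t z + w t z) = fun t z => DD q j y t z + DD q j w t z := by
  induction q with
  | zero =>
    induction j with
    | zero => rfl
    | succ j ih =>
      rw [← Sm.dt_DD (hy.add hw), ih, dt_add (hy.DD _ _) (hw.DD _ _), hy.dt_DD, hw.dt_DD]
  | succ q ih => rw [← dz_DD, ih, dz_add (hy.DD _ _) (hw.DD _ _), dz_DD, dz_DD]

theorem DD_cmul {y : ℝ → ℝ → ℝ} (c : ℝ) (hy : Sm y) (q j : ℕ) :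
    DD q j (fun t z => c * y t z) = fun t z => c * DD q j y t z := by
  induction q with
  | zero =>
    induction j with
    | zero => rfl
    | succ j ih =>
      rw [← Sm.dt_DD (hy.cmul c), ih, dt_cmul c (hy.DD _ _), hy.dt_DD]
  | succ q ih => rw [← dz_DD, ih, dz_cmul c (hy.DD _ _), dz_DD]

theorem DD_sub {y w : ℝ → ℝ → ℝ} (hy : Sm y) (hw : Sm w) (q j : ℕ) :
    DD q j (fun t z => y t z - w t z) = fun t z => DD q j y t z - DD q j w t z := by
  have e : (fun t z => y t z - w t z) = fun t z => y t z + (-1) * w t z := by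
    funext t z; ring
  rw [e, DD_add hy (hw.cmul _), DD_cmul _ hw]
  funext t z; ring

theorem DD_zmul {y : ℝ → ℝ → ℝ} (hy : Sm y) (q j : ℕ) :
    DD (q + 1) j (fun t z => z * y t z)
      = fun t z => z * DD (q + 1) j y t z + (q + 1) * DD q j y t z := by
  have h0 : ∀ j, DD 0 j (fun t z => z * y t z) = fun t z => z * DD 0 j y t z := by
    intro j
    induction j with
    | zero => rfl
    | succ j ih => rw [← Sm.dt_DD hy.zmul, ih, dt_zmul (hy.DD _ _), hy.dt_DD]
  induction q with
  | zero =>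
    rw [← dz_DD, h0, dz_zmul (hy.DD _ _), dz_DD]
    funext t z; simp; ring
  | succ q ih =>
    rw [← dz_DD, ih, dz_add ((hy.DD _ _).zmul) ((hy.DD _ _).cmul _), dz_zmul (hy.DD _ _),
      dz_cmul _ (hy.DD _ _), dz_DD, dz_DD]
    funext t z; push_cast; ring

theorem DD_zmul0 {y : ℝ → ℝ → ℝ} (hy : Sm y) (j : ℕ) :
    DD 0 j (fun t z => z * y t z) = fun t z => z * DD 0 j y t z := by
  induction j with
  | zero => rfl
  | succ j ih => rw [← Sm.dt_DD hy.zmul, ih, dt_zmul (hy.DD _ _), hy.dt_DD]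

theorem DD_DD {y : ℝ → ℝ → ℝ} (hy : Sm y) (q j q' j' : ℕ) :
    DD q j (DD q' j' y) = DD (q + q') (j + j') y := by
  induction q with
  | zero =>
    induction j with
    | zero => simp [DD]
    | succ j ih =>
      rw [← (hy.DD _ _).dt_DD, ih, hy.dt_DD]
      congr 1; omega
  | succ q ih =>
    rw [← dz_DD, ih, dz_DD]
    congr 1; omega

/-- `Δ` acting on functions of `(t,z)`. -/
noncomputable def DelT (N : ℝ) (y : ℝ → ℝ → ℝ) : ℝ → ℝ → ℝ := fun t => Del N (y t)

theorem DelT_eq (N : ℝ) (y : ℝ → ℝ → ℝ) :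
    DelT N y = fun t z => z * DD 2 0 y t z + (N / 2) * DD 1 0 y t z := rfl

theorem Sm.DelT {y : ℝ → ℝ → ℝ} (hy : Sm y) (N : ℝ) : Sm (DelT N y) := by
  rw [DelT_eq]; exact (hy.DD 2 0).zmul.add ((hy.DD 1 0).cmul _)

theorem DD_DelT {y : ℝ → ℝ → ℝ} (hy : Sm y) (N : ℝ) (q j : ℕ) :
    DD q j (DelT N y) = fun t z => z * DD (q + 2) j y t z + (N / 2 + q) * DD (q + 1) j y t z := by
  rw [DelT_eq, DD_add (hy.DD 2 0).zmul ((hy.DD 1 0).cmul _), DD_cmul _ (hy.DD _ _), DD_DD hy]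
  cases q with
  | zero =>
    rw [DD_zmul0 (hy.DD _ _), DD_DD hy]
    funext t z; simp
  | succ q =>
    rw [DD_zmul (hy.DD _ _), DD_DD hy, DD_DD hy]
    funext t z; push_cast; simp only [add_zero]; ring

theorem dt_iter_DelT {y : ℝ → ℝ → ℝ} (hy : Sm y) (N : ℝ) (j : ℕ) :
    dt^[j] (DelT N y) = DelT N (dt^[j] y) := by
  have := DD_DelT hy N 0 j
  have e : DD 0 j (DelT N y) = dt^[j] (DelT N y) := rfl
  rw [e] at this
  rw [this, DelT_eq]
  funext t z
  simp [DD]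

theorem DD_sum {ι : Type*} (s : Finset ι) {y : ι → ℝ → ℝ → ℝ} (hy : ∀ i, Sm (y i)) (q j : ℕ) :
    DD q j (fun t z => ∑ i ∈ s, y i t z) = fun t z => ∑ i ∈ s, DD q j (y i) t z := by
  classical
  induction s using Finset.induction_on with
  | empty =>
    have := DD_cmul 0 (Sm.const 0) q j
    simp only [Finset.sum_empty]
    simpa using this
  | insert a s ha ih =>
    simp only [Finset.sum_insert ha]
    rw [DD_add (hy a) (Sm.sum hy), ih]

theorem DD_mul_t {b f : ℝ → ℝ → ℝ} (hb : Sm b) (hf : Sm f) (j : ℕ) :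
    DD 0 j (fun t z => b t z * f t z) = fun t z => ∑ i ∈ Finset.range (j + 1),
      ((j.choose i : ℕ) : ℝ) * (DD 0 i b t z * DD 0 (j - i) f t z) := by
  funext t z
  have h1 : ∀ (y : ℝ → ℝ → ℝ) (j : ℕ) (t : ℝ),
      DD 0 j y t z = iteratedDeriv j (fun s => y s z) t := by
    intro y j
    induction j with
    | zero => intro t; simp [DD]
    | succ j ih =>
      intro t
      rw [iteratedDeriv_succ]
      have : DD 0 (j+1) y t z = deriv (fun s => DD 0 j y s z) t := by
        simp only [DD, Function.iterate_succ_apply', Function.iterate_zero, id]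
        rfl
      rw [this]; congr 1; funext s; exact ih s
  have hb' : ContDiff ℝ (⊤ : ℕ∞) (fun s : ℝ => b s z) :=
    hb.comp (contDiff_id.prodMk contDiff_const)
  have hf' : ContDiff ℝ (⊤ : ℕ∞) (fun s : ℝ => f s z) :=
    hf.comp (contDiff_id.prodMk contDiff_const)
  have := iteratedDeriv_mul (n := j) (x := t) (f := fun s => b s z) (g := fun s => f s z)
    (hb'.contDiffAt.of_le (by exact_mod_cast le_top))
    (hf'.contDiffAt.of_le (by exact_mod_cast le_top))
  simp only [h1]
  refine Eq.trans this (Finset.sum_congr rfl fun i _ => by ring)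

theorem DD_mul_z {b f : ℝ → ℝ → ℝ} (hb : Sm b) (hf : Sm f) (q : ℕ) :
    DD q 0 (fun t z => b t z * f t z) = fun t z => ∑ p ∈ Finset.range (q + 1),
      ((q.choose p : ℕ) : ℝ) * (DD p 0 b t z * DD (q - p) 0 f t z) := by
  funext t z
  have h1 : ∀ (y : ℝ → ℝ → ℝ) (q : ℕ) (z : ℝ),
      DD q 0 y t z = iteratedDeriv q (fun s => y t s) z := by
    intro y j
    induction j with
    | zero => intro t; simp [DD]
    | succ j ih =>
      intro z
      rw [iteratedDeriv_succ]
      have : DD (j+1) 0 y t z = deriv (fun s => DD j 0 y t s) z := by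
        simp only [DD, Function.iterate_succ_apply', Function.iterate_zero, id]
        rfl
      rw [this]; congr 1; funext s; exact ih s
  have := iteratedDeriv_mul (n := q) (x := z) (f := b t) (g := f t)
    ((hb.slice t).contDiffAt.of_le (by exact_mod_cast le_top))
    ((hf.slice t).contDiffAt.of_le (by exact_mod_cast le_top))
  simp only [h1]
  refine Eq.trans this (Finset.sum_congr rfl fun i _ => by ring)

/-- Leibniz rule for mixed derivatives. -/
theorem DD_mul {b f : ℝ → ℝ → ℝ} (hb : Sm b) (hf : Sm f) (q j : ℕ) :
    DD q j (fun t z => b t z * f t z) = fun t z =>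
      ∑ x ∈ Finset.range (j + 1) ×ˢ Finset.range (q + 1),
        ((j.choose x.1 * q.choose x.2 : ℕ) : ℝ)
          * (DD x.2 x.1 b t z * DD (q - x.2) (j - x.1) f t z) := by
  have e : DD q j (fun t z => b t z * f t z) = DD q 0 (DD 0 j (fun t z => b t z * f t z)) := by
    rw [DD_DD (hb.mul hf)]; simp
  rw [e, DD_mul_t hb hf, DD_sum _ (fun i => ((hb.DD 0 i).mul (hf.DD 0 (j - i))).cmul _)]
  funext t z
  rw [Finset.sum_product]
  refine Finset.sum_congr rfl fun i _ => ?_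
  rw [DD_cmul _ ((hb.DD 0 i).mul (hf.DD 0 (j - i))), DD_mul_z (hb.DD 0 i) (hf.DD 0 (j - i))]
  simp only [DD_DD hb, DD_DD hf, Finset.mul_sum]
  refine Finset.sum_congr rfl fun p _ => ?_
  push_cast
  simp only [add_zero, zero_add]
  ring

theorem dt_iter_eq_DD (y : ℝ → ℝ → ℝ) (j : ℕ) : dt^[j] y = DD 0 j y := rfl

/-- If a smooth function vanishes on an open rectangle so do all of its derivatives. -/
theorem DD_zero_of_open {y : ℝ → ℝ → ℝ} (hy : Sm y) {U : Set (ℝ × ℝ)} (hU : IsOpen U)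
    (h0 : ∀ p ∈ U, y p.1 p.2 = 0) (q j : ℕ) : ∀ p ∈ closure U, DD q j y p.1 p.2 = 0 := by
  have step : ∀ w : ℝ → ℝ → ℝ, (∀ p ∈ U, w p.1 p.2 = 0) → ∀ p ∈ U, dt w p.1 p.2 = 0 := by
    intro w hw p hp
    have : (fun s => w s p.2) =ᶠ[nhds p.1] fun _ => 0 := by
      have hc : Continuous (fun s : ℝ => (s, p.2)) := by fun_prop
      filter_upwards [(hU.preimage hc).mem_nhds (show (p.1, p.2) ∈ U from hp)] with s hs
      exact hw (s, p.2) hs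
    unfold dt
    rw [this.deriv_eq]; simp
  have step2 : ∀ w : ℝ → ℝ → ℝ, (∀ p ∈ U, w p.1 p.2 = 0) → ∀ p ∈ U, dz w p.1 p.2 = 0 := by
    intro w hw p hp
    have : (fun s => w p.1 s) =ᶠ[nhds p.2] fun _ => 0 := by
      have hc : Continuous (fun s : ℝ => (p.1, s)) := by fun_prop
      filter_upwards [(hU.preimage hc).mem_nhds (show (p.1, p.2) ∈ U from hp)] with s hs
      exact hw (p.1, s) hs
    unfold dz
    rw [this.deriv_eq]; simp
  have h1 : ∀ p ∈ U, DD q j y p.1 p.2 = 0 := by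
    induction q with
    | zero =>
      induction j with
      | zero => exact h0
      | succ j ih => rw [← hy.dt_DD]; exact step _ ih
    | succ q ih => rw [← dz_DD]; exact step2 _ ih
  intro p hp
  have hcl : IsClosed {p : ℝ × ℝ | DD q j y p.1 p.2 = 0} :=
    isClosed_eq (hy.DD q j).cont continuous_const
  exact closure_minimal h1 hcl hp

open MeasureTheory Real Set

/-! ### Weighted integrals -/

/-- The weighted integral `∫ z^r f² z^{N/2-1}`. -/
noncomputable def II (N : ℝ) (r : ℕ) (f : ℝ → ℝ) : ℝ :=
  ∫ z in (0:ℝ)..1, z ^ r * (f z) ^ 2 * z ^ (N / 2 - 1)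

theorem wt_cont {N : ℝ} (hN : 4 ≤ N) : Continuous (fun z : ℝ => z ^ (N / 2 - 1)) :=
  Real.continuous_rpow_const (by linarith)

theorem wt_nonneg {N z : ℝ} (hz : z ∈ Icc (0:ℝ) 1) : 0 ≤ z ^ (N / 2 - 1) :=
  Real.rpow_nonneg hz.1 _

theorem int01_mono {F G : ℝ → ℝ} (hF : Continuous F) (hG : Continuous G)
    (h : ∀ z ∈ Icc (0:ℝ) 1, F z ≤ G z) : ∫ z in (0:ℝ)..1, F z ≤ ∫ z in (0:ℝ)..1, G z :=
  intervalIntegral.integral_mono_on zero_le_one (hF.intervalIntegrable _ _)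
    (hG.intervalIntegrable _ _) h

theorem II_cont {N : ℝ} (hN : 4 ≤ N) (r : ℕ) {f : ℝ → ℝ} (hf : Continuous f) :
    Continuous (fun z : ℝ => z ^ r * (f z) ^ 2 * z ^ (N / 2 - 1)) := by
  have := wt_cont hN
  fun_prop

theorem II_nonneg (N : ℝ) (r : ℕ) (f : ℝ → ℝ) : 0 ≤ II N r f := by
  unfold II
  apply intervalIntegral.integral_nonneg zero_le_one
  intro z hz
  have := wt_nonneg (N := N) hz
  have := hz.1
  positivity

/-- Pointwise domination gives domination of the weighted integrals. -/
theorem II_le {N : ℝ} (hN : 4 ≤ N) {r r' : ℕ} {f g : ℝ → ℝ} (hf : Continuous f) (hg : Continuous g)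
    (c : ℝ) (h : ∀ z ∈ Icc (0:ℝ) 1, z ^ r * f z ^ 2 ≤ c * (z ^ r' * g z ^ 2)) :
    II N r f ≤ c * II N r' g := by
  unfold II
  rw [← intervalIntegral.integral_const_mul]
  apply int01_mono (II_cont hN r hf) ((II_cont hN r' hg).const_mul c)
  intro z hz
  have h1 := wt_nonneg (N := N) hz
  have := mul_le_mul_of_nonneg_right (h z hz) h1
  linarith

theorem II_le2 {N : ℝ} (hN : 4 ≤ N) {r r1 r2 : ℕ} {f g1 g2 : ℝ → ℝ} (hf : Continuous f)
    (hg1 : Continuous g1) (hg2 : Continuous g2) (c1 c2 : ℝ)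
    (h : ∀ z ∈ Icc (0:ℝ) 1,
      z ^ r * f z ^ 2 ≤ c1 * (z ^ r1 * g1 z ^ 2) + c2 * (z ^ r2 * g2 z ^ 2)) :
    II N r f ≤ c1 * II N r1 g1 + c2 * II N r2 g2 := by
  unfold II
  rw [← intervalIntegral.integral_const_mul, ← intervalIntegral.integral_const_mul,
    ← intervalIntegral.integral_add]
  · apply int01_mono (II_cont hN r hf)
      (((II_cont hN r1 hg1).const_mul c1).add ((II_cont hN r2 hg2).const_mul c2))
    intro z hz
    have h1 := wt_nonneg (N := N) hz
    have := mul_le_mul_of_nonneg_right (h z hz) h1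
    simp only [Pi.add_apply]
    linarith
  · exact ((II_cont hN r1 hg1).const_mul c1).intervalIntegrable _ _
  · exact ((II_cont hN r2 hg2).const_mul c2).intervalIntegrable _ _

/-- Fundamental theorem of calculus with the weight. -/
theorem ibp {N : ℝ} (hN : 4 ≤ N) (r : ℕ) {p p' : ℝ → ℝ} (hp : ∀ z, HasDerivAt p (p' z) z)
    (hp' : Continuous p') :
    ∫ z in (0:ℝ)..1, ((r + N / 2) * (z ^ r * p z) + z ^ r * (z * p' z)) * z ^ (N / 2 - 1) = p 1 := by
  have hpc : Continuous p := continuous_iff_continuousAt.2 fun z => (hp z).continuousAt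
  have hw := wt_cont hN
  have hF : Continuous (fun z : ℝ => z ^ r * z * z ^ (N / 2 - 1) * p z) := by fun_prop
  have h := intervalIntegral.integral_eq_sub_of_hasDerivAt_of_le (a := 0) (b := 1)
    (f := fun z : ℝ => z ^ r * z * z ^ (N / 2 - 1) * p z)
    (f' := fun z => ((r + N / 2) * (z ^ r * p z) + z ^ r * (z * p' z)) * z ^ (N / 2 - 1))
    zero_le_one hF.continuousOn ?_ ?_
  · rw [h]; simp
  · intro z hz
    have hz0 : 0 < z := hz.1
    have e : (fun z : ℝ => z ^ r * z * z ^ (N / 2 - 1)) =ᶠ[nhds z]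
        fun z => z ^ ((r : ℝ) + N / 2) := by
      filter_upwards [lt_mem_nhds hz0] with x hx
      rw [mul_assoc, ← Real.rpow_one_add' hx.le (by linarith), ← Real.rpow_natCast,
        ← Real.rpow_add hx]
      congr 1; ring
    have h1 : HasDerivAt (fun z : ℝ => z ^ r * z * z ^ (N / 2 - 1))
        ((r + N / 2) * (z ^ r * z ^ (N / 2 - 1))) z := by
      refine HasDerivAt.congr_of_eventuallyEq ?_ e
      have := Real.hasDerivAt_rpow_const (x := z) (p := (r : ℝ) + N / 2) (Or.inl hz0.ne')
      refine this.congr_deriv ?_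
      rw [← Real.rpow_natCast, ← Real.rpow_add hz0]
      congr 2; ring
    have := h1.mul (hp z)
    refine this.congr_deriv ?_
    ring
  · apply Continuous.intervalIntegrable
    fun_prop

/-- Hardy inequality. -/
theorem hardy {N : ℝ} (hN : 4 ≤ N) (r : ℕ) {u u' G : ℝ → ℝ} (hu : ∀ z, HasDerivAt u (u' z) z)
    (hu' : Continuous u') (hG : Continuous G) (c : ℝ) (hc : r + N / 2 + 2 ≤ 2 * c)
    (h : ∀ z, z * u' z + c * u z = G z) : II N r u ≤ II N r G := by
  have huc : Continuous u := continuous_iff_continuousAt.2 fun z => (hu z).continuousAt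
  have hw := wt_cont hN
  have h1 := ibp hN r (p := fun z => u z ^ 2) (p' := fun z => 2 * u z * u' z)
    (fun z => ((hu z).pow 2).congr_deriv (by simp)) (by fun_prop)
  have h2 : ∫ z in (0:ℝ)..1, ((r + N / 2) * (z ^ r * u z ^ 2) + z ^ r * (z * (2 * u z * u' z)))
      * z ^ (N / 2 - 1) ≤ II N r G - II N r u := by
    unfold II
    rw [← intervalIntegral.integral_sub ((II_cont hN r hG).intervalIntegrable _ _)
      ((II_cont hN r huc).intervalIntegrable _ _)]
    apply int01_mono (by fun_prop) (by fun_prop)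
    intro z hz
    have hz1 := wt_nonneg (N := N) hz
    rw [← sub_mul]
    apply mul_le_mul_of_nonneg_right _ hz1
    have hz0 : 0 ≤ z ^ r := pow_nonneg hz.1 r
    have : z * (2 * u z * u' z) = 2 * u z * (G z - c * u z) := by rw [← h z]; ring
    rw [this]
    have key : (r + N / 2) * u z ^ 2 + 2 * u z * (G z - c * u z) ≤ G z ^ 2 - u z ^ 2 := by
      nlinarith [sq_nonneg (G z - u z), sq_nonneg (u z)]
    calc _ = z ^ r * ((r + N / 2) * u z ^ 2 + 2 * u z * (G z - c * u z)) := by ring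
      _ ≤ z ^ r * (G z ^ 2 - u z ^ 2) := mul_le_mul_of_nonneg_left key hz0
      _ = _ := by ring
  rw [h1] at h2
  nlinarith [sq_nonneg (u 1)]

/-- Squared graded seminorms of a slice. -/
noncomputable def GG (N : ℝ) : ℕ → (ℝ → ℝ → ℝ) → ℝ → ℝ
  | 0 => fun y t => II N 0 (y t)
  | 1 => fun y t => II N 1 (dz y t)
  | k + 2 => fun y t => GG N k (DelT N y) t

theorem GG_nonneg (N : ℝ) (k : ℕ) (y : ℝ → ℝ → ℝ) (t : ℝ) : 0 ≤ GG N k y t := by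
  induction k using Nat.twoStepInduction generalizing y with
  | zero => exact II_nonneg _ _ _
  | one => exact II_nonneg _ _ _
  | more k ih _ => exact ih _

theorem Sm.contz {y : ℝ → ℝ → ℝ} (hy : Sm y) (t : ℝ) : Continuous (y t) :=
  (hy.slice t).continuous

/-- First half of elliptic regularity. -/
theorem ell_lt {N : ℝ} (hN : 4 ≤ N) {y : ℝ → ℝ → ℝ} (hy : Sm y) (t : ℝ) (q r : ℕ) (hr : r ≤ q) :
    II N r (DD (q + 1) 0 y t) ≤ II N r (DD q 0 (DelT N y) t) := by
  refine hardy hN r (u' := DD (q + 2) 0 y t) (fun z => ?_) ((hy.DD _ _).contz t)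
    (((hy.DelT N).DD _ _).contz t) (N / 2 + q) ?_ ?_
  · have := (hy.DD (q + 1) 0).hasDerivAt_z t z
    rwa [dz_DD] at this
  · have : (r : ℝ) ≤ q := by exact_mod_cast hr
    nlinarith
  · intro z
    rw [DD_DelT hy]

theorem G0 {N : ℝ} (hN : 4 ≤ N) (k : ℕ) : ∃ C > (0:ℝ), ∀ y : ℝ → ℝ → ℝ, Sm y → ∀ t, ∀ q r : ℕ,
    r ≤ q → 2 * q = k + r → II N r (DD q 0 y t) ≤ C * GG N k y t := by
  induction k using Nat.twoStepInduction with
  | zero =>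
    refine ⟨1, one_pos, fun y hy t q r h1 h2 => ?_⟩
    obtain rfl : q = 0 := by omega
    obtain rfl : r = 0 := by omega
    simp [GG, DD]
  | one =>
    refine ⟨1, one_pos, fun y hy t q r h1 h2 => ?_⟩
    obtain rfl : q = 1 := by omega
    obtain rfl : r = 1 := by omega
    simp [GG, DD]
  | more k ih _ =>
    obtain ⟨C, hC, ih⟩ := ih
    refine ⟨(2 + 2 * (N / 2 + k) ^ 2) * C, by positivity, fun y hy t q r h1 h2 => ?_⟩
    have hlt : ∀ q r : ℕ, r ≤ q → 2 * q = k + r →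
        II N r (DD (q + 1) 0 y t) ≤ C * GG N k (DelT N y) t := fun q r h1 h2 =>
      (ell_lt hN hy t q r h1).trans (ih _ (hy.DelT N) t q r h1 h2)
    have hG := GG_nonneg N k (DelT N y) t
    show _ ≤ (2 + 2 * (N / 2 + k) ^ 2) * C * GG N k (DelT N y) t
    rcases Nat.lt_or_ge r q with h | h
    · obtain ⟨q, rfl⟩ : ∃ q', q = q' + 1 := ⟨q - 1, by omega⟩
      refine (hlt q r (by omega) (by omega)).trans ?_
      rw [mul_assoc]
      have : 0 ≤ C * GG N k (DelT N y) t := by positivity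
      nlinarith [sq_nonneg (N / 2 + k)]
    · obtain rfl : q = k + 2 := by omega
      obtain rfl : r = k + 2 := by omega
      have e1 : II N (k + 2) (DD (k + 2) 0 y t) ≤ 2 * II N k (DD k 0 (DelT N y) t)
          + 2 * (N / 2 + k) ^ 2 * II N k (DD (k + 1) 0 y t) := by
        refine II_le2 hN ((hy.DD _ _).contz t) (((hy.DelT N).DD _ _).contz t)
          ((hy.DD _ _).contz t) _ _ ?_
        intro z hz
        rw [DD_DelT hy]
        have hz0 : 0 ≤ z ^ k := pow_nonneg hz.1 k
        have : z ^ (k + 2) * DD (k + 2) 0 y t z ^ 2 = z ^ k * (z * DD (k + 2) 0 y t z) ^ 2 := by ring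
        rw [this]
        have key : (z * DD (k + 2) 0 y t z) ^ 2
            ≤ 2 * (z * DD (k + 2) 0 y t z + (N / 2 + k) * DD (k + 1) 0 y t z) ^ 2
              + 2 * (N / 2 + k) ^ 2 * DD (k + 1) 0 y t z ^ 2 := by
          nlinarith [sq_nonneg (z * DD (k + 2) 0 y t z + 2 * (N / 2 + k) * DD (k + 1) 0 y t z)]
        calc _ ≤ z ^ k * _ := mul_le_mul_of_nonneg_left key hz0
          _ = _ := by ring
      have e2 := ih _ (hy.DelT N) t k k le_rfl (by omega)
      have e3 := hlt k k le_rfl (by omega)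
      have : 0 ≤ 2 * (N / 2 + k) ^ 2 := by positivity
      nlinarith [mul_le_mul_of_nonneg_left e3 this]

theorem G1 {N : ℝ} (hN : 4 ≤ N) (k : ℕ) : ∃ C > (0:ℝ), ∀ y : ℝ → ℝ → ℝ, Sm y → ∀ t X : ℝ,
    (∀ q r : ℕ, r ≤ q → 2 * q = k + r → II N r (DD q 0 y t) ≤ X) → GG N k y t ≤ C * X := by
  induction k using Nat.twoStepInduction with
  | zero =>
    refine ⟨1, one_pos, fun y hy t X h => ?_⟩
    simpa [GG, DD] using h 0 0 le_rfl (by omega)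
  | one =>
    refine ⟨1, one_pos, fun y hy t X h => ?_⟩
    simpa [GG, DD] using h 1 1 le_rfl (by omega)
  | more k ih _ =>
    obtain ⟨C, hC, ih⟩ := ih
    refine ⟨C * (2 + 2 * (N / 2 + k) ^ 2), by positivity, fun y hy t X h => ?_⟩
    show GG N k (DelT N y) t ≤ _
    rw [mul_assoc]
    refine ih _ (hy.DelT N) t _ fun q r h1 h2 => ?_
    have e1 : II N r (DD q 0 (DelT N y) t) ≤ 2 * II N (r + 2) (DD (q + 2) 0 y t)
        + 2 * (N / 2 + q) ^ 2 * II N r (DD (q + 1) 0 y t) := by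
      refine II_le2 hN (((hy.DelT N).DD _ _).contz t) ((hy.DD _ _).contz t)
        ((hy.DD _ _).contz t) _ _ ?_
      intro z hz
      rw [DD_DelT hy]
      have hz0 : 0 ≤ z ^ r := pow_nonneg hz.1 r
      have key : (z * DD (q + 2) 0 y t z + (N / 2 + q) * DD (q + 1) 0 y t z) ^ 2
          ≤ 2 * (z * DD (q + 2) 0 y t z) ^ 2 + 2 * ((N / 2 + q) * DD (q + 1) 0 y t z) ^ 2 := by
        nlinarith [sq_nonneg (z * DD (q + 2) 0 y t z - (N / 2 + q) * DD (q + 1) 0 y t z)]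
      calc _ ≤ z ^ r * _ := mul_le_mul_of_nonneg_left key hz0
        _ = _ := by ring
    have e2 := h (q + 2) (r + 2) (by omega) (by omega)
    have e3 := h (q + 1) r (by omega) (by omega)
    have hX : 0 ≤ X := (II_nonneg _ _ _).trans e2
    have hq : (q : ℝ) ≤ k := by exact_mod_cast (by omega : q ≤ k)
    have h5 : (N / 2 + q) ^ 2 ≤ (N / 2 + k) ^ 2 := by
      apply pow_le_pow_left₀ (by positivity); linarith
    have h6 := mul_le_mul h5 e3 (II_nonneg _ _ _) (by positivity)
    nlinarith

open MeasureTheory Real Set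

theorem G0' {N : ℝ} (hN : 4 ≤ N) (m : ℕ) : ∃ C > (0:ℝ), ∀ k ≤ m, ∀ y : ℝ → ℝ → ℝ, Sm y → ∀ t,
    ∀ q r : ℕ, r ≤ q → 2 * q = k + r → II N r (DD q 0 y t) ≤ C * GG N k y t := by
  choose C hC h using G0 hN
  refine ⟨∑ k ∈ Finset.range (m + 1), C k, Finset.sum_pos (fun k _ => hC k) (by simp), ?_⟩
  intro k hk y hy t q r h1 h2
  refine (h k y hy t q r h1 h2).trans ?_
  refine mul_le_mul_of_nonneg_right ?_ (GG_nonneg _ _ _ _)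
  exact Finset.single_le_sum (f := C) (fun k _ => (hC k).le) (Finset.mem_range.2 (by omega))

theorem G1' {N : ℝ} (hN : 4 ≤ N) (m : ℕ) : ∃ C > (0:ℝ), ∀ k ≤ m, ∀ y : ℝ → ℝ → ℝ, Sm y →
    ∀ t X : ℝ, (∀ q r : ℕ, r ≤ q → 2 * q = k + r → II N r (DD q 0 y t) ≤ X) →
      GG N k y t ≤ C * X := by
  choose C hC h using G1 hN
  refine ⟨∑ k ∈ Finset.range (m + 1), C k, Finset.sum_pos (fun k _ => hC k) (by simp), ?_⟩
  intro k hk y hy t X hX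
  refine (h k y hy t X hX).trans ?_
  have hX0 : 0 ≤ X := (II_nonneg _ _ _).trans (hX k k le_rfl (by omega))
  refine mul_le_mul_of_nonneg_right ?_ hX0
  exact Finset.single_le_sum (f := C) (fun k _ => (hC k).le) (Finset.mem_range.2 (by omega))

/-- Sum of all squared space-time seminorms of order at most `n`, at time `t`. -/
noncomputable def SS (N : ℝ) (n : ℕ) (y : ℝ → ℝ → ℝ) (t : ℝ) : ℝ :=
  ∑ j ∈ Finset.range (n + 1), ∑ k ∈ Finset.range (n + 1 - j), GG N k (dt^[j] y) t

theorem SS_nonneg (N : ℝ) (n : ℕ) (y : ℝ → ℝ → ℝ) (t : ℝ) : 0 ≤ SS N n y t :=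
  Finset.sum_nonneg fun _ _ => Finset.sum_nonneg fun _ _ => GG_nonneg _ _ _ _

theorem GG_le_SS (N : ℝ) {n j k : ℕ} (h : j + k ≤ n) (y : ℝ → ℝ → ℝ) (t : ℝ) :
    GG N k (dt^[j] y) t ≤ SS N n y t := by
  have h1 : GG N k (dt^[j] y) t ≤ ∑ k ∈ Finset.range (n + 1 - j), GG N k (dt^[j] y) t :=
    Finset.single_le_sum (f := fun k => GG N k (dt^[j] y) t) (fun _ _ => GG_nonneg _ _ _ _)
      (Finset.mem_range.2 (by omega))
  refine h1.trans ?_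
  exact Finset.single_le_sum
    (f := fun j => ∑ k ∈ Finset.range (n + 1 - j), GG N k (dt^[j] y) t)
    (fun _ _ => Finset.sum_nonneg fun _ _ => GG_nonneg _ _ _ _) (Finset.mem_range.2 (by omega))

theorem SS_le (N : ℝ) (n : ℕ) (y : ℝ → ℝ → ℝ) (t X : ℝ)
    (h : ∀ j k, j + k ≤ n → GG N k (dt^[j] y) t ≤ X) : SS N n y t ≤ (n + 1) ^ 2 * X := by
  have hX : 0 ≤ X := (GG_nonneg _ _ _ _).trans (h 0 0 (by omega))
  have h1 : ∀ j ∈ Finset.range (n + 1),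
      ∑ k ∈ Finset.range (n + 1 - j), GG N k (dt^[j] y) t ≤ (n + 1) * X := by
    intro j hj
    have : ∑ k ∈ Finset.range (n + 1 - j), GG N k (dt^[j] y) t
        ≤ ∑ k ∈ Finset.range (n + 1 - j), X := by
      refine Finset.sum_le_sum fun k hk => h j k ?_
      have := Finset.mem_range.1 hk
      omega
    refine this.trans ?_
    rw [Finset.sum_const, Finset.card_range, nsmul_eq_mul]
    refine mul_le_mul_of_nonneg_right ?_ hX
    exact_mod_cast Nat.sub_le _ _
  refine (Finset.sum_le_sum h1).trans ?_
  rw [Finset.sum_const, Finset.card_range, nsmul_eq_mul]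
  push_cast
  linarith

theorem SS_mono (N : ℝ) {m n : ℕ} (h : m ≤ n) (y : ℝ → ℝ → ℝ) (t : ℝ) :
    SS N m y t ≤ SS N n y t := by
  unfold SS
  have h1 : ∀ j ∈ Finset.range (m + 1), ∑ k ∈ Finset.range (m + 1 - j), GG N k (dt^[j] y) t
      ≤ ∑ k ∈ Finset.range (n + 1 - j), GG N k (dt^[j] y) t := by
    intro j _
    apply Finset.sum_le_sum_of_subset_of_nonneg
    · exact Finset.range_mono (by omega)
    · intro _ _ _; exact GG_nonneg _ _ _ _
  refine (Finset.sum_le_sum h1).trans ?_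
  apply Finset.sum_le_sum_of_subset_of_nonneg
  · exact Finset.range_mono (by omega)
  · intro _ _ _; exact Finset.sum_nonneg fun _ _ => GG_nonneg _ _ _ _

theorem DD_split {y : ℝ → ℝ → ℝ} (q j : ℕ) : DD q j y = DD q 0 (dt^[j] y) := rfl

theorem piece_le {N : ℝ} (hN : 4 ≤ N) (m : ℕ) : ∃ C > (0:ℝ), ∀ n ≤ m, ∀ y : ℝ → ℝ → ℝ, Sm y →
    ∀ t, ∀ q r j : ℕ, r ≤ q → 2 * q + j ≤ n + r → II N r (DD q j y t) ≤ C * SS N n y t := by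
  obtain ⟨C, hC, h⟩ := G0' hN m
  refine ⟨C, hC, fun n hn y hy t q r j h1 h2 => ?_⟩
  rw [DD_split]
  refine (h (2 * q - r) (by omega) _ (hy.dt_iter j) t q r h1 (by omega)).trans ?_
  exact mul_le_mul_of_nonneg_left (GG_le_SS N (by omega) y t) hC.le

theorem SS_of_pieces {N : ℝ} (hN : 4 ≤ N) (n : ℕ) : ∃ C > (0:ℝ), ∀ y : ℝ → ℝ → ℝ, Sm y →
    ∀ t X : ℝ, (∀ q r j : ℕ, r ≤ q → 2 * q + j ≤ n + r → II N r (DD q j y t) ≤ X) →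
      SS N n y t ≤ C * X := by
  obtain ⟨C, hC, h⟩ := G1' hN n
  refine ⟨(n + 1) ^ 2 * C, by positivity, fun y hy t X hX => ?_⟩
  rw [mul_assoc]
  refine SS_le N n y t _ fun j k hjk => ?_
  refine h k (by omega) _ (hy.dt_iter j) t X fun q r h1 h2 => ?_
  exact hX q r j h1 (by omega)

theorem SS_DelT {N : ℝ} (n : ℕ) {y : ℝ → ℝ → ℝ} (hy : Sm y) (t : ℝ) :
    SS N n (DelT N y) t ≤ (n + 1) ^ 2 * SS N (n + 2) y t := by
  refine SS_le N n _ t _ fun j k hjk => ?_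
  rw [dt_iter_DelT hy]
  exact GG_le_SS N (n := n + 2) (j := j) (k := k + 2) (by omega) y t

theorem II_shift_le {N : ℝ} (hN : 4 ≤ N) {r r' : ℕ} (h : r' ≤ r) {f : ℝ → ℝ} (hf : Continuous f) :
    II N r f ≤ II N r' f := by
  have := II_le hN (r := r) (r' := r') hf hf 1 (fun z hz => by
    rw [one_mul]
    exact mul_le_mul_of_nonneg_right (pow_le_pow_of_le_one hz.1 hz.2 h) (sq_nonneg _))
  linarith

theorem SS_zdz {N : ℝ} (hN : 4 ≤ N) (m : ℕ) : ∃ C > (0:ℝ), ∀ n ≤ m, ∀ y : ℝ → ℝ → ℝ, Sm y →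
    ∀ t, SS N n (fun t z => z * dz y t z) t ≤ C * SS N (n + 1) y t := by
  choose C1 hC1 h1 using SS_of_pieces hN
  obtain ⟨C2, hC2, h2⟩ := piece_le hN (m + 1)
  have hsum : ∀ n ≤ m, C1 n ≤ ∑ n ∈ Finset.range (m + 1), C1 n := fun n hn =>
    Finset.single_le_sum (f := C1) (fun k _ => (hC1 k).le) (Finset.mem_range.2 (by omega))
  refine ⟨(∑ n ∈ Finset.range (m + 1), C1 n) * (2 * C2 + 2 * m ^ 2 * C2),
    mul_pos (Finset.sum_pos (fun k _ => hC1 k) (by simp)) (by positivity), ?_⟩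
  intro n hn y hy t
  have hS := SS_nonneg N (n + 1) y t
  refine (h1 n _ hy.dz.zmul t ((2 * C2 + 2 * m ^ 2 * C2) * SS N (n + 1) y t) ?_).trans ?_
  swap
  · rw [← mul_assoc]
    exact mul_le_mul_of_nonneg_right (mul_le_mul_of_nonneg_right (hsum n hn) (by positivity)) hS
  intro q r j hr hq
  have edz : dz y = DD 1 0 y := rfl
  have key : II N (r + 2) (DD (q + 1) j y t) ≤ C2 * SS N (n + 1) y t := by
    rcases Nat.lt_or_ge r q with h | h
    · exact h2 (n + 1) (by omega) y hy t (q + 1) (r + 2) j (by omega) (by omega)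
    · refine (II_shift_le hN (r' := r + 1) (by omega) ((hy.DD _ _).contz t)).trans ?_
      exact h2 (n + 1) (by omega) y hy t (q + 1) (r + 1) j (by omega) (by omega)
  cases q with
  | zero =>
    have : II N r (DD 0 j (fun t z => z * dz y t z) t) ≤ 1 * II N (r + 2) (DD (0 + 1) j y t) := by
      refine II_le hN ((hy.dz.zmul.DD _ _).contz t) ((hy.DD _ _).contz t) 1 fun z hz => ?_
      rw [DD_zmul0 hy.dz, edz, DD_DD hy]
      simp only [add_zero]
      apply le_of_eq; ring
    have h0 : 0 ≤ (C2 + 2 * m ^ 2 * C2) * SS N (n + 1) y t := by positivity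
    linarith
  | succ q =>
    have e1 : II N r (DD (q + 1) j (fun t z => z * dz y t z) t)
        ≤ 2 * II N (r + 2) (DD (q + 1 + 1) j y t)
          + 2 * ((q:ℝ) + 1) ^ 2 * II N r (DD (q + 1) j y t) := by
      refine II_le2 hN ((hy.dz.zmul.DD _ _).contz t) ((hy.DD _ _).contz t)
        ((hy.DD _ _).contz t) _ _ fun z hz => ?_
      rw [DD_zmul hy.dz, edz, DD_DD hy, DD_DD hy]
      simp only [add_zero]
      have hz0 : 0 ≤ z ^ r := pow_nonneg hz.1 r
      have key : (z * DD (q + 1 + 1) j y t z + ((q:ℝ) + 1) * DD (q + 1) j y t z) ^ 2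
          ≤ 2 * (z * DD (q + 1 + 1) j y t z) ^ 2 + 2 * (((q:ℝ) + 1) * DD (q + 1) j y t z) ^ 2 := by
        nlinarith [sq_nonneg (z * DD (q + 1 + 1) j y t z - ((q:ℝ) + 1) * DD (q + 1) j y t z)]
      calc _ ≤ z ^ r * _ := mul_le_mul_of_nonneg_left key hz0
        _ = _ := by ring
    have e2 : II N r (DD (q + 1) j y t) ≤ C2 * SS N (n + 1) y t :=
      h2 (n + 1) (by omega) y hy t (q + 1) r j hr (by omega)
    have hqm : ((q:ℝ) + 1) ≤ m := by exact_mod_cast (by omega : q + 1 ≤ m)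
    have hqm2 : ((q:ℝ) + 1) ^ 2 ≤ (m:ℝ) ^ 2 := pow_le_pow_left₀ (by positivity) hqm 2
    have h6 := mul_le_mul hqm2 e2 (II_nonneg _ _ _) (by positivity)
    nlinarith

theorem II_sum {N : ℝ} (hN : 4 ≤ N) (r : ℕ) {ι : Type*} (s : Finset ι) {F : ι → ℝ → ℝ}
    (hF : ∀ i, Continuous (F i)) :
    II N r (fun z => ∑ i ∈ s, F i z) ≤ s.card * ∑ i ∈ s, II N r (F i) := by
  unfold II
  rw [← intervalIntegral.integral_finsetSum
    (fun i _ => (II_cont hN r (hF i)).intervalIntegrable _ _),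
    ← intervalIntegral.integral_const_mul]
  have hw := wt_cont hN
  apply int01_mono (II_cont hN r (by fun_prop))
  · exact (continuous_finsetSum _ fun i _ => II_cont hN r (hF i)).const_mul _
  intro z hz
  have h1 := wt_nonneg (N := N) hz
  have hz0 : 0 ≤ z ^ r := pow_nonneg hz.1 r
  have h2 : (∑ i ∈ s, F i z) ^ 2 ≤ s.card * ∑ i ∈ s, F i z ^ 2 := sq_sum_le_card_mul_sum_sq
  have h3 := mul_le_mul_of_nonneg_right (mul_le_mul_of_nonneg_left h2 hz0) h1
  refine h3.trans (le_of_eq ?_)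
  rw [← Finset.sum_mul, ← Finset.mul_sum]
  ring

/-- Coefficient bounds at time `t`. -/
def CB (a : ℕ → ℝ) (b : ℝ → ℝ → ℝ) (t : ℝ) : Prop :=
  ∀ p r i s : ℕ, r ≤ p → 2 * p + i = s + r → ∀ z ∈ Icc (0:ℝ) 1, z ^ r * DD p i b t z ^ 2 ≤ a s

theorem CB.nonneg {a : ℕ → ℝ} {b : ℝ → ℝ → ℝ} {t : ℝ} (h : CB a b t) (s : ℕ) : 0 ≤ a s := by
  have := h s s 0 s le_rfl (by omega) 0 (by simp)
  refine le_trans ?_ this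
  positivity

theorem comm_le {N : ℝ} (hN : 4 ≤ N) (m : ℕ) : ∃ C > (0:ℝ), ∀ b f : ℝ → ℝ → ℝ, Sm b → Sm f →
    ∀ (t : ℝ) (a : ℕ → ℝ), CB a b t → ∀ q r j : ℕ, r ≤ q → 2 * q + j = m + r →
    II N r (fun z => DD q j (fun t z => b t z * f t z) t z - b t z * DD q j f t z)
      ≤ C * ∑ s ∈ Finset.Icc 1 m, a s * SS N (m - s) f t := by
  obtain ⟨C, hC, hp⟩ := piece_le hN m
  refine ⟨((m + 1) ^ 2) * ((m + 1) ^ 2 * ((4 ^ m) ^ 2 * C)), by positivity, ?_⟩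
  intro b f hb hf t a ha q r j hr hm
  set R := Finset.range (j + 1) ×ˢ Finset.range (q + 1) with hR
  set Q := ∑ s ∈ Finset.Icc 1 m, a s * SS N (m - s) f t with hQ
  have hQ0 : 0 ≤ Q := Finset.sum_nonneg fun s _ => mul_nonneg (ha.nonneg s) (SS_nonneg _ _ _ _)
  have e : (fun z => DD q j (fun t z => b t z * f t z) t z - b t z * DD q j f t z)
      = fun z => ∑ x ∈ R.erase (0, 0), ((j.choose x.1 * q.choose x.2 : ℕ) : ℝ)
          * (DD x.2 x.1 b t z * DD (q - x.2) (j - x.1) f t z) := by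
    funext z
    rw [DD_mul hb hf]
    have h00 : ((0, 0) : ℕ × ℕ) ∈ R := by simp [hR]
    simp only
    rw [← Finset.add_sum_erase _ _ h00]
    simp [DD]
  rw [e]
  refine (II_sum hN r _ (fun x => ?_)).trans ?_
  · exact ((((hb.DD _ _).contz t).mul ((hf.DD _ _).contz t)).const_mul _)
  have hcard : ((R.erase (0, 0)).card : ℝ) ≤ (m + 1) ^ 2 := by
    have h1 : (R.erase (0, 0)).card ≤ R.card := Finset.card_le_card (Finset.erase_subset _ _)
    have h2 : R.card = (j + 1) * (q + 1) := by simp [hR]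
    have h3 : (j + 1) * (q + 1) ≤ (m + 1) * (m + 1) :=
      Nat.mul_le_mul (by omega) (by omega)
    have : (R.erase (0, 0)).card ≤ (m + 1) ^ 2 := by rw [sq]; omega
    exact_mod_cast this
  have hterm : ∀ x ∈ R.erase (0, 0), II N r (fun z => ((j.choose x.1 * q.choose x.2 : ℕ) : ℝ)
          * (DD x.2 x.1 b t z * DD (q - x.2) (j - x.1) f t z)) ≤ (4 ^ m) ^ 2 * C * Q := by
    intro x hx
    obtain ⟨i, p⟩ := x
    simp only [hR, Finset.mem_erase, Finset.mem_product, Finset.mem_range, ne_eq, Prod.mk.injEq] at hx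
    obtain ⟨hx0, hi, hpq⟩ := hx
    set r1 := min p r with hr1
    set s := 2 * p + i - r1 with hs
    have hs1 : 1 ≤ s := by omega
    have hsm : s ≤ m := by omega
    have hch : (((j.choose i * q.choose p : ℕ) : ℝ)) ≤ 4 ^ m := by
      have h1 : j.choose i ≤ 2 ^ j := Nat.choose_le_two_pow _ _
      have h2 : q.choose p ≤ 2 ^ q := Nat.choose_le_two_pow _ _
      have h3 : j.choose i * q.choose p ≤ 2 ^ j * 2 ^ q := Nat.mul_le_mul h1 h2
      have h4 : 2 ^ j * 2 ^ q ≤ 4 ^ m := by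
        rw [← pow_add, show 4 = 2 ^ 2 from rfl, ← pow_mul]
        exact Nat.pow_le_pow_right (by norm_num) (by omega)
      exact_mod_cast h3.trans h4
    have h1 : II N r (fun z => ((j.choose i * q.choose p : ℕ) : ℝ)
          * (DD p i b t z * DD (q - p) (j - i) f t z))
        ≤ ((4 ^ m) ^ 2 * a s) * II N (r - r1) (DD (q - p) (j - i) f t) := by
      refine II_le hN ((((hb.DD _ _).contz t).mul ((hf.DD _ _).contz t)).const_mul _)
        ((hf.DD _ _).contz t) _ fun z hz => ?_
      have hb1 := ha p r1 i s (by omega) (by omega) z hz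
      have hz2 : z ^ r = z ^ r1 * z ^ (r - r1) := by rw [← pow_add]; congr 1; omega
      have hz3 : 0 ≤ z ^ (r - r1) := pow_nonneg hz.1 _
      have hc2 : (((j.choose i * q.choose p : ℕ) : ℝ)) ^ 2 ≤ (4 ^ m) ^ 2 :=
        pow_le_pow_left₀ (by positivity) hch 2
      rw [hz2]
      simp only [Pi.mul_apply]
      calc _ = (((j.choose i * q.choose p : ℕ) : ℝ)) ^ 2 * (z ^ r1 * DD p i b t z ^ 2)
              * (z ^ (r - r1) * DD (q - p) (j - i) f t z ^ 2) := by ring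
        _ ≤ _ := by
          refine mul_le_mul_of_nonneg_right ?_ (by positivity)
          refine mul_le_mul hc2 hb1 ?_ (by positivity)
          have := pow_nonneg hz.1 r1
          positivity
    refine h1.trans ?_
    have h2 := hp (m - s) (by omega) f hf t (q - p) (r - r1) (j - i) (by omega) (by omega)
    have h3 : a s * SS N (m - s) f t ≤ Q :=
      Finset.single_le_sum (f := fun s => a s * SS N (m - s) f t)
        (fun s _ => mul_nonneg (ha.nonneg s) (SS_nonneg _ _ _ _)) (Finset.mem_Icc.2 ⟨hs1, hsm⟩)
    have h4 : 0 ≤ (4 ^ m) ^ 2 * a s := mul_nonneg (by positivity) (ha.nonneg s)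
    calc _ ≤ (4 ^ m) ^ 2 * a s * (C * SS N (m - s) f t) := mul_le_mul_of_nonneg_left h2 h4
      _ = (4 ^ m) ^ 2 * C * (a s * SS N (m - s) f t) := by ring
      _ ≤ _ := mul_le_mul_of_nonneg_left h3 (by positivity)
  have hsum := Finset.sum_le_card_nsmul _ _ _ hterm
  rw [nsmul_eq_mul] at hsum
  have h5 : 0 ≤ (4 ^ m) ^ 2 * C * Q := by positivity
  calc _ ≤ ((R.erase (0, 0)).card : ℝ) * (((R.erase (0, 0)).card : ℝ) * ((4 ^ m) ^ 2 * C * Q)) :=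
        mul_le_mul_of_nonneg_left hsum (by positivity)
    _ ≤ (m + 1) ^ 2 * ((m + 1) ^ 2 * ((4 ^ m) ^ 2 * C * Q)) := by
        refine mul_le_mul hcard (mul_le_mul_of_nonneg_right hcard h5) (by positivity) (by positivity)
    _ = _ := by ring

theorem prod_le {N : ℝ} (hN : 4 ≤ N) (m : ℕ) : ∃ C > (0:ℝ), ∀ b f : ℝ → ℝ → ℝ, Sm b → Sm f →
    ∀ (t : ℝ) (a : ℕ → ℝ), CB a b t → ∀ q r j : ℕ, r ≤ q → 2 * q + j = m + r →
    II N r (DD q j (fun t z => b t z * f t z) t)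
      ≤ C * (a 0 * SS N m f t + ∑ s ∈ Finset.Icc 1 m, a s * SS N (m - s) f t) := by
  obtain ⟨C, hC, hp⟩ := comm_le hN m
  obtain ⟨C', hC', hp'⟩ := piece_le hN m
  refine ⟨2 * C + 2 * C', by positivity, ?_⟩
  intro b f hb hf t a ha q r j hr hm
  have h1 := hp b f hb hf t a ha q r j hr hm
  have h2 := hp' m le_rfl f hf t q r j hr (by omega)
  have hc1 : Continuous (fun z => DD q j (fun t z => b t z * f t z) t z - b t z * DD q j f t z) :=
    (((hb.mul hf).DD q j).contz t).sub ((hb.contz t).mul ((hf.DD q j).contz t))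
  have h3 := II_le2 hN (r := r) (r1 := r) (r2 := r) (((hb.mul hf).DD q j).contz t) hc1
    ((hf.DD q j).contz t) 2 (2 * a 0) (fun z hz => by
      have hz0 : 0 ≤ z ^ r := pow_nonneg hz.1 r
      have hb0 := ha 0 0 0 0 le_rfl rfl z hz
      simp only [pow_zero, one_mul] at hb0
      have e : DD 0 0 b t z = b t z := rfl
      rw [e] at hb0
      set A := DD q j (fun t z => b t z * f t z) t z
      set F := DD q j f t z
      have k1 : A ^ 2 ≤ 2 * (A - b t z * F) ^ 2 + 2 * (b t z ^ 2 * F ^ 2) := by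
        nlinarith [sq_nonneg (A - 2 * (b t z * F))]
      have k2 : b t z ^ 2 * F ^ 2 ≤ a 0 * F ^ 2 := mul_le_mul_of_nonneg_right hb0 (sq_nonneg _)
      calc _ ≤ z ^ r * (2 * (A - b t z * F) ^ 2 + 2 * (a 0 * F ^ 2)) :=
            mul_le_mul_of_nonneg_left (by linarith) hz0
        _ = _ := by ring)
  have h4 := mul_le_mul_of_nonneg_left h2 (ha.nonneg 0)
  have h5 : 0 ≤ ∑ s ∈ Finset.Icc 1 m, a s * SS N (m - s) f t :=
    Finset.sum_nonneg fun s _ => mul_nonneg (ha.nonneg s) (SS_nonneg _ _ _ _)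
  have h6 : 0 ≤ a 0 * SS N m f t := mul_nonneg (ha.nonneg 0) (SS_nonneg _ _ _ _)
  have h7 := mul_nonneg hC.le h6
  have h8 := mul_nonneg hC'.le h5
  nlinarith

open MeasureTheory Real Set

/-- The hypotheses on the solution, differentiated and put in a convenient form. -/
structure Sol (N T : ℝ) (b₂ b₁ b₀ g h : ℝ → ℝ → ℝ) : Prop where
  hb2 : Sm b₂
  hb1 : Sm b₁
  hb0 : Sm b₀
  hg : Sm g
  hh : Sm h
  lo : ∀ t ∈ Icc (0:ℝ) T, ∀ z ∈ Icc (0:ℝ) 1, |b₂ t z - 1| ≤ 1 / 2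
  eq : ∀ q j : ℕ, ∀ t ∈ Icc (0:ℝ) T, ∀ z ∈ Icc (0:ℝ) 1,
    DD q j (fun t z => b₂ t z * DelT N h t z) t z
      = DD q (j + 2) h t z + DD q j (fun t z => b₁ t z * (z * dz h t z)) t z
        + DD q j (fun t z => b₀ t z * h t z) t z - DD q j g t z
  h0 : ∀ (q j : ℕ) (z : ℝ), DD q j h 0 z = 0
  g0 : ∀ (q j : ℕ) (z : ℝ), DD q j g 0 z = 0
  bd : ∀ j : ℕ, ∀ t ∈ Icc (0:ℝ) T, DD 0 j h t 1 = 0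

theorem DD_zero_at {y : ℝ → ℝ → ℝ} (hy : Sm y) {τ : ℝ} (hτ : 0 < τ)
    (h0 : ∀ t ∈ Icc (0:ℝ) τ, ∀ z : ℝ, y t z = 0) (q j : ℕ) (z : ℝ) : DD q j y 0 z = 0 := by
  refine DD_zero_of_open hy (U := Ioo 0 τ ×ˢ univ) (isOpen_Ioo.prod isOpen_univ)
    (fun p hp => h0 p.1 ⟨hp.1.1.le, hp.1.2.le⟩ p.2) q j (0, z) ?_
  rw [closure_prod_eq, closure_Ioo hτ.ne]
  exact ⟨⟨le_rfl, hτ.le⟩, by simp⟩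

theorem sol_of {N T : ℝ} {b₂ b₁ b₀ g h : ℝ → ℝ → ℝ} {τ : ℝ} (hτ : τ ∈ Ioo (0:ℝ) T)
    (hb2 : Sm b₂) (hb1 : Sm b₁) (hb0 : Sm b₀) (hg : Sm g) (hh : Sm h)
    (lo : ∀ t ∈ Icc (0:ℝ) T, ∀ z ∈ Icc (0:ℝ) 1, |b₂ t z - 1| ≤ 1 / 2)
    (g0 : ∀ t ∈ Icc (0:ℝ) τ, ∀ z : ℝ, g t z = 0)
    (eq : ∀ t ∈ Icc (0:ℝ) T, ∀ z ∈ Ioo (0:ℝ) 1,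
        dt (dt h) t z + opA N b₂ b₁ b₀ h t z = g t z)
    (bd : ∀ t ∈ Icc (0:ℝ) T, h t 1 = 0)
    (h0 : ∀ t ∈ Icc (0:ℝ) τ, ∀ z : ℝ, h t z = 0) : Sol N T b₂ b₁ b₀ g h := by
  have hT : 0 < T := hτ.1.trans hτ.2
  refine ⟨hb2, hb1, hb0, hg, hh, lo, ?_, DD_zero_at hh hτ.1 h0, DD_zero_at hg hτ.1 g0, ?_⟩
  · intro q j t ht z hz
    have s1 := hb2.mul (hh.DelT N)
    have s2 := hb1.mul hh.dz.zmul
    have s3 := hb0.mul hh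
    have s4 : Sm (dt (dt h)) := hh.dt.dt
    have hR := (((s1.sub s4).sub s2).sub s3).add hg
    have key := DD_zero_of_open hR (U := Ioo 0 T ×ˢ Ioo 0 1) (isOpen_Ioo.prod isOpen_Ioo)
      (fun p hp => by
        have := eq p.1 ⟨hp.1.1.le, hp.1.2.le⟩ p.2 hp.2
        unfold opA at this
        simp only [DelT, dz]
        linarith) q j (t, z) (by
          rw [closure_prod_eq, closure_Ioo hT.ne, closure_Ioo zero_ne_one]
          exact ⟨ht, hz⟩)
    rw [DD_add (((s1.sub s4).sub s2).sub s3) hg, DD_sub ((s1.sub s4).sub s2) s3,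
      DD_sub (s1.sub s4) s2, DD_sub s1 s4] at key
    have e : DD q j (dt (dt h)) = DD q (j + 2) h := by
      have : dt (dt h) = DD 0 2 h := rfl
      rw [this, DD_DD hh]; simp
    rw [e] at key
    simp only at key
    linarith
  · intro j t ht
    set y : ℝ → ℝ → ℝ := fun t _ => h t 1 with hydef
    have hy : Sm y := ContDiff.comp (g := fun p : ℝ × ℝ => h p.1 p.2)
      (f := fun p : ℝ × ℝ => (p.1, (1:ℝ))) hh (contDiff_fst.prodMk contDiff_const)
    have e : ∀ j, DD 0 j y = fun t _ => DD 0 j h t 1 := by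
      intro j
      induction j with
      | zero => rfl
      | succ j ih =>
        rw [← hy.dt_DD, ih, ← hh.dt_DD]
        rfl
    have key := DD_zero_of_open hy (U := Ioo 0 T ×ˢ univ) (isOpen_Ioo.prod isOpen_univ)
      (fun p hp => bd p.1 ⟨hp.1.1.le, hp.1.2.le⟩) 0 j (t, 1) (by
        rw [closure_prod_eq, closure_Ioo hT.ne]
        exact ⟨ht, by simp⟩)
    rw [e] at key
    exact key

theorem II_add {N : ℝ} (hN : 4 ≤ N) (r : ℕ) {f g : ℝ → ℝ} (hf : Continuous f) (hg : Continuous g) :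
    II N r (fun z => f z + g z) ≤ 2 * II N r f + 2 * II N r g := by
  refine II_le2 hN (hf.add hg) hf hg 2 2 fun z hz => ?_
  have hz0 : 0 ≤ z ^ r := pow_nonneg hz.1 r
  have : (f z + g z) ^ 2 ≤ 2 * f z ^ 2 + 2 * g z ^ 2 := by nlinarith [sq_nonneg (f z - g z)]
  calc _ ≤ z ^ r * (2 * f z ^ 2 + 2 * g z ^ 2) := mul_le_mul_of_nonneg_left this hz0
    _ = _ := by ring

theorem II_sub {N : ℝ} (hN : 4 ≤ N) (r : ℕ) {f g : ℝ → ℝ} (hf : Continuous f) (hg : Continuous g) :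
    II N r (fun z => f z - g z) ≤ 2 * II N r f + 2 * II N r g := by
  refine II_le2 hN (hf.sub hg) hf hg 2 2 fun z hz => ?_
  have hz0 : 0 ≤ z ^ r := pow_nonneg hz.1 r
  have : (f z - g z) ^ 2 ≤ 2 * f z ^ 2 + 2 * g z ^ 2 := by nlinarith [sq_nonneg (f z + g z)]
  calc _ ≤ z ^ r * (2 * f z ^ 2 + 2 * g z ^ 2) := mul_le_mul_of_nonneg_left this hz0
    _ = _ := by ring

/-- The error terms of order `m`. -/
noncomputable def QQ (N : ℝ) (m : ℕ) (a : ℕ → ℝ) (h : ℝ → ℝ → ℝ) (t : ℝ) : ℝ :=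
  a 1 * SS N (m + 1) h t + ∑ s ∈ Finset.Icc 1 m, a s * SS N (m + 2 - s) h t

theorem src_le {N : ℝ} (hN : 4 ≤ N) (m : ℕ) : ∃ C > (0:ℝ), ∀ b h : ℝ → ℝ → ℝ, Sm b → Sm h →
    ∀ (t : ℝ) (a : ℕ → ℝ), Monotone a → CB a b t → ∀ q r j : ℕ, r ≤ q → 2 * q + j = m + r →
    II N r (fun z => DD q j (fun t z => b t z * DelT N h t z) t z - b t z * DD q j (DelT N h) t z)
      ≤ C * QQ N m a h t ∧
    II N r (DD q j (fun t z => b t z * (z * dz h t z)) t) ≤ C * QQ N m a h t ∧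
    II N r (DD q j (fun t z => b t z * h t z) t) ≤ C * QQ N m a h t := by
  obtain ⟨C1, hC1, h1⟩ := comm_le hN m
  obtain ⟨C2, hC2, h2⟩ := prod_le hN m
  obtain ⟨C3, hC3, h3⟩ := SS_zdz hN m
  refine ⟨C1 * (m + 1) ^ 2 + C2 * C3 + C2, by positivity, ?_⟩
  intro b h hb hh t a hmono ha q r j hr hm
  have hQ : 0 ≤ QQ N m a h t := add_nonneg (mul_nonneg (ha.nonneg _) (SS_nonneg _ _ _ _))
    (Finset.sum_nonneg fun s _ => mul_nonneg (ha.nonneg s) (SS_nonneg _ _ _ _))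
  have hd : ∀ c x : ℝ, 0 < c → c ≤ C1 * (m + 1) ^ 2 + C2 * C3 + C2 → x ≤ c * QQ N m a h t →
      x ≤ (C1 * (m + 1) ^ 2 + C2 * C3 + C2) * QQ N m a h t := fun c x _ hc hx =>
    hx.trans (mul_le_mul_of_nonneg_right hc hQ)
  have p1 : 0 < C1 * ((m:ℝ) + 1) ^ 2 := by positivity
  have p2 : 0 < C2 * C3 := by positivity
  have h01 : a 0 ≤ a 1 := hmono (by norm_num)
  refine ⟨hd _ _ p1 (by linarith) ?_, hd _ _ p2 (by linarith) ?_, hd _ _ hC2 (by linarith) ?_⟩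
  · refine (h1 b _ hb (hh.DelT N) t a ha q r j hr hm).trans ?_
    rw [mul_assoc]
    refine mul_le_mul_of_nonneg_left ?_ hC1.le
    unfold QQ
    rw [mul_add, Finset.mul_sum]
    have : 0 ≤ ((m:ℝ) + 1) ^ 2 * (a 1 * SS N (m + 1) h t) :=
      mul_nonneg (by positivity) (mul_nonneg (ha.nonneg _) (SS_nonneg _ _ _ _))
    refine le_add_of_nonneg_of_le this (Finset.sum_le_sum fun s hs => ?_)
    have hs' := Finset.mem_Icc.1 hs
    have k1 := SS_DelT (N := N) (m - s) hh t
    rw [show m - s + 2 = m + 2 - s by omega] at k1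
    have k2 : (((m - s : ℕ) : ℝ) + 1) ^ 2 ≤ ((m:ℝ) + 1) ^ 2 := by
      have : ((m - s : ℕ) : ℝ) ≤ m := by exact_mod_cast Nat.sub_le _ _
      gcongr
    have k3 := mul_le_mul_of_nonneg_right k2 (SS_nonneg N (m + 2 - s) h t)
    calc _ ≤ a s * (((m:ℝ) + 1) ^ 2 * SS N (m + 2 - s) h t) :=
          mul_le_mul_of_nonneg_left (k1.trans k3) (ha.nonneg s)
      _ = _ := by ring
  · refine (h2 b _ hb hh.dz.zmul t a ha q r j hr hm).trans ?_
    rw [mul_assoc]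
    refine mul_le_mul_of_nonneg_left ?_ hC2.le
    unfold QQ
    rw [mul_add, Finset.mul_sum]
    refine add_le_add ?_ (Finset.sum_le_sum fun s hs => ?_)
    · have k1 := h3 m le_rfl h hh t
      calc _ ≤ a 1 * (C3 * SS N (m + 1) h t) :=
            mul_le_mul h01 k1 (SS_nonneg _ _ _ _) (ha.nonneg _)
        _ = _ := by ring
    · have k1 := h3 (m - s) (by omega) h hh t
      have k2 : SS N (m - s + 1) h t ≤ SS N (m + 2 - s) h t := SS_mono N (by
        have := Finset.mem_Icc.1 hs
        omega) h t
      calc _ ≤ a s * (C3 * SS N (m + 2 - s) h t) :=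
            mul_le_mul_of_nonneg_left (k1.trans (mul_le_mul_of_nonneg_left k2 hC3.le))
              (ha.nonneg _)
        _ = _ := by ring
  · refine (h2 b _ hb hh t a ha q r j hr hm).trans ?_
    refine mul_le_mul_of_nonneg_left ?_ hC2.le
    unfold QQ
    refine add_le_add ?_ (Finset.sum_le_sum fun s hs => ?_)
    · exact mul_le_mul h01 (SS_mono N (by omega) h t) (SS_nonneg _ _ _ _) (ha.nonneg _)
    · exact mul_le_mul_of_nonneg_left (SS_mono N (by omega) h t) (ha.nonneg _)

/-- The purely temporal top-order energy. -/
noncomputable def TT (N : ℝ) (m : ℕ) (h : ℝ → ℝ → ℝ) (t : ℝ) : ℝ :=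
  II N 0 (DD 0 (m + 2) h t) + II N 1 (DD 1 (m + 1) h t)

theorem elliptic {N : ℝ} (hN : 4 ≤ N) (m : ℕ) : ∃ C > (0:ℝ), ∀ (T : ℝ) (b₂ b₁ b₀ g h : ℝ → ℝ → ℝ),
    Sol N T b₂ b₁ b₀ g h → ∀ t ∈ Icc (0:ℝ) T, ∀ a : ℕ → ℝ, Monotone a → 1 ≤ a 1 →
    CB a b₂ t → CB a b₁ t → CB a b₀ t →
    SS N (m + 2) h t ≤ C * (TT N m h t + SS N m g t + QQ N m a h t) := by
  obtain ⟨C1, hC1, h1⟩ := src_le hN m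
  obtain ⟨C2, hC2, h2⟩ := G1' hN m
  obtain ⟨C3, hC3, h3⟩ := G0' hN m
  obtain ⟨C4, hC4, h4⟩ := piece_le hN m
  have claim : ∀ k, ∃ C > (0:ℝ), ∀ j, j + k = m + 2 → ∀ (T : ℝ) (b₂ b₁ b₀ g h : ℝ → ℝ → ℝ),
    Sol N T b₂ b₁ b₀ g h → ∀ t ∈ Icc (0:ℝ) T, ∀ a : ℕ → ℝ, Monotone a → 1 ≤ a 1 →
    CB a b₂ t → CB a b₁ t → CB a b₀ t →
    GG N k (dt^[j] h) t ≤ C * (TT N m h t + SS N m g t + QQ N m a h t) := by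
    have hQ : ∀ (b h : ℝ → ℝ → ℝ) (t : ℝ) (a : ℕ → ℝ), CB a b t → 0 ≤ QQ N m a h t :=
      fun b h t a ha => add_nonneg (mul_nonneg (ha.nonneg _) (SS_nonneg _ _ _ _))
        (Finset.sum_nonneg fun s _ => mul_nonneg (ha.nonneg s) (SS_nonneg _ _ _ _))
    intro k
    induction k using Nat.twoStepInduction with
    | zero =>
      refine ⟨1, one_pos, fun j hj T b₂ b₁ b₀ g h hs t ht a hmono h11 ha2 ha1 ha0 => ?_⟩
      obtain rfl : j = m + 2 := by omega
      have e : GG N 0 (dt^[m + 2] h) t = II N 0 (DD 0 (m + 2) h t) := rfl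
      have := hQ b₂ h t a ha2
      have := SS_nonneg N m g t
      have := II_nonneg N 1 (DD 1 (m + 1) h t)
      rw [e]; unfold TT
      linarith
    | one =>
      refine ⟨1, one_pos, fun j hj T b₂ b₁ b₀ g h hs t ht a hmono h11 ha2 ha1 ha0 => ?_⟩
      obtain rfl : j = m + 1 := by omega
      have e : GG N 1 (dt^[m + 1] h) t = II N 1 (DD 1 (m + 1) h t) := rfl
      have := hQ b₂ h t a ha2
      have := SS_nonneg N m g t
      have := II_nonneg N 0 (DD 0 (m + 2) h t)
      rw [e]; unfold TT
      linarith
    | more k ih _ =>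
      obtain ⟨C, hC, ih⟩ := ih
      refine ⟨C2 * (64 * (C1 + C1 + C1 + C3 * C + C4)), by positivity,
        fun j hj T b₂ b₁ b₀ g h hs t ht a hmono h11 ha2 ha1 ha0 => ?_⟩
      set X := TT N m h t + SS N m g t + QQ N m a h t with hX
      have x1 : QQ N m a h t ≤ X := by
        have := SS_nonneg N m g t
        have := II_nonneg N 0 (DD 0 (m + 2) h t)
        have := II_nonneg N 1 (DD 1 (m + 1) h t)
        rw [hX]; unfold TT; linarith
      have x2 : SS N m g t ≤ X := by
        have := hQ b₂ h t a ha2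
        have := II_nonneg N 0 (DD 0 (m + 2) h t)
        have := II_nonneg N 1 (DD 1 (m + 1) h t)
        rw [hX]; unfold TT; linarith
      have e : GG N (k + 2) (dt^[j] h) t = GG N k (dt^[j] (DelT N h)) t := by
        rw [dt_iter_DelT hs.hh]; rfl
      rw [e, mul_assoc]
      refine h2 k (by omega) _ ((hs.hh.DelT N).dt_iter j) t _ fun q r hr hq => ?_
      rw [← DD_split]
      have hqj : 2 * q + j = m + r := by omega
      obtain ⟨s1, -, -⟩ := h1 b₂ h hs.hb2 hs.hh t a hmono ha2 q r j hr hqj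
      obtain ⟨-, s2, -⟩ := h1 b₁ h hs.hb1 hs.hh t a hmono ha1 q r j hr hqj
      obtain ⟨-, -, s3⟩ := h1 b₀ h hs.hb0 hs.hh t a hmono ha0 q r j hr hqj
      have s4 := h4 m le_rfl g hs.hg t q r j hr hqj.le
      have s5 := h3 k (by omega) _ (hs.hh.dt_iter (j + 2)) t q r hr hq
      rw [← DD_split] at s5
      have s6 := ih (j + 2) (by omega) T b₂ b₁ b₀ g h hs t ht a hmono h11 ha2 ha1 ha0
      rw [← hX] at s6
      set F1 : ℝ → ℝ := fun z => DD q j (fun t z => b₂ t z * DelT N h t z) t z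
        - b₂ t z * DD q j (DelT N h) t z with hF1
      set F2 := DD q j (fun t z => b₁ t z * (z * dz h t z)) t
      set F3 := DD q j (fun t z => b₀ t z * h t z) t
      set F4 := DD q j g t
      set F5 := DD q (j + 2) h t
      have c0 : Continuous (DD q j (DelT N h) t) := ((hs.hh.DelT N).DD q j).contz t
      have c1 : Continuous F1 := (((hs.hb2.mul (hs.hh.DelT N)).DD q j).contz t).sub
        ((hs.hb2.contz t).mul c0)
      have c2 : Continuous F2 := ((hs.hb1.mul hs.hh.dz.zmul).DD q j).contz t
      have c3 : Continuous F3 := ((hs.hb0.mul hs.hh).DD q j).contz t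
      have c4 : Continuous F4 := (hs.hg.DD q j).contz t
      have c5 : Continuous F5 := (hs.hh.DD q (j + 2)).contz t
      have d1 : Continuous (fun z => F5 z + F2 z) := c5.add c2
      have d2 : Continuous (fun z => F5 z + F2 z + F3 z) := d1.add c3
      have d3 : Continuous (fun z => F5 z + F2 z + F3 z - F4 z) := d2.sub c4
      have d4 : Continuous (fun z => F5 z + F2 z + F3 z - F4 z - F1 z) := d3.sub c1
      have t1 : II N r (DD q j (DelT N h) t)
          ≤ 4 * II N r (fun z => (((F5 z + F2 z) + F3 z) - F4 z) - F1 z) := by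
        refine II_le hN c0 d4 4 fun z hz => ?_
        have hz0 : 0 ≤ z ^ r := pow_nonneg hz.1 r
        have heq := hs.eq q j t ht z hz
        have hlo := abs_le.1 (hs.lo t ht z hz)
        have hb : b₂ t z * DD q j (DelT N h) t z = (((F5 z + F2 z) + F3 z) - F4 z) - F1 z := by
          simp only [hF1]
          rw [heq]; ring
        rw [← hb]
        have : DD q j (DelT N h) t z ^ 2 ≤ 4 * (b₂ t z * DD q j (DelT N h) t z) ^ 2 := by
          rw [mul_pow]
          have : 1 ≤ 4 * b₂ t z ^ 2 := by nlinarith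
          nlinarith [sq_nonneg (DD q j (DelT N h) t z)]
        calc _ ≤ z ^ r * (4 * (b₂ t z * DD q j (DelT N h) t z) ^ 2) :=
              mul_le_mul_of_nonneg_left this hz0
          _ = _ := by ring
      have t2 := II_sub hN r d3 c1
      have t3 := II_sub hN r d2 c4
      have t4 := II_add hN r d1 c3
      have t5 := II_add hN r c5 c2
      have u1 := mul_le_mul_of_nonneg_left x1 hC1.le
      have u2 := mul_le_mul_of_nonneg_left x2 hC4.le
      have u3 := mul_le_mul_of_nonneg_left s6 hC3.le
      have v1 := II_nonneg N r F1
      have v2 := II_nonneg N r F2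
      have v3 := II_nonneg N r F3
      have v4 := II_nonneg N r F4
      have v5 := II_nonneg N r F5
      have : II N r (DD q j (DelT N h) t) ≤ 64 * (II N r F1 + II N r F2 + II N r F3 + II N r F5
          + II N r F4) := by linarith
      refine this.trans ?_
      rw [mul_assoc]
      refine mul_le_mul_of_nonneg_left ?_ (by norm_num)
      linarith
  choose C hC h using claim
  refine ⟨((m + 2 : ℕ) + 1) ^ 2 * (1 + ∑ k ∈ Finset.range (m + 3), C k), ?_, ?_⟩
  · have : 0 ≤ ∑ k ∈ Finset.range (m + 3), C k := Finset.sum_nonneg fun k _ => (hC k).le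
    positivity
  intro T b₂ b₁ b₀ g h' hs t ht a hmono h11 ha2 ha1 ha0
  have w1 := II_nonneg N 0 (DD 0 (m + 2) h' t)
  have w2 := II_nonneg N 1 (DD 1 (m + 1) h' t)
  have w3 := SS_nonneg N m g t
  have w4 : SS N (m + 1) h' t ≤ QQ N m a h' t := by
    unfold QQ
    have : 0 ≤ ∑ s ∈ Finset.Icc 1 m, a s * SS N (m + 2 - s) h' t :=
      Finset.sum_nonneg fun s _ => mul_nonneg (ha2.nonneg s) (SS_nonneg _ _ _ _)
    nlinarith [SS_nonneg N (m + 1) h' t]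
  have w5 := SS_nonneg N (m + 1) h' t
  have hX0 : 0 ≤ TT N m h' t + SS N m g t + QQ N m a h' t := by unfold TT; linarith
  rw [mul_assoc]
  refine SS_le N (m + 2) h' t _ fun j k hjk => ?_
  rcases Nat.lt_or_ge (j + k) (m + 2) with hlt | hge
  · have := GG_le_SS N (n := m + 1) (j := j) (k := k) (by omega) h' t
    have h0 : 0 ≤ (∑ k ∈ Finset.range (m + 3), C k) * (TT N m h' t + SS N m g t + QQ N m a h' t) :=
      mul_nonneg (Finset.sum_nonneg fun k _ => (hC k).le) hX0
    rw [add_mul, one_mul]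
    unfold TT at *
    linarith
  · refine (h k j (by omega) T b₂ b₁ b₀ g h' hs t ht a hmono h11 ha2 ha1 ha0).trans ?_
    refine mul_le_mul_of_nonneg_right ?_ hX0
    have := Finset.single_le_sum (f := C) (s := Finset.range (m + 3)) (fun k _ => (hC k).le)
      (Finset.mem_range.2 (show k < m + 3 by omega))
    linarith

open MeasureTheory Real Set

theorem param_cont {F : ℝ → ℝ → ℝ} (hF : Continuous (fun p : ℝ × ℝ => F p.1 p.2)) :
    Continuous (fun t => ∫ z in (0:ℝ)..1, F t z) :=
  intervalIntegral.continuous_parametric_intervalIntegral_of_continuous' (μ := volume) hF 0 1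

theorem param_deriv {F F' : ℝ → ℝ → ℝ} (hF : Continuous (fun p : ℝ × ℝ => F p.1 p.2))
    (hF' : Continuous (fun p : ℝ × ℝ => F' p.1 p.2))
    (hd : ∀ t z, HasDerivAt (fun s => F s z) (F' t z) t) (t : ℝ) :
    HasDerivAt (fun t => ∫ z in (0:ℝ)..1, F t z) (∫ z in (0:ℝ)..1, F' t z) t := by
  have hcF : ∀ t, Continuous (F t) := fun t =>
    hF.comp (continuous_const.prodMk continuous_id)
  have hcF' : ∀ t, Continuous (F' t) := fun t =>
    hF'.comp (continuous_const.prodMk continuous_id)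
  have hK : IsCompact (Icc (t - 1) (t + 1) ×ˢ Icc (0:ℝ) 1) := isCompact_Icc.prod isCompact_Icc
  obtain ⟨C, hC⟩ := hK.exists_bound_of_continuousOn hF'.continuousOn
  refine (intervalIntegral.hasDerivAt_integral_of_dominated_loc_of_deriv_le (μ := volume)
    (bound := fun _ => C) (s := Icc (t - 1) (t + 1))
    (Icc_mem_nhds (by linarith) (by linarith)) ?_ ?_ ?_ ?_ ?_ ?_).2
  · exact Filter.Eventually.of_forall fun x => (hcF x).aestronglyMeasurable
  · exact (hcF t).intervalIntegrable _ _
  · exact (hcF' t).aestronglyMeasurable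
  · refine Filter.Eventually.of_forall fun z hz x hx => ?_
    rw [uIoc_of_le zero_le_one] at hz
    exact hC (x, z) ⟨hx, hz.1.le, hz.2⟩
  · exact intervalIntegrable_const
  · exact Filter.Eventually.of_forall fun z _ x _ => hd x z

theorem wt_cont2 {N : ℝ} (hN : 4 ≤ N) : Continuous (fun p : ℝ × ℝ => p.2 ^ (N / 2 - 1)) :=
  (wt_cont hN).comp continuous_snd

theorem II_contT {N : ℝ} (hN : 4 ≤ N) (r : ℕ) {u : ℝ → ℝ → ℝ} (hu : Sm u) :
    Continuous (fun t => II N r (u t)) := by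
  have h1 := wt_cont2 hN
  have h2 := hu.cont
  unfold II
  exact param_cont (F := fun t z => z ^ r * (u t z) ^ 2 * z ^ (N / 2 - 1)) (by fun_prop)

theorem II_deriv {N : ℝ} (hN : 4 ≤ N) (r : ℕ) {u : ℝ → ℝ → ℝ} (hu : Sm u) (t : ℝ) :
    HasDerivAt (fun t => II N r (u t))
      (∫ z in (0:ℝ)..1, z ^ r * (2 * u t z * dt u t z) * z ^ (N / 2 - 1)) t := by
  have h1 := wt_cont2 hN
  have h2 := hu.cont
  have h3 := hu.dt.cont
  unfold II
  refine param_deriv (F := fun t z => z ^ r * (u t z) ^ 2 * z ^ (N / 2 - 1))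
    (F' := fun t z => z ^ r * (2 * u t z * dt u t z) * z ^ (N / 2 - 1))
    (by fun_prop) (by fun_prop) (fun t z => ?_) t
  refine ((((hu.hasDerivAt_t t z).pow 2).const_mul (z ^ r)).mul_const _).congr_deriv ?_
  simp

theorem GG_contT {N : ℝ} (hN : 4 ≤ N) (k : ℕ) : ∀ {y : ℝ → ℝ → ℝ}, Sm y →
    Continuous (fun t => GG N k y t) := by
  induction k using Nat.twoStepInduction with
  | zero => intro y hy; exact II_contT hN 0 hy
  | one => intro y hy; exact II_contT hN 1 hy.dz
  | more k ih _ => intro y hy; exact ih (hy.DelT N)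

theorem SS_contT {N : ℝ} (hN : 4 ≤ N) (n : ℕ) {y : ℝ → ℝ → ℝ} (hy : Sm y) :
    Continuous (fun t => SS N n y t) := by
  unfold SS
  exact continuous_finsetSum _ fun j _ => continuous_finsetSum _ fun k _ =>
    GG_contT hN k (hy.dt_iter j)

/-- Integrating a differential inequality. -/
theorem le_int {φ φ' ψ : ℝ → ℝ} (hd : ∀ t, HasDerivAt φ (φ' t) t) (hφ' : Continuous φ')
    (hψ : Continuous ψ) (h0 : φ 0 = 0) {t : ℝ} (ht : 0 ≤ t) (hle : ∀ s ∈ Icc 0 t, φ' s ≤ ψ s) :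
    φ t ≤ ∫ s in (0:ℝ)..t, ψ s := by
  have := intervalIntegral.integral_eq_sub_of_hasDerivAt (a := 0) (b := t)
    (fun s _ => hd s) (hφ'.intervalIntegrable _ _)
  rw [h0, sub_zero] at this
  rw [← this]
  exact intervalIntegral.integral_mono_on ht (hφ'.intervalIntegrable _ _)
    (hψ.intervalIntegrable _ _) hle

theorem II_growth {N : ℝ} (hN : 4 ≤ N) (r : ℕ) {u : ℝ → ℝ → ℝ} (hu : Sm u)
    (h0 : ∀ z, u 0 z = 0) {t : ℝ} (ht : 0 ≤ t) :
    II N r (u t) ≤ ∫ s in (0:ℝ)..t, (II N r (u s) + II N r (dt u s)) := by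
  have h1 := wt_cont2 hN
  have hw := wt_cont hN
  have h2 := hu.cont
  have h3 := hu.dt.cont
  refine le_int (II_deriv hN r hu) ?_ ((II_contT hN r hu).fun_add (II_contT hN r hu.dt)) ?_ ht ?_
  · exact param_cont (F := fun t z => z ^ r * (2 * u t z * dt u t z) * z ^ (N / 2 - 1))
      (by fun_prop)
  · simp [II, h0]
  · intro s _
    unfold II
    rw [← intervalIntegral.integral_add
      ((II_cont hN r (hu.contz s)).intervalIntegrable _ _)
      ((II_cont hN r (hu.dt.contz s)).intervalIntegrable _ _)]
    have c1 := hu.contz s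
    have c2 := hu.dt.contz s
    refine int01_mono (by fun_prop) (by fun_prop) fun z hz => ?_
    have hz0 : 0 ≤ z ^ r := pow_nonneg hz.1 r
    have hz1 := wt_nonneg (N := N) hz
    rw [← add_mul, ← mul_add]
    refine mul_le_mul_of_nonneg_right (mul_le_mul_of_nonneg_left ?_ hz0) hz1
    nlinarith [sq_nonneg (u s z - dt u s z)]

theorem intT_mono {F G : ℝ → ℝ} (hF : Continuous F) (hG : Continuous G) {t : ℝ} (ht : 0 ≤ t)
    (h : ∀ z ∈ Icc (0:ℝ) t, F z ≤ G z) : ∫ z in (0:ℝ)..t, F z ≤ ∫ z in (0:ℝ)..t, G z :=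
  intervalIntegral.integral_mono_on ht (hF.intervalIntegrable _ _)
    (hG.intervalIntegrable _ _) h

/-- Lower-order terms are controlled by time integrals. -/
theorem lower {N : ℝ} (hN : 4 ≤ N) (n : ℕ) : ∃ C > (0:ℝ), ∀ y : ℝ → ℝ → ℝ, Sm y →
    (∀ q j z, DD q j y 0 z = 0) → ∀ t : ℝ, 0 ≤ t →
    SS N n y t ≤ C * ∫ s in (0:ℝ)..t, SS N (n + 1) y s := by
  obtain ⟨C1, hC1, h1⟩ := SS_of_pieces hN n
  obtain ⟨C2, hC2, h2⟩ := piece_le hN (n + 1)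
  refine ⟨C1 * (2 * C2), by positivity, fun y hy h0 t ht => ?_⟩
  rw [mul_assoc]
  refine h1 y hy t _ fun q r j hr hq => ?_
  refine (II_growth hN r (hy.DD q j) (h0 q j) ht).trans ?_
  rw [← intervalIntegral.integral_const_mul]
  refine intT_mono ((II_contT hN r (hy.DD q j)).fun_add (II_contT hN r (hy.DD q j).dt))
    ((SS_contT hN _ hy).const_mul _) ht fun s _ => ?_
  have k1 := h2 (n + 1) le_rfl y hy s q r j hr (by omega)
  have k2 := h2 (n + 1) le_rfl y hy s q r (j + 1) hr (by omega)
  rw [hy.dt_DD]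
  linarith

theorem QQ_contT {N : ℝ} (hN : 4 ≤ N) (m : ℕ) (a : ℕ → ℝ) {y : ℝ → ℝ → ℝ} (hy : Sm y) :
    Continuous (fun t => QQ N m a y t) := by
  unfold QQ
  exact ((SS_contT hN _ hy).const_mul _).add
    (continuous_finsetSum _ fun j _ => (SS_contT hN _ hy).const_mul _)

theorem QQ_nonneg {N : ℝ} (m : ℕ) {a : ℕ → ℝ} (ha : ∀ s, 0 ≤ a s) (h : ℝ → ℝ → ℝ) (t : ℝ) :
    0 ≤ QQ N m a h t :=
  add_nonneg (mul_nonneg (ha _) (SS_nonneg _ _ _ _))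
    (Finset.sum_nonneg fun s _ => mul_nonneg (ha s) (SS_nonneg _ _ _ _))

set_option maxHeartbeats 2000000 in
theorem energy {N : ℝ} (hN : 4 ≤ N) (m : ℕ) : ∃ C > (0:ℝ), ∀ (T : ℝ) (b₂ b₁ b₀ g h : ℝ → ℝ → ℝ),
    Sol N T b₂ b₁ b₀ g h → ∀ a : ℕ → ℝ, Monotone a → 1 ≤ a 1 →
    (∀ t ∈ Icc (0:ℝ) T, CB a b₂ t ∧ CB a b₁ t ∧ CB a b₀ t) → ∀ t ∈ Icc (0:ℝ) T,
    TT N m h t ≤ C * ∫ s in (0:ℝ)..t, (QQ N (m + 1) a h s + SS N (m + 1) g s) := by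
  obtain ⟨C1, hC1, h1⟩ := src_le hN (m + 1)
  obtain ⟨C2, hC2, h2⟩ := piece_le hN (m + 1)
  obtain ⟨C3, hC3, h3⟩ := piece_le hN (m + 2)
  refine ⟨2 * (24 * C1 + 8 * C2 + 8 * C3), by positivity, ?_⟩
  intro T b₂ b₁ b₀ g h hs a hmono h11 hCB t ht
  have hh := hs.hh
  have hH1 := hh.DD 0 (m + 2)
  have hH2 := hh.DD 1 (m + 1)
  have hb := hs.hb2
  have hw := wt_cont hN
  have hw2 := wt_cont2 hN
  -- the energy and its derivative
  set F : ℝ → ℝ → ℝ := fun t z => (DD 0 (m + 2) h t z ^ 2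
    + b₂ t z * (z * DD 1 (m + 1) h t z ^ 2)) * z ^ (N / 2 - 1) with hF
  set F' : ℝ → ℝ → ℝ := fun t z => (2 * DD 0 (m + 2) h t z * DD 0 (m + 3) h t z
    + (dt b₂ t z * (z * DD 1 (m + 1) h t z ^ 2)
      + b₂ t z * (z * (2 * DD 1 (m + 1) h t z * DD 1 (m + 2) h t z)))) * z ^ (N / 2 - 1) with hF'
  have k1 := hH1.cont
  have k2 := hH2.cont
  have k3 := hb.cont
  have k4 := hb.dt.cont
  have k5 := (hh.DD 0 (m + 3)).cont
  have k6 := (hh.DD 1 (m + 2)).cont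
  have cF : Continuous (fun p : ℝ × ℝ => F p.1 p.2) := by
    simp only [hF]; fun_prop
  have cF' : Continuous (fun p : ℝ × ℝ => F' p.1 p.2) := by
    simp only [hF']; fun_prop
  have hd : ∀ t z, HasDerivAt (fun s => F s z) (F' t z) t := by
    intro t z
    have e1 : HasDerivAt (fun s => DD 0 (m + 2) h s z) (DD 0 (m + 3) h t z) t := by
      have := hH1.hasDerivAt_t t z
      rwa [hh.dt_DD] at this
    have e2 : HasDerivAt (fun s => DD 1 (m + 1) h s z) (DD 1 (m + 2) h t z) t := by
      have := hH2.hasDerivAt_t t z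
      rwa [hh.dt_DD] at this
    have e3 := hb.hasDerivAt_t t z
    refine (((e1.pow 2).add (e3.mul ((e2.pow 2).const_mul z))).mul_const _).congr_deriv ?_
    simp only [hF']
    simp
  have hder := param_deriv cF cF' hd
  have hE0 : (∫ z in (0:ℝ)..1, F 0 z) = 0 := by
    simp [hF, hs.h0]
  have hEbound : ∀ s ∈ Icc (0:ℝ) t, (∫ z in (0:ℝ)..1, F' s z)
      ≤ (24 * C1 + 8 * C2 + 8 * C3) * (QQ N (m + 1) a h s + SS N (m + 1) g s) := by
    intro s hst
    have hsT : s ∈ Icc (0:ℝ) T := ⟨hst.1, hst.2.trans ht.2⟩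
    obtain ⟨ha2, ha1, ha0⟩ := hCB s hsT
    obtain ⟨s1, -, -⟩ := h1 b₂ h hs.hb2 hs.hh s a hmono ha2 0 0 (m + 1) le_rfl (by omega)
    obtain ⟨-, s2, -⟩ := h1 b₁ h hs.hb1 hs.hh s a hmono ha1 0 0 (m + 1) le_rfl (by omega)
    obtain ⟨-, -, s3⟩ := h1 b₀ h hs.hb0 hs.hh s a hmono ha0 0 0 (m + 1) le_rfl (by omega)
    have s4 := h2 (m + 1) le_rfl g hs.hg s 0 0 (m + 1) le_rfl (by omega)
    have s5 := h3 (m + 2) le_rfl h hs.hh s 0 0 (m + 2) le_rfl (by omega)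
    have s6 := h3 (m + 2) le_rfl h hs.hh s 1 1 (m + 1) le_rfl (by omega)
    set F1 : ℝ → ℝ := fun z => DD 0 (m + 1) (fun t z => b₂ t z * DelT N h t z) s z
        - b₂ s z * DD 0 (m + 1) (DelT N h) s z with hF1
    set F2 := DD 0 (m + 1) (fun t z => b₁ t z * (z * dz h t z)) s
    set F3 := DD 0 (m + 1) (fun t z => b₀ t z * h t z) s
    set F4 := DD 0 (m + 1) g s
    have c0 : Continuous (DD 0 (m + 1) (DelT N h) s) := ((hs.hh.DelT N).DD 0 (m + 1)).contz s
    have c1 : Continuous F1 := (((hs.hb2.mul (hs.hh.DelT N)).DD 0 (m + 1)).contz s).sub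
      ((hs.hb2.contz s).mul c0)
    have c2 : Continuous F2 := ((hs.hb1.mul hs.hh.dz.zmul).DD 0 (m + 1)).contz s
    have c3 : Continuous F3 := ((hs.hb0.mul hs.hh).DD 0 (m + 1)).contz s
    have c4 : Continuous F4 := (hs.hg.DD 0 (m + 1)).contz s
    have d1 : Continuous (fun z => F1 z - F2 z) := c1.sub c2
    have d2 : Continuous (fun z => F1 z - F2 z - F3 z) := d1.sub c3
    have d3 : Continuous (fun z => F1 z - F2 z - F3 z + F4 z) := d2.add c4
    have t1 := II_add hN 0 d2 c4
    have t2 := II_sub hN 0 d1 c3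
    have t3 := II_sub hN 0 c1 c2
    set Φ : ℝ → ℝ := fun z => F1 z - F2 z - F3 z + F4 z with hΦ
    -- integration by parts
    have i1 := ibp hN 0 (p := fun z => b₂ s z * (DD 1 (m + 1) h s z * DD 0 (m + 2) h s z))
      (p' := fun z => dz b₂ s z * (DD 1 (m + 1) h s z * DD 0 (m + 2) h s z)
        + b₂ s z * (DD 2 (m + 1) h s z * DD 0 (m + 2) h s z
          + DD 1 (m + 1) h s z * DD 1 (m + 2) h s z))
      (fun z => by
        have e1 := hb.hasDerivAt_z s z
        have e2 := hH2.hasDerivAt_z s z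
        have e3 := hH1.hasDerivAt_z s z
        rw [dz_DD] at e2 e3
        exact e1.mul (e2.mul e3))
      (by
        have e1 := hb.dz.contz s
        have e2 := hb.contz s
        have e3 := hH2.contz s
        have e4 := hH1.contz s
        have e5 := (hh.DD 2 (m + 1)).contz s
        have e6 := (hh.DD 1 (m + 2)).contz s
        fun_prop)
    rw [hs.bd (m + 2) s hsT] at i1
    simp only [mul_zero, pow_zero, one_mul, CharP.cast_eq_zero, zero_add] at i1
    have e1 := hb.dz.contz s
    have e2 := hb.contz s
    have e3 := hH2.contz s
    have e4 := hH1.contz s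
    have e5 := (hh.DD 2 (m + 1)).contz s
    have e6 := (hh.DD 1 (m + 2)).contz s
    have e7 : Continuous (F' s) := cF'.comp (continuous_const.prodMk continuous_id)
    have i2 : (∫ z in (0:ℝ)..1, F' s z) ≤ (II N 0 Φ + (2 * a 1) * II N 0 (DD 0 (m + 2) h s))
        + (2 * a 1) * II N 1 (DD 1 (m + 1) h s) := by
      unfold II
      rw [← intervalIntegral.integral_const_mul, ← intervalIntegral.integral_const_mul,
        ← intervalIntegral.integral_add
          ((II_cont hN 0 d3).intervalIntegrable _ _)
          (((II_cont hN 0 e4).const_mul _).intervalIntegrable _ _),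
        ← intervalIntegral.integral_add
          (((II_cont hN 0 d3).fun_add ((II_cont hN 0 e4).const_mul _)).intervalIntegrable _ _)
          (((II_cont hN 1 e3).const_mul _).intervalIntegrable _ _)]
      have i3 : (∫ z in (0:ℝ)..1, F' s z) = ∫ z in (0:ℝ)..1, (F' s z - 2 *
          ((N / 2 * (b₂ s z * (DD 1 (m + 1) h s z * DD 0 (m + 2) h s z)) +
            z * (dz b₂ s z * (DD 1 (m + 1) h s z * DD 0 (m + 2) h s z) +
              b₂ s z * (DD 2 (m + 1) h s z * DD 0 (m + 2) h s z
                + DD 1 (m + 1) h s z * DD 1 (m + 2) h s z))) * z ^ (N / 2 - 1))) := by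
        rw [intervalIntegral.integral_sub (e7.intervalIntegrable _ _)
          (Continuous.intervalIntegrable (by fun_prop) _ _),
          intervalIntegral.integral_const_mul, i1]
        ring
      rw [i3]
      refine int01_mono (by fun_prop) (by fun_prop) fun z hz => ?_
      have hz1 := wt_nonneg (N := N) hz
      have heq := hs.eq 0 (m + 1) s hsT z hz
      have hA : b₂ s z * (z * DD 2 (m + 1) h s z + N / 2 * DD 1 (m + 1) h s z) + Φ z
          = DD 0 (m + 3) h s z := by
        have := congrFun (congrFun (DD_DelT hh N 0 (m + 1)) s) z
        simp only [zero_add, CharP.cast_eq_zero, add_zero] at this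
        rw [← this]
        simp only [hΦ, hF1]
        rw [heq]; ring
      have hB1 := ha2 0 0 1 1 le_rfl (by omega) z hz
      have hB2 := ha2 1 1 0 1 le_rfl (by omega) z hz
      have eB1 : DD 0 1 b₂ s z = dt b₂ s z := rfl
      have eB2 : DD 1 0 b₂ s z = dz b₂ s z := rfl
      rw [eB1, pow_zero, one_mul] at hB1
      rw [eB2, pow_one] at hB2
      simp only [hF']
      rw [← hA]
      set w := z ^ (N / 2 - 1)
      set u := DD 0 (m + 2) h s z
      set v := DD 1 (m + 1) h s z
      have q1 : 2 * u * Φ z ≤ u ^ 2 + Φ z ^ 2 := by nlinarith [sq_nonneg (u - Φ z)]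
      have q2 : dt b₂ s z * (z * v ^ 2) ≤ a 1 * (z * v ^ 2) := by
        refine mul_le_mul_of_nonneg_right ?_ (mul_nonneg hz.1 (sq_nonneg _))
        nlinarith
      have q3 : - (2 * z * dz b₂ s z * v * u) ≤ a 1 * u ^ 2 + z * v ^ 2 := by
        have q4 : (z * dz b₂ s z ^ 2) * u ^ 2 ≤ a 1 * u ^ 2 :=
          mul_le_mul_of_nonneg_right hB2 (sq_nonneg _)
        have q5 : 0 ≤ z * (dz b₂ s z * u + v) ^ 2 := mul_nonneg hz.1 (sq_nonneg _)
        nlinarith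
      have q6 : z * v ^ 2 ≤ a 1 * (z * v ^ 2) :=
        le_mul_of_one_le_left (mul_nonneg hz.1 (sq_nonneg _)) h11
      have q7 : u ^ 2 ≤ a 1 * u ^ 2 := le_mul_of_one_le_left (sq_nonneg _) h11
      have : 2 * u * Φ z + dt b₂ s z * (z * v ^ 2) - 2 * z * dz b₂ s z * v * u
          ≤ Φ z ^ 2 + 2 * a 1 * u ^ 2 + 2 * a 1 * (z * v ^ 2) := by linarith
      have := mul_le_mul_of_nonneg_right this hz1
      simp only [pow_zero, one_mul, pow_one]
      linarith
    have hQ1 : a 1 * SS N (m + 2) h s ≤ QQ N (m + 1) a h s := by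
      unfold QQ
      have : 0 ≤ ∑ x ∈ Finset.Icc 1 (m + 1), a x * SS N (m + 1 + 2 - x) h s :=
        Finset.sum_nonneg fun x _ => mul_nonneg (ha2.nonneg x) (SS_nonneg _ _ _ _)
      linarith
    have r5 := mul_le_mul_of_nonneg_left s5 (ha2.nonneg 1)
    have r6 := mul_le_mul_of_nonneg_left s6 (ha2.nonneg 1)
    have r7 := mul_le_mul_of_nonneg_left hQ1 hC3.le
    have r8 := SS_nonneg N (m + 1) g s
    have r9 := QQ_nonneg (N := N) (m + 1) ha2.nonneg h s
    have v1 := II_nonneg N 0 F1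
    have v2 := II_nonneg N 0 F2
    have v3 := II_nonneg N 0 F3
    have v4 := II_nonneg N 0 F4
    have w1 : 0 ≤ C1 * SS N (m + 1) g s := by positivity
    have w2 : 0 ≤ C2 * QQ N (m + 1) a h s := by positivity
    have w3 : 0 ≤ C3 * SS N (m + 1) g s := by positivity
    have w4 : 0 ≤ C3 * QQ N (m + 1) a h s := by positivity
    have hΦ2 : II N 0 Φ ≤ 8 * (II N 0 F1 + II N 0 F2 + II N 0 F3 + II N 0 F4) := by linarith
    have : II N 0 Φ ≤ 24 * C1 * QQ N (m + 1) a h s + 8 * C2 * SS N (m + 1) g s := by linarith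
    have : 2 * a 1 * II N 0 (DD 0 (m + 2) h s) + 2 * a 1 * II N 1 (DD 1 (m + 1) h s)
        ≤ 4 * C3 * QQ N (m + 1) a h s := by linarith
    linarith
  have hfin := le_int hder (param_cont cF')
    (((QQ_contT hN (m + 1) a hh).fun_add (SS_contT hN (m + 1) hs.hg)).const_mul _) hE0 ht.1 hEbound
  rw [intervalIntegral.integral_const_mul] at hfin
  have hTT : TT N m h t ≤ 2 * ∫ z in (0:ℝ)..1, F t z := by
    unfold TT II
    rw [← intervalIntegral.integral_const_mul, ← intervalIntegral.integral_add
      ((II_cont hN 0 (hH1.contz t)).intervalIntegrable _ _)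
      ((II_cont hN 1 (hH2.contz t)).intervalIntegrable _ _)]
    have cFt : Continuous (F t) := cF.comp (continuous_const.prodMk continuous_id)
    refine int01_mono ((II_cont hN 0 (hH1.contz t)).fun_add (II_cont hN 1 (hH2.contz t)))
      (cFt.const_mul _) fun z hz => ?_
    have hz1 := wt_nonneg (N := N) hz
    have hlo := abs_le.1 (hs.lo t ht z hz)
    simp only [hF, pow_zero, one_mul, pow_one]
    rw [← add_mul, ← mul_assoc]
    refine mul_le_mul_of_nonneg_right ?_ hz1
    have : 0 ≤ z * DD 1 (m + 1) h t z ^ 2 := mul_nonneg hz.1 (sq_nonneg _)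
    nlinarith [sq_nonneg (DD 0 (m + 2) h t z)]
  rw [mul_assoc]
  linarith

open MeasureTheory Real Set

theorem gron {K T : ℝ} (hK : 0 ≤ K) (hT : 0 ≤ T) {x f : ℝ → ℝ} (hx : Continuous x)
    (hf : Continuous f) (f0 : ∀ t ∈ Icc (0:ℝ) T, 0 ≤ f t)
    (h : ∀ t ∈ Icc (0:ℝ) T, x t ≤ K * (∫ s in (0:ℝ)..t, x s) + K * ∫ s in (0:ℝ)..t, f s) :
    ∫ s in (0:ℝ)..T, x s ≤ exp (K * T) * ∫ s in (0:ℝ)..T, f s := by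
  set Fc := ∫ s in (0:ℝ)..T, f s with hFc
  have hfle : ∀ t ∈ Icc (0:ℝ) T, ∫ s in (0:ℝ)..t, f s ≤ Fc := by
    intro t ht
    have h1 : (∫ s in (0:ℝ)..t, f s) + ∫ s in t..T, f s = Fc :=
      intervalIntegral.integral_add_adjacent_intervals (hf.intervalIntegrable _ _)
        (hf.intervalIntegrable _ _)
    have h2 : 0 ≤ ∫ s in t..T, f s := intervalIntegral.integral_nonneg ht.2
      fun s hs => f0 s ⟨ht.1.trans hs.1, hs.2⟩
    linarith
  have hd : ∀ t, HasDerivAt (fun t => exp (-K * t) * ((∫ s in (0:ℝ)..t, x s) + Fc))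
      (exp (-K * t) * (x t - K * ((∫ s in (0:ℝ)..t, x s) + Fc))) t := by
    intro t
    have e1 : HasDerivAt (fun t => ∫ s in (0:ℝ)..t, x s) (x t) t :=
      intervalIntegral.integral_hasDerivAt_right (hx.intervalIntegrable _ _)
        (hx.stronglyMeasurableAtFilter _ _) hx.continuousAt
    have e2 : HasDerivAt (fun t => exp (-K * t)) (exp (-K * t) * (-K)) t := by
      have := ((hasDerivAt_id t).const_mul (-K)).exp
      simpa using this
    refine (e2.mul (e1.add_const Fc)).congr_deriv ?_
    ring
  have hanti : AntitoneOn (fun t => exp (-K * t) * ((∫ s in (0:ℝ)..t, x s) + Fc)) (Icc 0 T) := by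
    refine antitoneOn_of_deriv_nonpos (convex_Icc 0 T)
      (fun t _ => (hd t).continuousAt.continuousWithinAt)
      (fun t _ => (hd t).differentiableAt.differentiableWithinAt) fun t ht => ?_
    rw [interior_Icc] at ht
    have ht' : t ∈ Icc (0:ℝ) T := ⟨ht.1.le, ht.2.le⟩
    rw [(hd t).deriv]
    refine mul_nonpos_of_nonneg_of_nonpos (exp_pos _).le ?_
    have h1 := h t ht'
    have h2 := mul_le_mul_of_nonneg_left (hfle t ht') hK
    linarith
  have := hanti (left_mem_Icc.2 hT) (right_mem_Icc.2 hT) hT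
  simp only [mul_zero, exp_zero, intervalIntegral.integral_same, zero_add, one_mul] at this
  have hF0 : 0 ≤ Fc := intervalIntegral.integral_nonneg hT f0
  have h3 := mul_le_mul_of_nonneg_left this (exp_pos (K * T)).le
  rw [← mul_assoc, ← exp_add, show K * T + -K * T = 0 by ring, exp_zero, one_mul] at h3
  linarith

theorem QQ_int {N : ℝ} (hN : 4 ≤ N) (m : ℕ) (a : ℕ → ℝ) {h : ℝ → ℝ → ℝ} (hh : Sm h) (t : ℝ) :
    ∫ s in (0:ℝ)..t, QQ N m a h s = a 1 * (∫ s in (0:ℝ)..t, SS N (m + 1) h s)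
      + ∑ s ∈ Finset.Icc 1 m, a s * ∫ x in (0:ℝ)..t, SS N (m + 2 - s) h x := by
  unfold QQ
  have hc : ∀ (n : ℕ) (c : ℝ), Continuous (fun t => c * SS N n h t) := fun n c =>
    (SS_contT hN n hh).const_mul c
  rw [intervalIntegral.integral_add ((hc _ _).intervalIntegrable _ _)
    ((continuous_finsetSum _ fun s _ => hc _ _).intervalIntegrable _ _),
    intervalIntegral.integral_finsetSum (fun s _ => (hc _ _).intervalIntegrable _ _),
    intervalIntegral.integral_const_mul]
  simp_rw [intervalIntegral.integral_const_mul]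

theorem SS_int_nonneg (N : ℝ) (n : ℕ) (y : ℝ → ℝ → ℝ) {t : ℝ} (ht : 0 ≤ t) :
    0 ≤ ∫ s in (0:ℝ)..t, SS N n y s :=
  intervalIntegral.integral_nonneg ht fun s _ => SS_nonneg _ _ _ _

theorem QQ_lower {N : ℝ} (hN : 4 ≤ N) (m : ℕ) : ∃ C > (0:ℝ), ∀ (h : ℝ → ℝ → ℝ), Sm h →
    (∀ q j z, DD q j h 0 z = 0) → ∀ a : ℕ → ℝ, (∀ s, 0 ≤ a s) → ∀ t : ℝ, 0 ≤ t →
    QQ N m a h t ≤ C * ∫ s in (0:ℝ)..t, QQ N (m + 1) a h s := by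
  choose C hC hl using lower hN
  set L := ∑ k ∈ Finset.range (m + 2), C k with hL
  have hLC : ∀ k ≤ m + 1, C k ≤ L := fun k hk =>
    Finset.single_le_sum (f := C) (fun k _ => (hC k).le) (Finset.mem_range.2 (by omega))
  have hL0 : 0 < L := (hC 0).trans_le (hLC 0 (by omega))
  have hle : ∀ (h : ℝ → ℝ → ℝ), Sm h → (∀ q j z, DD q j h 0 z = 0) → ∀ k ≤ m + 1, ∀ c t : ℝ,
      0 ≤ c → 0 ≤ t →
      c * SS N k h t ≤ L * (c * ∫ s in (0:ℝ)..t, SS N (k + 1) h s) := by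
    intro h hh h0 k hk c t hc ht
    have h1 := hl k h hh h0 t ht
    have h2 := mul_le_mul_of_nonneg_right (hLC k hk) (SS_int_nonneg N (k + 1) h ht)
    calc _ ≤ c * (L * ∫ s in (0:ℝ)..t, SS N (k + 1) h s) :=
          mul_le_mul_of_nonneg_left (h1.trans h2) hc
      _ = _ := by ring
  refine ⟨L, hL0, fun h hh h0 a ha t ht => ?_⟩
  rw [QQ_int hN _ _ hh, mul_add, Finset.mul_sum]
  unfold QQ
  refine add_le_add (hle h hh h0 (m + 1) le_rfl _ t (ha 1) ht) ?_
  refine le_trans (Finset.sum_le_sum (g := fun s =>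
    L * (a s * ∫ x in (0:ℝ)..t, SS N (m + 1 + 2 - s) h x)) fun s hs => ?_) ?_
  · have hs' := Finset.mem_Icc.1 hs
    have := hle h hh h0 (m + 2 - s) (by omega) (a s) t (ha s) ht
    rwa [show m + 2 - s + 1 = m + 1 + 2 - s by omega] at this
  · refine Finset.sum_le_sum_of_subset_of_nonneg (Finset.Icc_subset_Icc le_rfl (by omega)) ?_
    intro s _ _
    exact mul_nonneg hL0.le (mul_nonneg (ha s) (SS_int_nonneg N _ h ht))

theorem recur {N T : ℝ} (hN : 4 ≤ N) (hT : 0 < T) (A : ℝ) (m : ℕ) : ∃ C > (0:ℝ),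
    ∀ (b₂ b₁ b₀ g h : ℝ → ℝ → ℝ),
    Sol N T b₂ b₁ b₀ g h → ∀ a : ℕ → ℝ, Monotone a → 1 ≤ a 1 → a 1 ≤ A →
    (∀ t ∈ Icc (0:ℝ) T, CB a b₂ t ∧ CB a b₁ t ∧ CB a b₀ t) →
    ∫ t in (0:ℝ)..T, SS N (m + 2) h t ≤ C * ((∫ t in (0:ℝ)..T, SS N (m + 1) g t)
      + ∑ s ∈ Finset.Icc 2 (m + 1), a s * ∫ t in (0:ℝ)..T, SS N (m + 3 - s) h t) := by
  obtain ⟨C1, hC1, h1⟩ := elliptic hN m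
  obtain ⟨C2, hC2, h2⟩ := energy hN m
  obtain ⟨C3, hC3, h3⟩ := QQ_lower hN m
  obtain ⟨C4, hC4, h4⟩ := lower hN m
  set K := C1 * (C2 + C3 + C4) * (1 + 2 * |A|) with hK
  have hK0 : 0 < K := by positivity
  refine ⟨exp (K * T), exp_pos _, ?_⟩
  intro b₂ b₁ b₀ g h hs a hmono h11 hA hCB
  have ha : ∀ s, 0 ≤ a s := fun s => (hCB 0 ⟨le_rfl, hT.le⟩).1.nonneg s
  have cf : Continuous (fun t => SS N (m + 1) g t
      + ∑ s ∈ Finset.Icc 2 (m + 1), a s * SS N (m + 3 - s) h t) :=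
    (SS_contT hN _ hs.hg).fun_add (continuous_finsetSum _ fun s _ =>
      (SS_contT hN _ hs.hh).const_mul _)
  have fint : ∀ t, ∫ x in (0:ℝ)..t, (SS N (m + 1) g x
      + ∑ s ∈ Finset.Icc 2 (m + 1), a s * SS N (m + 3 - s) h x)
      = (∫ x in (0:ℝ)..t, SS N (m + 1) g x)
        + ∑ s ∈ Finset.Icc 2 (m + 1), a s * ∫ x in (0:ℝ)..t, SS N (m + 3 - s) h x := by
    intro t
    have hc : ∀ (n : ℕ) (c : ℝ), Continuous (fun t => c * SS N n h t) := fun n c =>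
      (SS_contT hN n hs.hh).const_mul c
    rw [intervalIntegral.integral_add ((SS_contT hN _ hs.hg).intervalIntegrable _ _)
      ((continuous_finsetSum _ fun s _ => hc _ _).intervalIntegrable _ _),
      intervalIntegral.integral_finsetSum (fun s _ => (hc _ _).intervalIntegrable _ _)]
    simp_rw [intervalIntegral.integral_const_mul]
  have key := gron hK0.le hT.le (SS_contT hN (m + 2) hs.hh) cf
    (fun t _ => add_nonneg (SS_nonneg _ _ _ _)
      (Finset.sum_nonneg fun s _ => mul_nonneg (ha s) (SS_nonneg _ _ _ _))) ?_
  · rwa [fint] at key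
  intro t ht
  rw [fint]
  obtain ⟨ha2, ha1, ha0⟩ := hCB t ht
  have e1 := h1 T b₂ b₁ b₀ g h hs t ht a hmono h11 ha2 ha1 ha0
  have e2 := h2 T b₂ b₁ b₀ g h hs a hmono h11 hCB t ht
  have e3 := h3 h hs.hh hs.h0 a ha t ht.1
  have e4 := h4 g hs.hg hs.g0 t ht.1
  rw [intervalIntegral.integral_add ((QQ_contT hN _ _ hs.hh).intervalIntegrable _ _)
      ((SS_contT hN _ hs.hg).intervalIntegrable _ _)] at e2
  set G := ∫ x in (0:ℝ)..t, SS N (m + 1) g x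
  set X := ∫ x in (0:ℝ)..t, SS N (m + 2) h x
  set S := ∑ s ∈ Finset.Icc 2 (m + 1), a s * ∫ x in (0:ℝ)..t, SS N (m + 3 - s) h x with hS
  have hG0 : 0 ≤ G := SS_int_nonneg N _ g ht.1
  have hX0 : 0 ≤ X := SS_int_nonneg N _ h ht.1
  have hS0 : 0 ≤ S := Finset.sum_nonneg fun s _ => mul_nonneg (ha s) (SS_int_nonneg N _ h ht.1)
  have hQ : (∫ x in (0:ℝ)..t, QQ N (m + 1) a h x) = 2 * a 1 * X + S := by
    rw [QQ_int hN _ _ hs.hh]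
    have : Finset.Icc 1 (m + 1) = insert 1 (Finset.Icc 2 (m + 1)) := by
      ext x; simp only [Finset.mem_Icc, Finset.mem_insert]; omega
    rw [this, Finset.sum_insert (by simp)]
    rw [show m + 1 + 2 - 1 = m + 2 by omega, show m + 1 + 1 = m + 2 by omega,
      show m + 1 + 2 = m + 3 by omega, ← hS]
    ring
  rw [hQ] at e2 e3
  have hA' : a 1 ≤ |A| := hA.trans (le_abs_self A)
  have hAX : a 1 * X ≤ |A| * X := mul_le_mul_of_nonneg_right hA' hX0
  have z1 : 2 * a 1 * X + S + G ≤ (1 + 2 * |A|) * (X + (G + S)) := by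
    have : 0 ≤ |A| * (G + S) := by positivity
    nlinarith
  have z2 : TT N m h t + SS N m g t + QQ N m a h t ≤ (C2 + C3 + C4) * (2 * a 1 * X + S + G) := by
    have w1 : 0 ≤ a 1 * X := mul_nonneg (ha 1) hX0
    have w2 : 0 ≤ C4 * (2 * a 1 * X + S) := mul_nonneg hC4.le (by linarith)
    have w3 : 0 ≤ C3 * G := by positivity
    linarith
  calc SS N (m + 2) h t ≤ C1 * ((C2 + C3 + C4) * ((1 + 2 * |A|) * (X + (G + S)))) :=
        e1.trans (mul_le_mul_of_nonneg_left (z2.trans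
          (mul_le_mul_of_nonneg_left z1 (by positivity))) hC1.le)
    _ = _ := by rw [hK]; ring

open MeasureTheory Real Set

theorem DelIter_comm (N : ℝ) (m : ℕ) (f : ℝ → ℝ) : DelIter N (m + 1) f = DelIter N m (Del N f) := by
  induction m with
  | zero => rfl
  | succ m ih =>
    have e : DelIter N (m + 1 + 1) f = Del N (DelIter N (m + 1) f) := rfl
    rw [e, ih]; rfl

theorem Xnorm_sq (N : ℝ) (f : ℝ → ℝ) : Xnorm N f ^ 2 = II N 0 f := by
  unfold Xnorm
  rw [Real.sq_sqrt]
  · simp [II]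
  · apply intervalIntegral.integral_nonneg zero_le_one
    intro z hz
    have := wt_nonneg (N := N) hz
    positivity

theorem gnorm_sq (N : ℝ) (k : ℕ) (y : ℝ → ℝ → ℝ) (t : ℝ) : gnorm N k (y t) ^ 2 = GG N k y t := by
  induction k using Nat.twoStepInduction generalizing y with
  | zero => simp [gnorm, DelIter, Xnorm_sq, GG]
  | one =>
    simp only [gnorm, DelIter, Xnorm_sq, GG]
    simp only [Nat.one_mod, one_ne_zero, if_false]
    simp only [Nat.reduceDiv, DelIter, Xnorm_sq]
    unfold II
    refine intervalIntegral.integral_congr fun z hz => ?_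
    rw [uIcc_of_le zero_le_one] at hz
    simp only [Ddot, dz, mul_pow, Real.sq_sqrt hz.1]
    ring
  | more k ih _ =>
    have e : gnorm N (k + 2) (y t) = gnorm N k (DelT N y t) := by
      unfold gnorm
      rw [Nat.add_mod_right, show (k + 2) / 2 = k / 2 + 1 by omega, DelIter_comm]
      rfl
    rw [e, ih]; rfl

theorem normN_sq (N : ℝ) (k : ℕ) (y : ℝ → ℝ → ℝ) (t : ℝ) :
    normN N k (y t) ^ 2 = ∑ l ∈ Finset.range (k + 1), GG N l y t := by
  unfold normN
  rw [Real.sq_sqrt (Finset.sum_nonneg fun l _ => sq_nonneg _)]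
  simp_rw [gnorm_sq]

theorem normT_sq {N : ℝ} (hN : 4 ≤ N) {T : ℝ} (hT : 0 ≤ T) (n : ℕ) {y : ℝ → ℝ → ℝ} (hy : Sm y) :
    normT N T n y ^ 2 = ∫ t in (0:ℝ)..T, ∑ j ∈ Finset.range (n + 1),
      ∑ k ∈ Finset.range (n + 1 - j), ∑ l ∈ Finset.range (k + 1), GG N l (dt^[j] y) t := by
  unfold normT
  rw [Real.sq_sqrt (Finset.sum_nonneg fun j _ => Finset.sum_nonneg fun k _ =>
    intervalIntegral.integral_nonneg hT fun t _ => sq_nonneg _)]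
  have hc : ∀ j k, Continuous (fun t => ∑ l ∈ Finset.range (k + 1), GG N l (dt^[j] y) t) :=
    fun j k => continuous_finsetSum _ fun l _ => GG_contT hN l (hy.dt_iter j)
  have hc2 : ∀ j, Continuous (fun t => ∑ k ∈ Finset.range (n + 1 - j),
      ∑ l ∈ Finset.range (k + 1), GG N l (dt^[j] y) t) :=
    fun j => continuous_finsetSum _ fun k _ => hc j k
  rw [intervalIntegral.integral_finsetSum (fun j _ => (hc2 j).intervalIntegrable _ _)]
  refine Finset.sum_congr rfl fun j _ => ?_
  rw [intervalIntegral.integral_finsetSum (fun k _ => (hc j k).intervalIntegrable _ _)]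
  refine Finset.sum_congr rfl fun k _ => ?_
  simp_rw [normN_sq]

theorem normT_ge {N : ℝ} (hN : 4 ≤ N) {T : ℝ} (hT : 0 ≤ T) (n : ℕ) {y : ℝ → ℝ → ℝ} (hy : Sm y) :
    ∫ t in (0:ℝ)..T, SS N n y t ≤ normT N T n y ^ 2 := by
  rw [normT_sq hN hT n hy]
  refine intT_mono (SS_contT hN n hy) (continuous_finsetSum _ fun j _ =>
    continuous_finsetSum _ fun k _ => continuous_finsetSum _ fun l _ =>
      GG_contT hN l (hy.dt_iter j)) hT fun t _ => ?_
  unfold SS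
  refine Finset.sum_le_sum fun j _ => Finset.sum_le_sum fun k _ => ?_
  exact Finset.single_le_sum (f := fun l => GG N l (dt^[j] y) t) (fun _ _ => GG_nonneg _ _ _ _)
    (Finset.mem_range.2 (by omega))

theorem normT_le {N : ℝ} (hN : 4 ≤ N) {T : ℝ} (hT : 0 ≤ T) (n : ℕ) {y : ℝ → ℝ → ℝ} (hy : Sm y) :
    normT N T n y ^ 2 ≤ (n + 1) ^ 3 * ∫ t in (0:ℝ)..T, SS N n y t := by
  rw [normT_sq hN hT n hy, ← intervalIntegral.integral_const_mul]
  refine intT_mono (continuous_finsetSum _ fun j _ =>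
    continuous_finsetSum _ fun k _ => continuous_finsetSum _ fun l _ =>
      GG_contT hN l (hy.dt_iter j)) ((SS_contT hN n hy).const_mul _) hT fun t _ => ?_
  have h0 := SS_nonneg N n y t
  have hsum : ∀ (m : ℕ) (f : ℕ → ℝ) (X : ℝ), m ≤ n + 1 → 0 ≤ X → (∀ i ∈ Finset.range m, f i ≤ X) →
      ∑ i ∈ Finset.range m, f i ≤ (n + 1) * X := by
    intro m f X hm hX hf
    have := Finset.sum_le_card_nsmul _ _ _ hf
    rw [nsmul_eq_mul, Finset.card_range] at this
    refine this.trans (mul_le_mul_of_nonneg_right ?_ hX)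
    exact_mod_cast hm
  have : ((n:ℝ) + 1) ^ 3 * SS N n y t = (n + 1) * ((n + 1) * ((n + 1) * SS N n y t)) := by ring
  rw [this]
  refine hsum _ _ _ le_rfl (by positivity) fun j hj => ?_
  refine hsum _ _ _ (by omega) (by positivity) fun k hk => ?_
  have hj := Finset.mem_range.1 hj
  have hk := Finset.mem_range.1 hk
  refine hsum _ _ _ (by omega) (by positivity) fun l hl => ?_
  have hl := Finset.mem_range.1 hl
  exact GG_le_SS N (by omega) y t

open MeasureTheory Real Set

/-! ### Interpolation inequalities for the source -/

theorem int_le3 {N : ℝ} (hN : 4 ≤ N) {F f1 f2 f3 : ℝ → ℝ} (r1 r2 r3 : ℕ) (c1 c2 c3 : ℝ)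
    (hF : Continuous F) (h1 : Continuous f1) (h2 : Continuous f2) (h3 : Continuous f3)
    (h : ∀ z ∈ Icc (0:ℝ) 1, F z ≤ c1 * (z ^ r1 * f1 z ^ 2) + c2 * (z ^ r2 * f2 z ^ 2)
      + c3 * (z ^ r3 * f3 z ^ 2)) :
    ∫ z in (0:ℝ)..1, F z * z ^ (N / 2 - 1) ≤ c1 * II N r1 f1 + c2 * II N r2 f2 + c3 * II N r3 f3 := by
  have hw := wt_cont hN
  have k1 := II_cont hN r1 h1
  have k2 := II_cont hN r2 h2
  have k3 := II_cont hN r3 h3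
  have e : c1 * II N r1 f1 + c2 * II N r2 f2 + c3 * II N r3 f3
      = ∫ z in (0:ℝ)..1, (c1 * (z ^ r1 * f1 z ^ 2 * z ^ (N / 2 - 1))
        + c2 * (z ^ r2 * f2 z ^ 2 * z ^ (N / 2 - 1)) + c3 * (z ^ r3 * f3 z ^ 2 * z ^ (N / 2 - 1))) := by
    unfold II
    rw [intervalIntegral.integral_add, intervalIntegral.integral_add,
      intervalIntegral.integral_const_mul, intervalIntegral.integral_const_mul,
      intervalIntegral.integral_const_mul]
    · exact (k1.const_mul c1).intervalIntegrable _ _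
    · exact (k2.const_mul c2).intervalIntegrable _ _
    · exact ((k1.const_mul c1).fun_add (k2.const_mul c2)).intervalIntegrable _ _
    · exact (k3.const_mul c3).intervalIntegrable _ _
  rw [e]
  refine int01_mono (by fun_prop)
    (((k1.const_mul c1).fun_add (k2.const_mul c2)).fun_add (k3.const_mul c3)) fun z hz => ?_
  have := mul_le_mul_of_nonneg_right (h z hz) (wt_nonneg (N := N) hz)
  linarith

theorem young (a b : ℝ) {μ : ℝ} (hμ : 0 < μ) : 2 * a * b ≤ μ * a ^ 2 + μ⁻¹ * b ^ 2 := by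
  have h : μ * a ^ 2 + μ⁻¹ * b ^ 2 - 2 * a * b = μ * (a - μ⁻¹ * b) ^ 2 := by
    field_simp
    ring
  have := mul_nonneg hμ.le (sq_nonneg (a - μ⁻¹ * b))
  linarith

theorem young' (a b : ℝ) {μ : ℝ} (hμ : 0 < μ) : -(2 * a * b) ≤ μ * a ^ 2 + μ⁻¹ * b ^ 2 := by
  have := young (-a) b hμ
  nlinarith

/-- Trace inequality. -/
theorem trace1 {N : ℝ} (hN : 4 ≤ N) {y : ℝ → ℝ → ℝ} (hy : Sm y) (t : ℝ) {μ : ℝ} (hμ : 0 < μ) :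
    y t 1 ^ 2 ≤ (N / 2 + μ⁻¹) * II N 0 (y t) + μ * II N 1 (dz y t) := by
  have c0 := hy.contz t
  have c1 := hy.dz.contz t
  have h := ibp hN 0 (p := fun z => y t z ^ 2) (p' := fun z => 2 * y t z * dz y t z)
    (fun z => ((hy.hasDerivAt_z t z).pow 2).congr_deriv (by simp)) (by fun_prop)
  rw [← h]
  refine (int_le3 hN 0 1 0 (N / 2 + μ⁻¹) μ 0 (f1 := y t) (f2 := dz y t) (f3 := y t) (by fun_prop)
    c0 c1 c0 fun z hz => ?_).trans_eq (by ring)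
  have hz0 := hz.1
  have y1 := young (dz y t z) (y t z) hμ
  have y2 := mul_le_mul_of_nonneg_left y1 hz0
  have y3 : z * (μ⁻¹ * y t z ^ 2) ≤ μ⁻¹ * y t z ^ 2 :=
    mul_le_of_le_one_left (by positivity) hz.2
  simp only [pow_zero, pow_one, Nat.cast_zero]
  nlinarith

theorem trace2 {N : ℝ} (hN : 4 ≤ N) {y : ℝ → ℝ → ℝ} (hy : Sm y) (t : ℝ) {μ : ℝ} (hμ : 0 < μ) :
    dz y t 1 ^ 2 ≤ μ * II N 0 (DelT N y t) + μ⁻¹ * II N 1 (dz y t) := by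
  have c0 := (hy.DelT N).contz t
  have c1 := hy.dz.contz t
  have c2 := hy.dz.dz.contz t
  have h := ibp hN 1 (p := fun z => dz y t z ^ 2) (p' := fun z => 2 * dz y t z * dz (dz y) t z)
    (fun z => ((hy.dz.hasDerivAt_z t z).pow 2).congr_deriv (by simp)) (by fun_prop)
  rw [← h]
  refine (int_le3 hN 0 1 0 μ μ⁻¹ 0 (f1 := DelT N y t) (f2 := dz y t) (f3 := dz y t) (by fun_prop)
    c0 c1 c1 fun z hz => ?_).trans_eq (by ring)
  have hz0 := hz.1
  have e : DelT N y t z = z * dz (dz y) t z + N / 2 * dz y t z := rfl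
  have y1 := young (DelT N y t z) (z * dz y t z) hμ
  have hi : 0 < μ⁻¹ := inv_pos.2 hμ
  have y3 : μ⁻¹ * (z * dz y t z) ^ 2 ≤ μ⁻¹ * (z * dz y t z ^ 2) := by
    apply mul_le_mul_of_nonneg_left _ hi.le
    have : 0 ≤ z * dz y t z ^ 2 := by positivity
    nlinarith [hz.2]
  have y4 : 0 ≤ (N / 2 - 1) * (z * dz y t z ^ 2) := by
    have : 0 ≤ z * dz y t z ^ 2 := by positivity
    exact mul_nonneg (by linarith) this
  have e2 : z * dz (dz y) t z = DelT N y t z - N / 2 * dz y t z := by rw [e]; ring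
  simp only [pow_zero, pow_one, Nat.cast_one]
  have e3 : z * (z * (2 * dz y t z * dz (dz y) t z))
      = 2 * DelT N y t z * (z * dz y t z) - N * (z * dz y t z ^ 2) := by
    have : z * (z * (2 * dz y t z * dz (dz y) t z)) = 2 * z * dz y t z * (z * dz (dz y) t z) := by ring
    rw [this, e2]; ring
  rw [e3]
  linarith

theorem interp0 {N : ℝ} (hN : 4 ≤ N) {y : ℝ → ℝ → ℝ} (hy : Sm y) (t : ℝ) {s : ℝ} (hs : 0 < s)
    (hs1 : s ≤ 1) :
    II N 1 (dz y t) ≤ 9 * N ^ 2 * (s ^ 2 * II N 0 (DelT N y t) + (s ^ 2)⁻¹ * II N 0 (y t)) := by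
  have c0 := hy.contz t
  have cU := (hy.DelT N).contz t
  have c1 := hy.dz.contz t
  have c2 := hy.dz.dz.contz t
  have h := ibp hN 0 (p := fun z => -(y t z * dz y t z))
    (p' := fun z => -(dz y t z * dz y t z + y t z * dz (dz y) t z))
    (fun z => ((hy.hasDerivAt_z t z).mul (hy.dz.hasDerivAt_z t z)).neg) (by fun_prop)
  have hs2 : 0 < s ^ 2 := by positivity
  have h1 := (int_le3 hN 0 0 1 (s ^ 2 / 2) ((s ^ 2)⁻¹ / 2) (-1) (f1 := DelT N y t) (f2 := y t)
    (f3 := dz y t)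
    (F := fun z => ((((0:ℕ):ℝ) + N / 2) * (z ^ 0 * -(y t z * dz y t z)) +
      z ^ 0 * (z * -(dz y t z * dz y t z + y t z * dz (dz y) t z))))
    (by fun_prop) cU c0 c1 fun z hz => ?_)
  · rw [h] at h1
    have t1 := trace1 hN hy t (μ := s / 4) (by positivity)
    have t2 := trace2 hN hy t (μ := s) hs
    have p1 := young (dz y t 1) (y t 1) (μ := s / 2) (by positivity)
    have a0 := II_nonneg N 0 (y t)
    have a1 := II_nonneg N 1 (dz y t)
    have a2 := II_nonneg N 0 (DelT N y t)
    generalize II N 0 (y t) = A0 at *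
    generalize II N 1 (dz y t) = A1 at *
    generalize II N 0 (DelT N y t) = A2 at *
    have hi : 0 < s⁻¹ := by positivity
    have e1 : (s / 2)⁻¹ * y t 1 ^ 2 ≤ (2 * s⁻¹) * ((N / 2 + (s / 4)⁻¹) * A0 + s / 4 * A1) := by
      have : (s / 2)⁻¹ = 2 * s⁻¹ := by field_simp
      rw [this]
      exact mul_le_mul_of_nonneg_left t1 (by positivity)
    have e2 : (s / 2) * dz y t 1 ^ 2 ≤ (s / 2) * (s * A2 + s⁻¹ * A1) :=
      mul_le_mul_of_nonneg_left t2 (by positivity)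
    have e3 : (2 * s⁻¹) * ((N / 2 + (s / 4)⁻¹) * A0 + s / 4 * A1)
        = N * s⁻¹ * A0 + 8 * (s ^ 2)⁻¹ * A0 + A1 / 2 := by
      field_simp
      ring
    have e4 : (s / 2) * (s * A2 + s⁻¹ * A1) = s ^ 2 / 2 * A2 + A1 / 2 := by
      field_simp
    have e5 : N * s⁻¹ * A0 ≤ N * (s ^ 2)⁻¹ * A0 := by
      have : s⁻¹ ≤ (s ^ 2)⁻¹ := inv_anti₀ hs2 (by nlinarith)
      gcongr
    have k1 : A1 ≤ 3 / 2 * (s ^ 2 * A2) + (N + 9) * ((s ^ 2)⁻¹ * A0) := by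
      have : 0 ≤ (s ^ 2)⁻¹ * A0 := by positivity
      linarith
    have k2 : 0 ≤ (s ^ 2)⁻¹ * A0 := by positivity
    have k3 : 0 ≤ s ^ 2 * A2 := by positivity
    have k4 : N + 9 ≤ 9 * N ^ 2 := by nlinarith
    have k5 : 3 / 2 ≤ 9 * N ^ 2 := by nlinarith
    nlinarith [mul_le_mul_of_nonneg_right k4 k2, mul_le_mul_of_nonneg_right k5 k3]
  · have e : DelT N y t z = z * dz (dz y) t z + N / 2 * dz y t z := rfl
    have := young' (DelT N y t z) (y t z) hs2
    simp only [pow_zero, pow_one, Nat.cast_zero]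
    have e3 : (0 + N / 2) * (1 * -(y t z * dz y t z)) +
      1 * (z * -(dz y t z * dz y t z + y t z * dz (dz y) t z))
        = - (y t z * DelT N y t z) - z * dz y t z ^ 2 := by rw [e]; ring
    rw [e3]
    linarith

theorem interp1 {N : ℝ} (hN : 4 ≤ N) {y : ℝ → ℝ → ℝ} (hy : Sm y) (t : ℝ) {s : ℝ} (hs : 0 < s)
    (hs1 : s ≤ 1) :
    II N 0 (DelT N y t)
      ≤ 9 * N ^ 2 * (s ^ 2 * II N 1 (dz (DelT N y) t) + (s ^ 2)⁻¹ * II N 1 (dz y t)) := by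
  have hU := hy.DelT N
  have cU := hU.contz t
  have cU' := hU.dz.contz t
  have c1 := hy.dz.contz t
  have c2 := hy.dz.dz.contz t
  have h := ibp hN 0 (p := fun z => -(dz y t z * DelT N y t z))
    (p' := fun z => -(dz (dz y) t z * DelT N y t z + dz y t z * dz (DelT N y) t z))
    (fun z => ((hy.dz.hasDerivAt_z t z).mul (hU.hasDerivAt_z t z)).neg) (by fun_prop)
  have hs2 : 0 < s ^ 2 := by positivity
  have h1 := (int_le3 hN 1 1 0 (s ^ 2 / 2) ((s ^ 2)⁻¹ / 2) (-1) (f1 := dz (DelT N y) t) (f2 := dz y t)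
    (f3 := DelT N y t)
    (F := fun z => ((((0:ℕ):ℝ) + N / 2) * (z ^ 0 * -(dz y t z * DelT N y t z)) +
      z ^ 0 * (z * -(dz (dz y) t z * DelT N y t z + dz y t z * dz (DelT N y) t z))))
    (by fun_prop) cU' c1 cU fun z hz => ?_)
  · rw [h] at h1
    have hN0 : 0 < N := by linarith
    have hκ : 0 < s / (2 * N) := by positivity
    have t1 := trace1 hN hU t (μ := 4 * (s / (2 * N))) (by positivity)
    have t2 := trace2 hN hy t (μ := (s / (2 * N)) / 2) (by positivity)
    have p1 := young (DelT N y t 1) (dz y t 1) (μ := s / (2 * N)) (by positivity)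
    have a0 := II_nonneg N 1 (dz y t)
    have a1 := II_nonneg N 0 (DelT N y t)
    have a2 := II_nonneg N 1 (dz (DelT N y) t)
    generalize II N 1 (dz y t) = A0 at *
    generalize II N 0 (DelT N y t) = A1 at *
    generalize II N 1 (dz (DelT N y) t) = A2 at *
    have e1 := mul_le_mul_of_nonneg_left t1 hκ.le
    have e2 := mul_le_mul_of_nonneg_left t2 (inv_pos.2 hκ).le
    have e3 : (s / (2 * N)) * ((N / 2 + (4 * (s / (2 * N)))⁻¹) * A1 + 4 * (s / (2 * N)) * A2)
        = s / 4 * A1 + A1 / 4 + (s ^ 2 * A2) / N ^ 2 := by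
      field_simp
      ring
    have e4 : (s / (2 * N))⁻¹ * (s / (2 * N) / 2 * A1 + (s / (2 * N) / 2)⁻¹ * A0)
        = A1 / 2 + 8 * N ^ 2 * ((s ^ 2)⁻¹ * A0) := by
      field_simp
      ring
    have e5 : s / 4 * A1 ≤ A1 / 4 := by nlinarith
    have k2 : 0 ≤ (s ^ 2)⁻¹ * A0 := by positivity
    have k3 : 0 ≤ s ^ 2 * A2 := by positivity
    have e6 : (s ^ 2 * A2) / N ^ 2 ≤ s ^ 2 * A2 := div_le_self k3 (by nlinarith)
    have k1 : A1 ≤ 2 * (s ^ 2 * A2) + (8 * N ^ 2 + 1) * ((s ^ 2)⁻¹ * A0) := by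
      linarith
    have k4 : 8 * N ^ 2 + 1 ≤ 9 * N ^ 2 := by nlinarith
    have k5 : 2 ≤ 9 * N ^ 2 := by nlinarith
    nlinarith [mul_le_mul_of_nonneg_right k4 k2, mul_le_mul_of_nonneg_right k5 k3]
  · have e : DelT N y t z = z * dz (dz y) t z + N / 2 * dz y t z := rfl
    have := young' (dz (DelT N y) t z) (dz y t z) hs2
    have := mul_le_mul_of_nonneg_left this hz.1
    simp only [pow_zero, pow_one, Nat.cast_zero]
    have e3 : (0 + N / 2) * (1 * -(dz y t z * DelT N y t z)) +
      1 * (z * -(dz (dz y) t z * DelT N y t z + dz y t z * dz (DelT N y) t z))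
        = - (z * (dz y t z * dz (DelT N y) t z)) - DelT N y t z ^ 2 := by rw [e]; ring
    rw [e3]
    linarith

theorem interp {N : ℝ} (hN : 4 ≤ N) (k : ℕ) {y : ℝ → ℝ → ℝ} (hy : Sm y) (t : ℝ) {s : ℝ} (hs : 0 < s)
    (hs1 : s ≤ 1) :
    GG N (k + 1) y t ≤ 9 * N ^ 2 * (s ^ 2 * GG N (k + 2) y t + (s ^ 2)⁻¹ * GG N k y t) := by
  induction k using Nat.twoStepInduction generalizing y with
  | zero => exact interp0 hN hy t hs hs1
  | one => exact interp1 hN hy t hs hs1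
  | more k ih _ => exact ih (hy.DelT N)

theorem II_growth' {N : ℝ} (hN : 4 ≤ N) {u : ℝ → ℝ → ℝ} (hu : Sm u)
    (h0 : ∀ z, u 0 z = 0) {t : ℝ} (ht : 0 ≤ t) {μ : ℝ} (hμ : 0 < μ) :
    II N 0 (u t) ≤ ∫ s in (0:ℝ)..t, (μ * II N 0 (dt u s) + μ⁻¹ * II N 0 (u s)) := by
  have h1 := wt_cont2 hN
  have hw := wt_cont hN
  have h2 := hu.cont
  have h3 := hu.dt.cont
  refine le_int (II_deriv hN 0 hu) ?_
    (((II_contT hN 0 hu.dt).const_mul μ).fun_add ((II_contT hN 0 hu).const_mul μ⁻¹)) ?_ ht ?_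
  · exact param_cont (F := fun t z => z ^ 0 * (2 * u t z * dt u t z) * z ^ (N / 2 - 1))
      (by fun_prop)
  · simp [II, h0]
  · intro s _
    have c1 := hu.contz s
    have c2 := hu.dt.contz s
    refine (int_le3 hN 0 0 0 μ μ⁻¹ 0 (f1 := dt u s) (f2 := u s) (f3 := u s) (by fun_prop) c2 c1 c1
      fun z hz => ?_).trans_eq (by ring)
    have := young (dt u s z) (u s z) hμ
    simp only [pow_zero]
    linarith

theorem interpT {N : ℝ} (hN : 4 ≤ N) {u : ℝ → ℝ → ℝ} (hu : Sm u)
    (h0 : ∀ z, u 0 z = 0) (h0' : ∀ z, dt u 0 z = 0) {T : ℝ} (hT : 0 ≤ T) {s : ℝ} (hs : 0 < s) :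
    ∫ t in (0:ℝ)..T, II N 0 (dt u t) ≤ 9 * N ^ 2 * (s ^ 2 * (∫ t in (0:ℝ)..T, II N 0 (dt (dt u) t))
      + (s ^ 2)⁻¹ * ∫ t in (0:ℝ)..T, II N 0 (u t)) := by
  have h1 := wt_cont2 hN
  have hw := wt_cont hN
  have hs2 : 0 < s ^ 2 := by positivity
  have c0 := hu.cont
  have c1 := hu.dt.cont
  have c2 := hu.dt.dt.cont
  have i0 := II_contT hN 0 hu
  have i1 := II_contT hN 0 hu.dt
  have i2 := II_contT hN 0 hu.dt.dt
  have hd : ∀ t, HasDerivAt (fun t => ∫ z in (0:ℝ)..1, -(u t z * dt u t z) * z ^ (N / 2 - 1))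
      (∫ z in (0:ℝ)..1, -(dt u t z * dt u t z + u t z * dt (dt u) t z) * z ^ (N / 2 - 1)) t := by
    intro t
    refine param_deriv (F := fun t z => -(u t z * dt u t z) * z ^ (N / 2 - 1))
      (F' := fun t z => -(dt u t z * dt u t z + u t z * dt (dt u) t z) * z ^ (N / 2 - 1))
      (by fun_prop) (by fun_prop) (fun t z => ?_) t
    exact (((hu.hasDerivAt_t t z).mul (hu.dt.hasDerivAt_t t z)).neg).mul_const _
  have hle := le_int hd (param_cont (F := fun t z =>
      -(dt u t z * dt u t z + u t z * dt (dt u) t z) * z ^ (N / 2 - 1)) (by fun_prop))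
    (ψ := fun t => s ^ 2 / 2 * II N 0 (dt (dt u) t) + (s ^ 2)⁻¹ / 2 * II N 0 (u t)
      + (-1) * II N 0 (dt u t))
    (((i2.const_mul _).fun_add (i0.const_mul _)).fun_add (i1.const_mul _)) (by simp [h0]) hT
    (by
      intro t _
      have d0 := hu.contz t
      have d1 := hu.dt.contz t
      have d2 := hu.dt.dt.contz t
      refine int_le3 hN 0 0 0 _ _ _ (by fun_prop) d2 d0 d1 fun z hz => ?_
      have := young' (dt (dt u) t z) (u t z) hs2
      simp only [pow_zero]
      linarith)
  have d0 := hu.contz T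
  have d1 := hu.dt.contz T
  have hb : -(∫ z in (0:ℝ)..1, -(u T z * dt u T z) * z ^ (N / 2 - 1))
      ≤ s / 4 * II N 0 (dt u T) + s⁻¹ * II N 0 (u T) := by
    rw [← intervalIntegral.integral_neg]
    have := int_le3 hN 0 0 0 (s / 4) (s⁻¹) 0 (f1 := dt u T) (f2 := u T) (f3 := u T)
      (F := fun z => u T z * dt u T z) (by fun_prop) d1 d0 d0 (fun z hz => by
        have := young (dt u T z) (u T z) (μ := s / 2) (by positivity)
        have e : (s / 2)⁻¹ = 2 * s⁻¹ := by field_simp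
        rw [e] at this
        simp only [pow_zero]
        linarith)
    calc _ = ∫ z in (0:ℝ)..1, (u T z * dt u T z) * z ^ (N / 2 - 1) := by
          congr 1; funext z; ring
      _ ≤ _ := this.trans_eq (by ring)
  have g0 := II_growth' hN hu h0 hT (μ := s / 4) (by positivity)
  have g1 := II_growth' hN hu.dt h0' hT (μ := s) hs
  rw [intervalIntegral.integral_add ((i2.const_mul _).intervalIntegrable _ _)
    ((i1.const_mul _).intervalIntegrable _ _), intervalIntegral.integral_const_mul,
    intervalIntegral.integral_const_mul] at g1
  rw [intervalIntegral.integral_add ((i1.const_mul _).intervalIntegrable _ _)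
    ((i0.const_mul _).intervalIntegrable _ _), intervalIntegral.integral_const_mul,
    intervalIntegral.integral_const_mul] at g0
  rw [intervalIntegral.integral_add
    (((i2.const_mul _).fun_add (i0.const_mul _)).intervalIntegrable _ _)
    ((i1.const_mul _).intervalIntegrable _ _), intervalIntegral.integral_add
    ((i2.const_mul _).intervalIntegrable _ _)
    ((i0.const_mul _).intervalIntegrable _ _), intervalIntegral.integral_const_mul,
    intervalIntegral.integral_const_mul, intervalIntegral.integral_const_mul] at hle
  have a0 : 0 ≤ ∫ t in (0:ℝ)..T, II N 0 (u t) :=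
    intervalIntegral.integral_nonneg hT fun t _ => II_nonneg _ _ _
  have a1 : 0 ≤ ∫ t in (0:ℝ)..T, II N 0 (dt u t) :=
    intervalIntegral.integral_nonneg hT fun t _ => II_nonneg _ _ _
  have a2 : 0 ≤ ∫ t in (0:ℝ)..T, II N 0 (dt (dt u) t) :=
    intervalIntegral.integral_nonneg hT fun t _ => II_nonneg _ _ _
  generalize (∫ t in (0:ℝ)..T, II N 0 (u t)) = A0 at *
  generalize (∫ t in (0:ℝ)..T, II N 0 (dt u t)) = A1 at *
  generalize (∫ t in (0:ℝ)..T, II N 0 (dt (dt u) t)) = A2 at *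
  have e1 := mul_le_mul_of_nonneg_left g1 (show 0 ≤ s / 4 by positivity)
  have e2 := mul_le_mul_of_nonneg_left g0 (show 0 ≤ s⁻¹ by positivity)
  have e3 : s / 4 * (s * A2 + s⁻¹ * A1) = (s ^ 2 * A2) / 4 + A1 / 4 := by
    field_simp
  have e4 : s⁻¹ * (s / 4 * A1 + (s / 4)⁻¹ * A0) = A1 / 4 + 4 * ((s ^ 2)⁻¹ * A0) := by
    field_simp
  have k2 : 0 ≤ (s ^ 2)⁻¹ * A0 := by positivity
  have k3 : 0 ≤ s ^ 2 * A2 := by positivity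
  have k1 : A1 ≤ 2 * (s ^ 2 * A2) + 9 * ((s ^ 2)⁻¹ * A0) := by
    linarith
  have k4 : 9 ≤ 9 * N ^ 2 := by nlinarith
  have k5 : 2 ≤ 9 * N ^ 2 := by nlinarith
  nlinarith [mul_le_mul_of_nonneg_right k4 k2, mul_le_mul_of_nonneg_right k5 k3]

theorem SSint_le (N : ℝ) (hN : 4 ≤ N) (n : ℕ) {y : ℝ → ℝ → ℝ} (hy : Sm y) {T X : ℝ}
    (h : ∀ j k, j + k ≤ n → ∫ t in (0:ℝ)..T, GG N k (dt^[j] y) t ≤ X)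
    (hX : 0 ≤ X) : ∫ t in (0:ℝ)..T, SS N n y t ≤ (n + 1) ^ 2 * X := by
  unfold SS
  rw [intervalIntegral.integral_finsetSum fun j _ => (continuous_finsetSum _ fun k _ =>
    GG_contT hN k (hy.dt_iter j)).intervalIntegrable _ _]
  have h1 : ∀ j ∈ Finset.range (n + 1), ∫ t in (0:ℝ)..T,
      ∑ k ∈ Finset.range (n + 1 - j), GG N k (dt^[j] y) t ≤ (n + 1) * X := by
    intro j hj
    rw [intervalIntegral.integral_finsetSum fun k _ =>
      (GG_contT hN k (hy.dt_iter j)).intervalIntegrable _ _]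
    have : ∑ k ∈ Finset.range (n + 1 - j), ∫ t in (0:ℝ)..T, GG N k (dt^[j] y) t
        ≤ ∑ k ∈ Finset.range (n + 1 - j), X := by
      refine Finset.sum_le_sum fun k hk => h j k ?_
      have := Finset.mem_range.1 hk
      omega
    refine this.trans ?_
    rw [Finset.sum_const, Finset.card_range, nsmul_eq_mul]
    refine mul_le_mul_of_nonneg_right ?_ hX
    exact_mod_cast Nat.sub_le _ _
  refine (Finset.sum_le_sum h1).trans ?_
  rw [Finset.sum_const, Finset.card_range, nsmul_eq_mul]
  push_cast
  linarith

theorem GGint_le {N : ℝ} (hN : 4 ≤ N) {n j k : ℕ} (h : j + k ≤ n) {y : ℝ → ℝ → ℝ} (hy : Sm y)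
    {T : ℝ} (hT : 0 ≤ T) :
    ∫ t in (0:ℝ)..T, GG N k (dt^[j] y) t ≤ ∫ t in (0:ℝ)..T, SS N n y t :=
  intT_mono (GG_contT hN k (hy.dt_iter j)) (SS_contT hN n hy) hT fun t _ => GG_le_SS N h y t

theorem SS_int_nonneg' (N : ℝ) (n : ℕ) (y : ℝ → ℝ → ℝ) {T : ℝ} (hT : 0 ≤ T) :
    0 ≤ ∫ t in (0:ℝ)..T, SS N n y t :=
  intervalIntegral.integral_nonneg hT fun t _ => SS_nonneg _ _ _ _

theorem interpSS {N : ℝ} (hN : 4 ≤ N) (k : ℕ) : ∃ C > (0:ℝ), ∀ (T : ℝ) (y : ℝ → ℝ → ℝ), 0 ≤ T → Sm y →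
    (∀ q j z, DD q j y 0 z = 0) → ∀ s : ℝ, 0 < s → s ≤ 1 →
    ∫ t in (0:ℝ)..T, SS N (k + 1) y t ≤ C * (s ^ 2 * (∫ t in (0:ℝ)..T, SS N (k + 2) y t)
      + (s ^ 2)⁻¹ * ∫ t in (0:ℝ)..T, SS N k y t) := by
  refine ⟨((k + 1 : ℕ) + 1) ^ 2 * (9 * N ^ 2), by positivity, fun T y hT hy h0 s hs hs1 => ?_⟩
  have hs2 : 0 < s ^ 2 := by positivity
  have n0 := SS_int_nonneg' N k y hT
  have n2 := SS_int_nonneg' N (k + 2) y hT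
  rw [mul_assoc]
  refine SSint_le N hN (k + 1) hy (fun j l hjl => ?_) (by positivity)
  rcases Nat.lt_or_ge (j + l) (k + 1) with h | h
  · refine (GGint_le hN (show j + l ≤ k by omega) hy hT).trans ?_
    have e : 1 ≤ (s ^ 2)⁻¹ := (one_le_inv₀ hs2).2 (by nlinarith)
    have k4 : 1 ≤ 9 * N ^ 2 := by nlinarith
    have a : (∫ t in (0:ℝ)..T, SS N k y t) ≤ (s ^ 2)⁻¹ * ∫ t in (0:ℝ)..T, SS N k y t :=
      le_mul_of_one_le_left n0 e
    have b : 0 ≤ s ^ 2 * ∫ t in (0:ℝ)..T, SS N (k + 2) y t := by positivity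
    refine (a.trans (le_add_of_nonneg_left b)).trans ?_
    exact le_mul_of_one_le_left (by positivity) k4
  · cases l with
    | zero =>
      obtain rfl : j = k + 1 := by omega
      have := interpT hN (hy.dt_iter k) (fun z => h0 0 k z) (fun z => by
        have := h0 0 (k + 1) z
        rwa [← dt_iter_eq_DD, Function.iterate_succ_apply'] at this) hT hs
      rw [← Function.iterate_succ_apply' dt k y, ← Function.iterate_succ_apply' dt (k + 1) y] at this
      have g1 := GGint_le hN (show (k + 2) + 0 ≤ k + 2 by omega) hy hT
      have g2 := GGint_le hN (show k + 0 ≤ k by omega) hy hT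
      refine this.trans ?_
      have hp : 0 ≤ 9 * N ^ 2 := by positivity
      refine mul_le_mul_of_nonneg_left (add_le_add ?_ ?_) hp
      · exact mul_le_mul_of_nonneg_left g1 hs2.le
      · exact mul_le_mul_of_nonneg_left g2 (inv_pos.2 hs2).le
    | succ l =>
      have hyj := hy.dt_iter j
      have := intT_mono (GG_contT hN (l + 1) hyj) ((((GG_contT hN (l + 2) hyj).const_mul
        (s ^ 2)).fun_add ((GG_contT hN l hyj).const_mul (s ^ 2)⁻¹)).const_mul (9 * N ^ 2)) hT
        fun t _ => interp hN l hyj t hs hs1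
      refine this.trans ?_
      rw [intervalIntegral.integral_const_mul, intervalIntegral.integral_add
        (((GG_contT hN (l + 2) hyj).const_mul (s ^ 2)).intervalIntegrable _ _)
        (((GG_contT hN l hyj).const_mul (s ^ 2)⁻¹).intervalIntegrable _ _),
        intervalIntegral.integral_const_mul, intervalIntegral.integral_const_mul]
      have g1 := GGint_le hN (show j + (l + 2) ≤ k + 2 by omega) hy hT
      have g2 := GGint_le hN (show j + l ≤ k by omega) hy hT
      have hp : 0 ≤ 9 * N ^ 2 := by positivity
      refine mul_le_mul_of_nonneg_left (add_le_add ?_ ?_) hp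
      · exact mul_le_mul_of_nonneg_left g1 hs2.le
      · exact mul_le_mul_of_nonneg_left g2 (inv_pos.2 hs2).le

/-- Optimising the parameter in an interpolation inequality. -/
theorem opt {C a0 a1 a2 : ℝ} (hC : 0 < C) (h0 : 1 ≤ a0) (h02 : a0 ≤ a2) (h1 : 0 ≤ a1)
    (h : ∀ s : ℝ, 0 < s → s ≤ 1 → a1 ≤ C * (s ^ 2 * a2 + (s ^ 2)⁻¹ * a0)) :
    a1 ^ 2 ≤ 4 * C ^ 2 * (a0 * a2) := by
  have p0 : 0 < a0 := by linarith
  have p2 : 0 < a2 := by linarith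
  set x := √(a0 / a2) with hx
  have hx0 : 0 < x := Real.sqrt_pos.2 (by positivity)
  have hx2 : x ^ 2 = a0 / a2 := Real.sq_sqrt (by positivity)
  have hx1 : x ≤ 1 := by
    rw [hx, Real.sqrt_le_one, div_le_one p2]; exact h02
  have hs2 : √x ^ 2 = x := Real.sq_sqrt hx0.le
  have := h (√x) (Real.sqrt_pos.2 hx0) (Real.sqrt_le_one.2 hx1)
  rw [hs2] at this
  have e : x⁻¹ * a0 = x * a2 := by
    have : a0 = x ^ 2 * a2 := by rw [hx2]; field_simp
    rw [this]; field_simp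
  rw [e] at this
  have h3 : a1 ≤ 2 * C * (x * a2) := by linarith
  have h4 : a1 ^ 2 ≤ (2 * C * (x * a2)) ^ 2 := pow_le_pow_left₀ h1 h3 2
  refine h4.trans_eq ?_
  rw [mul_pow, mul_pow, mul_pow, hx2]
  field_simp
  ring

theorem logconvG {N : ℝ} (hN : 4 ≤ N) (k : ℕ) : ∃ C > (0:ℝ), ∀ (T : ℝ) (y : ℝ → ℝ → ℝ), 0 ≤ T → Sm y →
    (∀ q j z, DD q j y 0 z = 0) →
    (1 + ∫ t in (0:ℝ)..T, SS N (k + 1) y t) ^ 2 ≤ C * ((1 + ∫ t in (0:ℝ)..T, SS N k y t) *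
      (1 + ∫ t in (0:ℝ)..T, SS N (k + 2) y t)) := by
  obtain ⟨C, hC, h⟩ := interpSS hN k
  refine ⟨4 * (C + 1) ^ 2, by positivity, fun T y hT hy h0 => ?_⟩
  have n0 := SS_int_nonneg' N k y hT
  have n1 := SS_int_nonneg' N (k + 1) y hT
  have n2 := SS_int_nonneg' N (k + 2) y hT
  have m := intT_mono (SS_contT hN k hy) (SS_contT hN (k + 2) hy) hT
    fun t _ => SS_mono N (show k ≤ k + 2 by omega) y t
  refine opt (by positivity) (by linarith) (by linarith) (by linarith) fun s hs hs1 => ?_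
  have := h T y hT hy h0 s hs hs1
  have hs2 : 0 < s ^ 2 := by positivity
  have e : 1 ≤ (s ^ 2)⁻¹ := (one_le_inv₀ hs2).2 (by nlinarith)
  have b1 : 0 ≤ s ^ 2 * ∫ t in (0:ℝ)..T, SS N (k + 2) y t := by positivity
  have b2 : 0 ≤ (s ^ 2)⁻¹ * ∫ t in (0:ℝ)..T, SS N k y t := by positivity
  have b3 : 0 ≤ C * (s ^ 2 + (s ^ 2)⁻¹) := by positivity
  nlinarith

open MeasureTheory Real Set

/-! ### Sup norms of the coefficients -/

/-- Hardy inequality in sup norm. -/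
theorem sup_hardy (r : ℕ) {u u' G : ℝ → ℝ} (hu : ∀ z, HasDerivAt u (u' z) z) (c X : ℝ)
    (hc : r + 1 ≤ 2 * c) (h : ∀ z, z * u' z + c * u z = G z)
    (hG : ∀ z ∈ Icc (0:ℝ) 1, z ^ r * G z ^ 2 ≤ X) :
    ∀ z ∈ Icc (0:ℝ) 1, z ^ r * u z ^ 2 ≤ 4 * X := by
  have huc : Continuous u := continuous_iff_continuousAt.2 fun z => (hu z).continuousAt
  obtain ⟨z0, hz0, hmax⟩ := isCompact_Icc.exists_isMaxOn (nonempty_Icc.2 zero_le_one)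
    (show Continuous (fun z : ℝ => z ^ r * u z ^ 2) by fun_prop).continuousOn (s := Icc (0:ℝ) 1)
  have key : z0 ^ r * u z0 ^ 2 ≤ 4 * (z0 ^ r * G z0 ^ 2) := by
    have hr0 : (0:ℝ) ≤ r := Nat.cast_nonneg r
    have hp : 0 ≤ z0 ^ r := pow_nonneg hz0.1 r
    have hh := h z0
    rcases hz0.1.eq_or_lt with e | hpos
    · cases r with
      | zero =>
        rw [← e] at hh ⊢
        simp only [pow_zero, one_mul]
        rw [← hh]
        simp only [zero_mul, zero_add]
        simp at hc
        have h4 : 1 ≤ 4 * c ^ 2 := by nlinarith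
        have := mul_le_mul_of_nonneg_right h4 (sq_nonneg (u 0))
        nlinarith
      | succ r => rw [← e]; simp
    · have hd : HasDerivAt (fun z : ℝ => z ^ r * u z ^ 2)
          ((r * z0 ^ (r - 1)) * u z0 ^ 2 + z0 ^ r * (2 * u z0 * u' z0)) z0 :=
        ((hasDerivAt_pow r z0).mul ((hu z0).pow 2)).congr_deriv (by simp)
      have hs := (hasDerivAt_iff_tendsto_slope_left_right.1 hd).1
      have hge : 0 ≤ (r * z0 ^ (r - 1)) * u z0 ^ 2 + z0 ^ r * (2 * u z0 * u' z0) := by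
        refine ge_of_tendsto hs ?_
        filter_upwards [Ioo_mem_nhdsLT hpos] with z hz
        have := hmax (show z ∈ Icc (0:ℝ) 1 from ⟨hz.1.le, hz.2.le.trans hz0.2⟩)
        simp only [mem_ofPred_eq] at this
        rw [slope_def_field]
        exact div_nonneg_of_nonpos (by linarith) (by linarith [hz.2])
      have e1 : z0 * ((r * z0 ^ (r - 1)) * u z0 ^ 2 + z0 ^ r * (2 * u z0 * u' z0))
          = z0 ^ r * (r * u z0 ^ 2 + 2 * u z0 * (G z0 - c * u z0)) := by
        rw [← hh]
        cases r with
        | zero => simp; ring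
        | succ r => simp only [Nat.add_sub_cancel, pow_succ]; ring
      have e2 : 0 ≤ z0 ^ r * (r * u z0 ^ 2 + 2 * u z0 * (G z0 - c * u z0)) := by
        rw [← e1]; exact mul_nonneg hz0.1 hge
      have e3 : 0 ≤ r * u z0 ^ 2 + 2 * u z0 * (G z0 - c * u z0) :=
        nonneg_of_mul_nonneg_right e2 (pow_pos hpos r)
      have e4 : u z0 ^ 2 ≤ 4 * G z0 ^ 2 := by
        nlinarith [sq_nonneg (u z0), sq_nonneg (u z0 - 2 * G z0)]
      nlinarith
  intro z hz
  have := hmax hz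
  simp only [mem_ofPred_eq] at this
  linarith [hG z0 hz0]

/-- Iterates of `√z d/dz` in smooth form. -/
noncomputable def EE : ℕ → (ℝ → ℝ → ℝ) → ℝ → ℝ → ℝ
  | 0 => fun y => y
  | 1 => fun y t z => √z * dz y t z
  | k + 2 => fun y => EE k (DelT 1 y)

theorem EE_cont (k : ℕ) {y : ℝ → ℝ → ℝ} (hy : Sm y) :
    Continuous (fun p : ℝ × ℝ => EE k y p.1 p.2) := by
  induction k using Nat.twoStepInduction generalizing y with
  | zero => exact hy.cont
  | one =>
    have := hy.dz.cont
    show Continuous (fun p : ℝ × ℝ => √p.2 * dz y p.1 p.2)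
    fun_prop
  | more k ih _ => exact ih (hy.DelT 1)

theorem EE_cont_z (k : ℕ) {y : ℝ → ℝ → ℝ} (hy : Sm y) (t : ℝ) : Continuous (EE k y t) :=
  (EE_cont k hy).comp (continuous_const.prodMk continuous_id)

theorem EE_deriv_t (k : ℕ) {y : ℝ → ℝ → ℝ} (hy : Sm y) (t z : ℝ) :
    HasDerivAt (fun t => EE k y t z) (EE k (dt y) t z) t := by
  induction k using Nat.twoStepInduction generalizing y with
  | zero => exact hy.hasDerivAt_t t z
  | one =>
    have := (hy.dz.hasDerivAt_t t z).const_mul (√z)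
    rw [hy.dt_dz] at this
    exact this
  | more k ih _ =>
    have := ih (hy.DelT 1)
    have e : dt (DelT 1 y) = DelT 1 (dt y) := dt_iter_DelT hy 1 1
    rw [e] at this
    exact this

theorem EE_deriv_z (k : ℕ) {y : ℝ → ℝ → ℝ} (hy : Sm y) (t : ℝ) {z : ℝ} (hz : 0 < z) :
    HasDerivAt (EE k y t) (EE (k + 1) y t z / √z) z := by
  have hs : 0 < √z := Real.sqrt_pos.2 hz
  induction k using Nat.twoStepInduction generalizing y with
  | zero =>
    have e : EE (0 + 1) y t z / √z = dz y t z := by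
      show √z * dz y t z / √z = _
      field_simp
    rw [e]
    exact hy.hasDerivAt_z t z
  | one =>
    have := (Real.hasDerivAt_sqrt hz.ne').mul (hy.dz.hasDerivAt_z t z)
    refine HasDerivAt.congr_deriv this ?_
    show _ = (z * dz (dz y) t z + 1 / 2 * dz y t z) / √z
    have e : z = √z * √z := (Real.mul_self_sqrt hz.le).symm
    nth_rewrite 5 [e]
    field_simp
    ring
  | more k ih _ => exact ih (hy.DelT 1)

theorem Ddot_iter_congr (k : ℕ) {f g : ℝ → ℝ} (h : ∀ z, 0 < z → f z = g z) :
    ∀ z, 0 < z → Ddot^[k] f z = Ddot^[k] g z := by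
  induction k generalizing f g with
  | zero => exact h
  | succ k ih =>
    intro z hz
    rw [Function.iterate_succ_apply, Function.iterate_succ_apply]
    refine ih (fun w hw => ?_) z hz
    unfold Ddot
    have : f =ᶠ[nhds w] g := by
      filter_upwards [lt_mem_nhds hw] with x hx using h x hx
    rw [this.deriv_eq]

theorem Ddot_iter (k : ℕ) {y : ℝ → ℝ → ℝ} (hy : Sm y) (t : ℝ) :
    ∀ z, 0 < z → Ddot^[k] (y t) z = EE k y t z := by
  induction k with
  | zero => intro z _; rfl
  | succ k ih =>
    intro z hz
    rw [Function.iterate_succ_apply']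
    unfold Ddot
    have : Ddot^[k] (y t) =ᶠ[nhds z] EE k y t := by
      filter_upwards [lt_mem_nhds hz] with x hx using ih x hx
    have e := this.deriv_eq
    unfold Ddot at e
    rw [e, (EE_deriv_z k hy t hz).deriv]
    have hs : 0 < √z := Real.sqrt_pos.2 hz
    field_simp

theorem ext0 {F : ℝ → ℝ} (hF : Continuous F) {X : ℝ} (h : ∀ z ∈ Ioc (0:ℝ) 1, F z ≤ X) :
    ∀ z ∈ Icc (0:ℝ) 1, F z ≤ X := by
  have : Icc (0:ℝ) 1 ⊆ {z | F z ≤ X} := by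
    rw [← closure_Ioc (zero_ne_one' ℝ)]
    exact closure_minimal h (isClosed_le hF continuous_const)
  exact this

theorem Ddot_le (k : ℕ) {y : ℝ → ℝ → ℝ} (hy : Sm y) (t : ℝ) {z : ℝ} (hz : 0 ≤ z) :
    |Ddot^[k] (y t) z| ≤ |EE k y t z| := by
  rcases hz.eq_or_lt with e | h
  · cases k with
    | zero => exact le_rfl
    | succ k =>
      rw [Function.iterate_succ_apply', ← e]
      simp [Ddot]
  · rw [Ddot_iter k hy t z h]

theorem supNT_nonneg (T : ℝ) (n : ℕ) (y : ℝ → ℝ → ℝ) : 0 ≤ supNT T n y :=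
  Real.iSup_nonneg fun _ => Real.iSup_nonneg fun _ => Real.iSup_nonneg fun _ => abs_nonneg _

theorem supNT_le {T : ℝ} {n : ℕ} {y : ℝ → ℝ → ℝ} (hy : Sm y) {B : ℝ} (hB : 0 ≤ B)
    (h : ∀ j k, j + k ≤ n → ∀ t ∈ Icc (0:ℝ) T, ∀ z ∈ Ioc (0:ℝ) 1, |EE k (dt^[j] y) t z| ≤ B) :
    supNT T n y ≤ B := by
  refine Real.iSup_le (fun p => ?_) hB
  refine Real.iSup_le (fun t => ?_) hB
  refine Real.iSup_le (fun z => ?_) hB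
  refine (Ddot_le _ (hy.dt_iter _) t.1 z.2.1).trans ?_
  exact ext0 (EE_cont_z _ (hy.dt_iter _) t.1).abs (h _ _ p.2 t.1 t.2) z.1 z.2

theorem le_supNT {T : ℝ} {n : ℕ} {y : ℝ → ℝ → ℝ} (hy : Sm y) {j k : ℕ} (hjk : j + k ≤ n) {t : ℝ}
    (ht : t ∈ Icc (0:ℝ) T) : ∀ z ∈ Icc (0:ℝ) 1, |EE k (dt^[j] y) t z| ≤ supNT T n y := by
  refine ext0 (EE_cont_z _ (hy.dt_iter _) t).abs fun z hz => ?_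
  rw [← Ddot_iter k (hy.dt_iter j) t z hz.1]
  have hfin : Finite {p : ℕ × ℕ // p.1 + p.2 ≤ n} := by
    apply Set.Finite.to_subtype
    refine ((Set.finite_Iic n).prod (Set.finite_Iic n)).subset ?_
    intro p hp
    have hp : p.1 + p.2 ≤ n := hp
    exact ⟨show p.1 ≤ n by omega, show p.2 ≤ n by omega⟩
  have h1 : supT T (fun t => Ddot^[k] (dt^[j] y t)) ≤ supNT T n y :=
    le_ciSup (f := fun p : {p : ℕ × ℕ // p.1 + p.2 ≤ n} =>
      supT T (fun t => Ddot^[p.1.2] (dt^[p.1.1] y t))) (Set.finite_range _).bddAbove ⟨(j, k), hjk⟩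
  refine le_trans ?_ h1
  obtain ⟨B, hB⟩ := (isCompact_Icc.prod isCompact_Icc).exists_bound_of_continuousOn
    (s := Icc (0:ℝ) T ×ˢ Icc (0:ℝ) 1) (EE_cont k (hy.dt_iter j)).continuousOn
  have hB' : ∀ (t : Icc (0:ℝ) T) (z : Icc (0:ℝ) 1), |Ddot^[k] (dt^[j] y t.1) z.1| ≤ B :=
    fun t z => (Ddot_le k (hy.dt_iter j) t.1 z.2.1).trans (hB (t.1, z.1) ⟨t.2, z.2⟩)
  have hne : Nonempty (Icc (0:ℝ) 1) := ⟨⟨0, by simp⟩⟩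
  have h2 := le_ciSup (f := fun z : Icc (0:ℝ) 1 => |Ddot^[k] (dt^[j] y t) z.1|)
    ⟨B, by rintro _ ⟨w, rfl⟩; exact hB' ⟨t, ht⟩ w⟩ ⟨z, hz.1.le, hz.2⟩
  refine h2.trans ?_
  exact le_ciSup (f := fun t : Icc (0:ℝ) T => ⨆ z : Icc (0:ℝ) 1, |Ddot^[k] (dt^[j] y t.1) z.1|)
    ⟨B, by rintro _ ⟨w, rfl⟩; exact ciSup_le (hB' w)⟩ ⟨t, ht⟩

theorem supNT_mono {T : ℝ} {m n : ℕ} (h : m ≤ n) {y : ℝ → ℝ → ℝ} (hy : Sm y) :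
    supNT T m y ≤ supNT T n y :=
  supNT_le hy (supNT_nonneg _ _ _) fun _ _ hjk _ ht z hz =>
    le_supNT hy (hjk.trans h) ht z ⟨hz.1.le, hz.2⟩

theorem EE_pieces (k : ℕ) : ∃ C > (0:ℝ), ∀ y : ℝ → ℝ → ℝ, Sm y → ∀ t X : ℝ,
    (∀ z ∈ Icc (0:ℝ) 1, EE k y t z ^ 2 ≤ X) → ∀ q r : ℕ, r ≤ q → 2 * q = k + r →
    ∀ z ∈ Icc (0:ℝ) 1, z ^ r * DD q 0 y t z ^ 2 ≤ C * X := by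
  induction k using Nat.twoStepInduction with
  | zero =>
    refine ⟨1, one_pos, fun y hy t X hX q r h1 h2 z hz => ?_⟩
    obtain rfl : q = 0 := by omega
    obtain rfl : r = 0 := by omega
    have := hX z hz
    simp only [EE] at this
    simpa [DD] using this
  | one =>
    refine ⟨1, one_pos, fun y hy t X hX q r h1 h2 z hz => ?_⟩
    obtain rfl : q = 1 := by omega
    obtain rfl : r = 1 := by omega
    have := hX z hz
    simp only [EE, mul_pow, Real.sq_sqrt hz.1] at this
    simpa [DD] using this
  | more k ih _ =>
    obtain ⟨C, hC, ih⟩ := ih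
    refine ⟨(2 + 2 * (1 / 2 + k) ^ 2) * (4 * C), by positivity, fun y hy t X hX q r h1 h2 => ?_⟩
    have hX0 : 0 ≤ X := (sq_nonneg _).trans (hX 0 (by simp))
    have ih' := ih _ (hy.DelT 1) t X hX
    have hlt : ∀ q r : ℕ, r ≤ q → 2 * q = k + r → ∀ z ∈ Icc (0:ℝ) 1,
        z ^ r * DD (q + 1) 0 y t z ^ 2 ≤ 4 * (C * X) := fun q r h1 h2 => by
      refine sup_hardy r (u' := DD (q + 2) 0 y t) (G := DD q 0 (DelT 1 y) t) (fun z => ?_)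
        (1 / 2 + q) _ ?_ ?_ (ih' q r h1 h2)
      · have := (hy.DD (q + 1) 0).hasDerivAt_z t z
        rwa [dz_DD] at this
      · have : (r : ℝ) ≤ q := by exact_mod_cast h1
        have : (0 : ℝ) ≤ q := Nat.cast_nonneg q
        linarith
      · intro z
        rw [DD_DelT hy]
    rcases Nat.lt_or_ge r q with h | h
    · obtain ⟨q, rfl⟩ : ∃ q', q = q' + 1 := ⟨q - 1, by omega⟩
      intro z hz
      refine (hlt q r (by omega) (by omega) z hz).trans ?_
      have : 0 ≤ C * X := by positivity
      nlinarith [mul_nonneg (sq_nonneg ((1:ℝ) / 2 + k)) this]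
    · obtain rfl : q = k + 2 := by omega
      obtain rfl : r = k + 2 := by omega
      intro z hz
      have e2 := ih' k k le_rfl (by omega) z hz
      have e3 := hlt k k le_rfl (by omega) z hz
      rw [DD_DelT hy] at e2
      have hz0 : 0 ≤ z ^ k := pow_nonneg hz.1 k
      have : z ^ (k + 2) * DD (k + 2) 0 y t z ^ 2 = z ^ k * (z * DD (k + 2) 0 y t z) ^ 2 := by ring
      rw [this]
      have key : (z * DD (k + 2) 0 y t z) ^ 2
          ≤ 2 * (z * DD (k + 2) 0 y t z + ((1:ℝ) / 2 + k) * DD (k + 1) 0 y t z) ^ 2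
            + 2 * ((1:ℝ) / 2 + k) ^ 2 * DD (k + 1) 0 y t z ^ 2 := by
        nlinarith [sq_nonneg (z * DD (k + 2) 0 y t z + 2 * ((1:ℝ) / 2 + k) * DD (k + 1) 0 y t z)]
      have k1 := mul_le_mul_of_nonneg_left key hz0
      have : 0 ≤ 2 * ((1:ℝ) / 2 + k) ^ 2 := by positivity
      have k2 := mul_le_mul_of_nonneg_left e3 this
      have k3 : 0 ≤ C * X := by positivity
      nlinarith

/-- The coefficient bounds. -/
theorem CB_of : ∃ K : ℕ → ℝ, Monotone K ∧ (∀ s, 1 ≤ K s) ∧ ∀ (T : ℝ) (b : ℝ → ℝ → ℝ) (β : ℕ → ℝ),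
    Sm b → (∀ s, supNT T s b ≤ β s) → ∀ t ∈ Icc (0:ℝ) T, CB (fun s => K s * β s ^ 2) b t := by
  choose C hC h using EE_pieces
  refine ⟨fun s => 1 + ∑ k ∈ Finset.range (s + 1), C k, ?_, ?_, ?_⟩
  · intro m n hmn
    have : ∑ k ∈ Finset.range (m + 1), C k ≤ ∑ k ∈ Finset.range (n + 1), C k :=
      Finset.sum_le_sum_of_subset_of_nonneg (Finset.range_mono (by omega))
        fun k _ _ => (hC k).le
    simpa using this
  · intro s
    have : 0 ≤ ∑ k ∈ Finset.range (s + 1), C k := Finset.sum_nonneg fun k _ => (hC k).le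
    simpa using this
  · intro T b β hb hβ t ht p r i s hrp he z hz
    have h1 : ∀ z ∈ Icc (0:ℝ) 1, EE (2 * p - r) (dt^[i] b) t z ^ 2 ≤ β s ^ 2 := by
      intro z hz
      have := (le_supNT hb (n := s) (j := i) (k := 2 * p - r) (by omega) ht z hz).trans (hβ s)
      rw [← sq_abs]
      exact pow_le_pow_left₀ (abs_nonneg _) this 2
    refine (h (2 * p - r) _ (hb.dt_iter i) t _ h1 p r hrp (by omega) z hz).trans ?_
    refine mul_le_mul_of_nonneg_right ?_ (sq_nonneg _)
    have := Finset.single_le_sum (f := C) (fun k _ => (hC k).le)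
      (Finset.mem_range.2 (show 2 * p - r < s + 1 by omega))
    linarith

/-- Landau's inequality. -/
theorem landau {f f' f'' : ℝ → ℝ} {l A D : ℝ} (h1 : ∀ x ∈ Icc 0 l, HasDerivAt f (f' x) x)
    (h2 : ∀ x ∈ Icc 0 l, HasDerivAt f' (f'' x) x) (hA : ∀ x ∈ Icc 0 l, |f x| ≤ A)
    (hD : ∀ x ∈ Icc 0 l, |f'' x| ≤ D) {s : ℝ} (hs : 0 < s) (hs1 : s ≤ 1) (hl : 0 < l) :
    |f' 0| ≤ 2 / l * ((s ^ 2)⁻¹ * A) + l * (s ^ 2 * D) := by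
  have hs2 : s ^ 2 ≤ 1 := by nlinarith
  have hd : 0 < l * s ^ 2 := by positivity
  have hdl : l * s ^ 2 ≤ l := mul_le_of_le_one_right hl.le hs2
  have hsub : Icc 0 (l * s ^ 2) ⊆ Icc 0 l := Icc_subset_Icc le_rfl hdl
  obtain ⟨x, hx, hxe⟩ := exists_hasDerivAt_eq_slope f f' hd
    (fun x hx => (h1 x (hsub hx)).continuousAt.continuousWithinAt)
    (fun x hx => h1 x (hsub (Ioo_subset_Icc_self hx)))
  obtain ⟨w, hw, hwe⟩ := exists_hasDerivAt_eq_slope f' f'' hx.1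
    (fun w hw => (h2 w (hsub ⟨hw.1, hw.2.trans hx.2.le⟩)).continuousAt.continuousWithinAt)
    (fun w hw => h2 w (hsub ⟨hw.1.le, hw.2.le.trans hx.2.le⟩))
  have hw' := hD w (hsub ⟨hw.1.le, hw.2.le.trans hx.2.le⟩)
  have a1 := hA 0 ⟨le_rfl, hl.le⟩
  have a2 := hA _ (hsub ⟨hd.le, le_rfl⟩)
  have hx0 : 0 < x := hx.1
  have e1 : f' 0 = f' x - f'' w * x := by
    rw [hwe, sub_zero, div_mul_cancel₀ _ hx0.ne']; ring
  have b1 : |f' x| ≤ 2 * A / (l * s ^ 2) := by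
    rw [hxe, sub_zero, abs_div, abs_of_pos hd]
    gcongr
    have := abs_sub (f (l * s ^ 2)) (f 0)
    linarith
  have b2 : |f'' w * x| ≤ D * (l * s ^ 2) := by
    rw [abs_mul, abs_of_pos hx0]
    exact mul_le_mul hw' hx.2.le hx0.le ((abs_nonneg _).trans hw')
  have b3 : |f' 0| ≤ |f' x| + |f'' w * x| := by rw [e1]; exact abs_sub _ _
  have e2 : 2 * A / (l * s ^ 2) = 2 / l * ((s ^ 2)⁻¹ * A) := by field_simp
  rw [e2] at b1
  linarith

theorem landau_t {T : ℝ} (hT : 0 < T) {n k j : ℕ} (h : j + 1 + k = n + 1) {y : ℝ → ℝ → ℝ} (hy : Sm y) {t : ℝ}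
    (ht : t ∈ Icc (0:ℝ) T) {z : ℝ} (hz : z ∈ Icc (0:ℝ) 1) {s : ℝ} (hs : 0 < s) (hs1 : s ≤ 1) :
    |EE k (dt^[j + 1] y) t z| ≤ 2 / (T / 2) * ((s ^ 2)⁻¹ * supNT T n y)
      + T / 2 * (s ^ 2 * supNT T (n + 2) y) := by
  have hd : ∀ i x, HasDerivAt (fun t => EE k (dt^[i] y) t z) (EE k (dt^[i + 1] y) x z) x := by
    intro i x
    rw [Function.iterate_succ_apply']
    exact EE_deriv_t k (hy.dt_iter i) x z
  rcases le_total t (T / 2) with h2 | h2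
  · have := landau (f := fun x => EE k (dt^[j] y) (t + x) z)
      (f' := fun x => EE k (dt^[j + 1] y) (t + x) z) (f'' := fun x => EE k (dt^[j + 2] y) (t + x) z)
      (l := T / 2) (A := supNT T n y) (D := supNT T (n + 2) y)
      (fun x _ => (hd j (t + x)).comp_const_add t x) (fun x _ => (hd (j + 1) (t + x)).comp_const_add t x)
      (fun x hx => le_supNT hy (by omega) ⟨by linarith [hx.1, ht.1], by linarith [hx.2]⟩ z hz)
      (fun x hx => le_supNT hy (by omega) ⟨by linarith [hx.1, ht.1], by linarith [hx.2]⟩ z hz)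
      hs hs1 (by positivity)
    simpa using this
  · have := landau (f := fun x => EE k (dt^[j] y) (t - x) z)
      (f' := fun x => -EE k (dt^[j + 1] y) (t - x) z) (f'' := fun x => EE k (dt^[j + 2] y) (t - x) z)
      (l := T / 2) (A := supNT T n y) (D := supNT T (n + 2) y)
      (fun x _ => (hd j (t - x)).comp_const_sub t x)
      (fun x _ => (((hd (j + 1) (t - x)).comp_const_sub t x).neg).congr_deriv (neg_neg _))
      (fun x hx => le_supNT hy (by omega) ⟨by linarith [hx.2, ht.1], by linarith [hx.1, ht.2]⟩ z hz)
      (fun x hx => le_supNT hy (by omega) ⟨by linarith [hx.2, ht.1], by linarith [hx.1, ht.2]⟩ z hz)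
      hs hs1 (by positivity)
    simpa using this

theorem landau_z {T : ℝ} {n : ℕ} {y : ℝ → ℝ → ℝ} (hy : Sm y) {t : ℝ}
    (ht : t ∈ Icc (0:ℝ) T) {z : ℝ} (hz : z ∈ Ioc (0:ℝ) 1) {s : ℝ} (hs : 0 < s) (hs1 : s ≤ 1) :
    |EE (n + 1) y t z| ≤ 2 * ((s ^ 2)⁻¹ * supNT T n y) + s ^ 2 * supNT T (n + 2) y := by
  have hd : ∀ i x, 0 < x → HasDerivAt (fun x => EE i y t (x ^ 2)) (2 * EE (i + 1) y t (x ^ 2)) x := by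
    intro i x hx
    have h1 := EE_deriv_z i hy t (z := x ^ 2) (by positivity)
    have h2 := hasDerivAt_pow 2 x
    refine (HasDerivAt.comp (h₂ := EE i y t) (h := fun x : ℝ => x ^ 2) x h1 h2).congr_deriv ?_
    rw [Real.sqrt_sq hx.le]
    simp
    field_simp
  have hx0 : 0 < √z := Real.sqrt_pos.2 hz.1
  have hx1 : √z ≤ 1 := Real.sqrt_le_one.2 hz.2
  have hxz : √z ^ 2 = z := Real.sq_sqrt hz.1.le
  have b0 : ∀ x ∈ Icc (0:ℝ) 1, |EE n y t (x ^ 2)| ≤ supNT T n y := fun x hx =>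
    le_supNT hy (j := 0) (k := n) (by omega) ht _ ⟨by positivity, pow_le_one₀ hx.1 hx.2⟩
  have b2 : ∀ x ∈ Icc (0:ℝ) 1, |4 * EE (n + 2) y t (x ^ 2)| ≤ 4 * supNT T (n + 2) y := fun x hx => by
    rw [abs_mul, abs_of_pos (by norm_num : (0:ℝ) < 4)]
    exact mul_le_mul_of_nonneg_left (le_supNT hy (j := 0) (k := n + 2) (by omega) ht _
      ⟨by positivity, pow_le_one₀ hx.1 hx.2⟩) (by norm_num)
  rcases le_total (√z) (1 / 2) with h2 | h2
  · have := landau (f := fun x => EE n y t ((√z + x) ^ 2))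
      (f' := fun x => 2 * EE (n + 1) y t ((√z + x) ^ 2)) (f'' := fun x => 4 * EE (n + 2) y t ((√z + x) ^ 2))
      (l := 1 / 2) (A := supNT T n y) (D := 4 * supNT T (n + 2) y)
      (fun x hx => (hd n (√z + x) (by linarith [hx.1])).comp_const_add (√z) x)
      (fun x hx => (((hd (n + 1) (√z + x) (by linarith [hx.1])).comp_const_add (√z) x).const_mul 2).congr_deriv
        (by ring))
      (fun x hx => b0 _ ⟨by linarith [hx.1], by linarith [hx.2]⟩)
      (fun x hx => b2 _ ⟨by linarith [hx.1], by linarith [hx.2]⟩)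
      hs hs1 (by norm_num)
    simp only [add_zero, hxz, abs_mul, abs_two] at this
    linarith
  · rcases eq_or_lt_of_le h2 with h3 | h3
    · have := landau (f := fun x => EE n y t ((√z + x) ^ 2))
        (f' := fun x => 2 * EE (n + 1) y t ((√z + x) ^ 2)) (f'' := fun x => 4 * EE (n + 2) y t ((√z + x) ^ 2))
        (l := 1 / 2) (A := supNT T n y) (D := 4 * supNT T (n + 2) y)
        (fun x hx => (hd n (√z + x) (by linarith [hx.1])).comp_const_add (√z) x)
        (fun x hx => (((hd (n + 1) (√z + x) (by linarith [hx.1])).comp_const_add (√z) x).const_mul 2).congr_deriv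
          (by ring))
        (fun x hx => b0 _ ⟨by linarith [hx.1], by linarith [hx.2]⟩)
        (fun x hx => b2 _ ⟨by linarith [hx.1], by linarith [hx.2]⟩)
        hs hs1 (by norm_num)
      simp only [add_zero, hxz, abs_mul, abs_two] at this
      linarith
    · have := landau (f := fun x => EE n y t ((√z - x) ^ 2))
        (f' := fun x => -(2 * EE (n + 1) y t ((√z - x) ^ 2)))
        (f'' := fun x => 4 * EE (n + 2) y t ((√z - x) ^ 2))
        (l := 1 / 2) (A := supNT T n y) (D := 4 * supNT T (n + 2) y)
        (fun x hx => (hd n (√z - x) (by linarith [hx.2])).comp_const_sub (√z) x)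
        (fun x hx => ((((hd (n + 1) (√z - x) (by linarith [hx.2])).comp_const_sub
          (√z) x).const_mul 2).neg).congr_deriv (by ring))
        (fun x hx => b0 _ ⟨by linarith [hx.2], by linarith [hx.1]⟩)
        (fun x hx => b2 _ ⟨by linarith [hx.2], by linarith [hx.1]⟩)
        hs hs1 (by norm_num)
      simp only [sub_zero, hxz, abs_neg, abs_mul, abs_two] at this
      linarith

theorem supNT_interp {T : ℝ} (hT : 0 < T) (n : ℕ) {y : ℝ → ℝ → ℝ} (hy : Sm y)
    {s : ℝ} (hs : 0 < s) (hs1 : s ≤ 1) :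
    supNT T (n + 1) y ≤ (2 + 4 / T + T) * (s ^ 2 * supNT T (n + 2) y + (s ^ 2)⁻¹ * supNT T n y) := by
  have n0 := supNT_nonneg T n y
  have n2 := supNT_nonneg T (n + 2) y
  have hs2 : 0 < s ^ 2 := by positivity
  have k0 : 0 ≤ (s ^ 2)⁻¹ * supNT T n y := by positivity
  have k2 : 0 ≤ s ^ 2 * supNT T (n + 2) y := by positivity
  have hT4 : 0 < 4 / T := by positivity
  refine supNT_le hy (by positivity) fun j k hjk t ht z hz => ?_
  rcases Nat.lt_or_ge (j + k) (n + 1) with h | h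
  · refine (le_supNT hy (show j + k ≤ n by omega) ht z ⟨hz.1.le, hz.2⟩).trans ?_
    have e : 1 ≤ (s ^ 2)⁻¹ := (one_le_inv₀ hs2).2 (by nlinarith)
    have a := le_mul_of_one_le_left n0 e
    have p1 : 0 ≤ (1 + 4 / T + T) * (s ^ 2 * supNT T (n + 2) y + (s ^ 2)⁻¹ * supNT T n y) := by
      positivity
    linarith
  · cases j with
    | zero =>
      obtain rfl : k = n + 1 := by omega
      have := landau_z hy ht hz hs hs1 (n := n)
      have p1 : 0 ≤ (4 / T + T) * (s ^ 2 * supNT T (n + 2) y + (s ^ 2)⁻¹ * supNT T n y) := by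
        positivity
      simp only [Function.iterate_zero, id_eq]
      linarith
    | succ j =>
      have := landau_t hT (show j + 1 + k = n + 1 by omega) hy ht ⟨hz.1.le, hz.2⟩ hs hs1
      have e : 2 / (T / 2) = 4 / T := by field_simp; norm_num
      rw [e] at this
      have p1 : 0 ≤ (2 + T) * ((s ^ 2)⁻¹ * supNT T n y) := by positivity
      have p2 : 0 ≤ (2 + 4 / T + T / 2) * (s ^ 2 * supNT T (n + 2) y) := by positivity
      linarith

/-- The size of the coefficients. -/
noncomputable def bet (T : ℝ) (b₂ b₁ b₀ : ℝ → ℝ → ℝ) (s : ℕ) : ℝ :=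
  1 + (supNT T s b₂ + supNT T s b₁ + supNT T s b₀)

theorem bet_mono {T : ℝ} {b₂ b₁ b₀ : ℝ → ℝ → ℝ} (h2 : Sm b₂) (h1 : Sm b₁) (h0 : Sm b₀) :
    Monotone (bet T b₂ b₁ b₀) := fun m n h => by
  have a2 := supNT_mono (T := T) h h2
  have a1 := supNT_mono (T := T) h h1
  have a0 := supNT_mono (T := T) h h0
  unfold bet
  linarith

theorem one_le_bet (T : ℝ) (b₂ b₁ b₀ : ℝ → ℝ → ℝ) (s : ℕ) : 1 ≤ bet T b₂ b₁ b₀ s := by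
  have a2 := supNT_nonneg T s b₂
  have a1 := supNT_nonneg T s b₁
  have a0 := supNT_nonneg T s b₀
  unfold bet
  linarith

theorem logconvB {T : ℝ} (hT : 0 < T) {b₂ b₁ b₀ : ℝ → ℝ → ℝ} (h2 : Sm b₂) (h1 : Sm b₁) (h0 : Sm b₀)
    (n : ℕ) : bet T b₂ b₁ b₀ (n + 1) ^ 2
      ≤ 4 * (2 + 4 / T + T) ^ 2 * (bet T b₂ b₁ b₀ n * bet T b₂ b₁ b₀ (n + 2)) := by
  have hT4 : 0 < 4 / T := by positivity
  refine opt (by positivity) (one_le_bet _ _ _ _ _) (bet_mono h2 h1 h0 (by omega))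
    (zero_le_one.trans (one_le_bet _ _ _ _ _)) fun s hs hs1 => ?_
  have i2 := supNT_interp hT n h2 hs hs1
  have i1 := supNT_interp hT n h1 hs hs1
  have i0 := supNT_interp hT n h0 hs hs1
  have hs2 : 0 < s ^ 2 := by positivity
  have e : 1 ≤ (s ^ 2)⁻¹ := (one_le_inv₀ hs2).2 (by nlinarith)
  have p : 1 ≤ (2 + 4 / T + T) * (s ^ 2 + (s ^ 2)⁻¹) := by
    have : 1 ≤ 2 + 4 / T + T := by linarith
    nlinarith
  unfold bet
  linarith

open MeasureTheory Real Set

/-! ### Products of log-convex sequences and the final induction -/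

theorem seqQ (K : ℕ → ℝ) (hK : ∀ j, 0 < K j) (i : ℕ) : ∀ (l : ℕ) (X : ℝ), 0 < X → ∃ Y > (0:ℝ),
    ∀ a c : ℕ → ℝ, (∀ j, 0 < a j) → (∀ j, 0 < c j) →
    (∀ j, a (j + 1) ^ 2 ≤ K j * (a j * a (j + 2))) →
    (∀ j, c (j + 1) ^ 2 ≤ K j * (c j * c (j + 2))) →
    a (i + 1) * c l ≤ X * (a i * c (l + 1)) → a (i + 1) * c l ≤ Y * (a 0 * c (l + (i + 1))) := by
  induction i with
  | zero => intro l X hX; exact ⟨X, hX, fun a c _ _ _ _ h => h⟩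
  | succ i ih =>
    intro l X hX
    obtain ⟨Y, hY, h⟩ := ih (l + 1) (K i * K l * X)
      (mul_pos (mul_pos (hK i) (hK l)) hX)
    refine ⟨X * Y, by positivity, fun a c ha hc hKa hKc hh => ?_⟩
    have e := h a c ha hc hKa hKc ?_
    · refine hh.trans ?_
      have : l + 1 + (i + 1) = l + (i + 1 + 1) := by omega
      rw [this] at e
      rw [mul_assoc]
      exact mul_le_mul_of_nonneg_left e hX.le
    · have p : 0 < a (i + 1) * c (l + 1) := mul_pos (ha _) (hc _)
      have h1 := hKa i
      have h2 := hKc l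
      have h3 : a (i + 1) ^ 2 * c (l + 1) ^ 2
          ≤ (K i * (a i * a (i + 2))) * (K l * (c l * c (l + 2))) :=
        mul_le_mul h1 h2 (sq_nonneg _) ((sq_nonneg _).trans h1)
      have q : 0 ≤ K i * K l * (a i * c (l + 2)) :=
        (mul_pos (mul_pos (hK i) (hK l)) (mul_pos (ha _) (hc _))).le
      have h4 := mul_le_mul_of_nonneg_left hh q
      refine le_of_mul_le_mul_right ?_ p
      calc a (i + 1) * c (l + 1) * (a (i + 1) * c (l + 1)) = a (i + 1) ^ 2 * c (l + 1) ^ 2 := by ring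
        _ ≤ _ := h3
        _ = K i * K l * (a i * c (l + 2)) * (a (i + 1 + 1) * c l) := by ring
        _ ≤ _ := h4
        _ = _ := by ring

theorem seq_prod (K : ℕ → ℝ) (hK : ∀ j, 0 < K j) (i l : ℕ) : ∃ Y > (0:ℝ),
    ∀ a c : ℕ → ℝ, (∀ j, 0 < a j) → (∀ j, 0 < c j) →
    (∀ j, a (j + 1) ^ 2 ≤ K j * (a j * a (j + 2))) →
    (∀ j, c (j + 1) ^ 2 ≤ K j * (c j * c (j + 2))) →
    a i * c l ≤ Y * (a 0 * c (i + l) + c 0 * a (i + l)) := by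
  cases i with
  | zero =>
    refine ⟨1, one_pos, fun a c ha hc _ _ => ?_⟩
    have := mul_pos (hc 0) (ha l)
    simp only [zero_add]
    linarith
  | succ i =>
    cases l with
    | zero =>
      refine ⟨1, one_pos, fun a c ha hc _ _ => ?_⟩
      have := mul_pos (ha 0) (hc (i + 1))
      simp only [add_zero]
      linarith
    | succ l =>
      obtain ⟨Y1, hY1, h1⟩ := seqQ K hK i (l + 1) 1 one_pos
      obtain ⟨Y2, hY2, h2⟩ := seqQ K hK l (i + 1) (K l * K i) (mul_pos (hK l) (hK i))
      refine ⟨Y1 + Y2, by positivity, fun a c ha hc hKa hKc => ?_⟩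
      have p1 := mul_pos (ha 0) (hc (i + 1 + (l + 1)))
      have p2 := mul_pos (hc 0) (ha (i + 1 + (l + 1)))
      rcases le_total (a (i + 1) * c (l + 1)) (a i * c (l + 2)) with h | h
      · have := h1 a c ha hc hKa hKc (by rw [one_mul]; exact h)
        rw [show l + 1 + (i + 1) = i + 1 + (l + 1) by omega] at this
        nlinarith
      · have := h2 c a hc ha hKc hKa ?_
        · nlinarith
        · have p : 0 < a (i + 1) * c (l + 1) := mul_pos (ha _) (hc _)
          have k1 := hKa i
          have k2 := hKc l
          have h3 : a (i + 1) ^ 2 * c (l + 1) ^ 2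
              ≤ (K i * (a i * a (i + 2))) * (K l * (c l * c (l + 2))) :=
            mul_le_mul k1 k2 (sq_nonneg _) ((sq_nonneg _).trans k1)
          have q : 0 ≤ K i * K l * (a (i + 2) * c l) :=
            (mul_pos (mul_pos (hK i) (hK l)) (mul_pos (ha _) (hc _))).le
          have h4 := mul_le_mul_of_nonneg_left h q
          refine le_of_mul_le_mul_right ?_ p
          calc c (l + 1) * a (i + 1) * (a (i + 1) * c (l + 1))
              = a (i + 1) ^ 2 * c (l + 1) ^ 2 := by ring
            _ ≤ _ := h3
            _ = K i * K l * (a (i + 2) * c l) * (a i * c (l + 2)) := by ring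
            _ ≤ _ := h4
            _ = _ := by ring

/-- The data of the problem. -/
structure Dat (N T M : ℝ) (b₂ b₁ b₀ g h : ℝ → ℝ → ℝ) : Prop where
  sol : Sol N T b₂ b₁ b₀ g h
  gM : ∫ t in (0:ℝ)..T, SS N 1 g t ≤ M ^ 2
  bM : bet T b₂ b₁ b₀ 6 ≤ 1 + M

theorem products {N T M : ℝ} (hN : 4 ≤ N) (hT : 0 < T) (hM : 0 < M) (i l : ℕ) :
    ∃ Y > (0:ℝ), ∀ b₂ b₁ b₀ g h : ℝ → ℝ → ℝ, Dat N T M b₂ b₁ b₀ g h →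
    bet T b₂ b₁ b₀ (i + 1) ^ 2 * (1 + ∫ t in (0:ℝ)..T, SS N (l + 1) g t)
      ≤ Y * ((1 + ∫ t in (0:ℝ)..T, SS N (i + l + 1) g t) + bet T b₂ b₁ b₀ (i + l + 5) ^ 2)
    ∧ bet T b₂ b₁ b₀ (i + 1) ^ 2 * bet T b₂ b₁ b₀ (l + 5) ^ 2
      ≤ Y * bet T b₂ b₁ b₀ (i + l + 5) ^ 2 := by
  choose KG hKG hG using logconvG hN
  set R := 4 * (2 + 4 / T + T) ^ 2 with hR
  have hR0 : 0 < R := by positivity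
  set K : ℕ → ℝ := fun j => R ^ 2 + KG (j + 1) with hKdef
  have hK : ∀ j, 0 < K j := fun j => add_pos (by positivity) (hKG _)
  obtain ⟨Y1, hY1, h1⟩ := seq_prod K hK i l
  obtain ⟨Y2, hY2, h2⟩ := seq_prod K hK i (l + 4)
  refine ⟨Y1 * ((1 + M) ^ 2 + (1 + M ^ 2)) + 2 * Y2 * (1 + M) ^ 2, by positivity, ?_⟩
  intro b₂ b₁ b₀ g h hd
  have hs := hd.sol
  have hbp : ∀ j, 0 < bet T b₂ b₁ b₀ j := fun j => zero_lt_one.trans_le (one_le_bet _ _ _ _ _)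
  have hbm := bet_mono (T := T) hs.hb2 hs.hb1 hs.hb0
  have ha : ∀ j, 0 < bet T b₂ b₁ b₀ (j + 1) ^ 2 := fun j => pow_pos (hbp _) 2
  have hc : ∀ j, 0 < 1 + ∫ t in (0:ℝ)..T, SS N (j + 1) g t := fun j => by
    have := SS_int_nonneg' N (j + 1) g hT.le
    linarith
  have hKa : ∀ j, (bet T b₂ b₁ b₀ (j + 1 + 1) ^ 2) ^ 2
      ≤ K j * (bet T b₂ b₁ b₀ (j + 1) ^ 2 * bet T b₂ b₁ b₀ (j + 2 + 1) ^ 2) := fun j => by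
    have := logconvB hT hs.hb2 hs.hb1 hs.hb0 (j + 1)
    have h4 : bet T b₂ b₁ b₀ (j + 1 + 1) ^ 2
        ≤ R * (bet T b₂ b₁ b₀ (j + 1) * bet T b₂ b₁ b₀ (j + 2 + 1)) := this
    have h3 := pow_le_pow_left₀ (sq_nonneg _) h4 2
    have h5 : (R * (bet T b₂ b₁ b₀ (j + 1) * bet T b₂ b₁ b₀ (j + 2 + 1))) ^ 2
        = R ^ 2 * (bet T b₂ b₁ b₀ (j + 1) ^ 2 * bet T b₂ b₁ b₀ (j + 2 + 1) ^ 2) := by ring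
    refine (h3.trans h5.le).trans ?_
    exact mul_le_mul_of_nonneg_right (le_add_of_nonneg_right (hKG _).le)
      (mul_pos (ha j) (ha (j + 2))).le
  have hKc : ∀ j, (1 + ∫ t in (0:ℝ)..T, SS N (j + 1 + 1) g t) ^ 2
      ≤ K j * ((1 + ∫ t in (0:ℝ)..T, SS N (j + 1) g t)
        * (1 + ∫ t in (0:ℝ)..T, SS N (j + 2 + 1) g t)) := fun j => by
    have := hG (j + 1) T g hT.le hs.hg hs.g0
    refine this.trans ?_
    exact mul_le_mul_of_nonneg_right (le_add_of_nonneg_left (by positivity))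
      (mul_pos (hc j) (hc (j + 2))).le
  have b1 : bet T b₂ b₁ b₀ (0 + 1) ^ 2 ≤ (1 + M) ^ 2 :=
    pow_le_pow_left₀ (hbp _).le ((hbm (by omega)).trans hd.bM) 2
  have c1 : 1 + ∫ t in (0:ℝ)..T, SS N (0 + 1) g t ≤ 1 + M ^ 2 := by
    have := hd.gM
    simpa using this
  have r1 := h1 (fun j => bet T b₂ b₁ b₀ (j + 1) ^ 2) (fun j => 1 + ∫ t in (0:ℝ)..T, SS N (j + 1) g t)
    ha hc hKa hKc
  have r2 := h2 (fun j => bet T b₂ b₁ b₀ (j + 1) ^ 2) (fun j => bet T b₂ b₁ b₀ (j + 1) ^ 2)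
    ha ha hKa hKa
  have hm : bet T b₂ b₁ b₀ (i + l + 1) ^ 2 ≤ bet T b₂ b₁ b₀ (i + l + 5) ^ 2 :=
    pow_le_pow_left₀ (hbp _).le (hbm (by omega)) 2
  rw [show i + (l + 4) + 1 = i + l + 5 by omega] at r2
  have pB := ha (i + l + 4)
  have pB' := ha (i + l)
  have pC := hc (i + l)
  rw [show i + l + 4 + 1 = i + l + 5 by omega] at pB
  generalize bet T b₂ b₁ b₀ (i + l + 5) ^ 2 = B at *
  generalize bet T b₂ b₁ b₀ (i + l + 1) ^ 2 = B' at *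
  generalize (1 + ∫ t in (0:ℝ)..T, SS N (i + l + 1) g t) = G at *
  constructor
  · refine r1.trans ?_
    have k1 := mul_le_mul_of_nonneg_right b1 pC.le
    have k2 : (1 + ∫ t in (0:ℝ)..T, SS N (0 + 1) g t) * B' ≤ (1 + M ^ 2) * B :=
      mul_le_mul c1 hm pB'.le (by positivity)
    have k3 : 0 ≤ (1 + M) ^ 2 * B + (1 + M ^ 2) * G := by positivity
    have k4 := mul_le_mul_of_nonneg_left (add_le_add k1 k2) hY1.le
    have k5 := mul_nonneg hY1.le k3
    have k6 : 0 ≤ 2 * Y2 * (1 + M) ^ 2 * (G + B) := by positivity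
    linarith
  · refine r2.trans ?_
    have k1 := mul_le_mul_of_nonneg_right b1 pB.le
    have k4 := mul_le_mul_of_nonneg_left k1 hY2.le
    have k6 : 0 ≤ Y1 * ((1 + M) ^ 2 + (1 + M ^ 2)) * B := by positivity
    linarith

theorem main_ind {N T M : ℝ} (hN : 4 ≤ N) (hT : 0 < T) (hM : 0 < M) (m : ℕ) :
    ∃ C > (0:ℝ), ∀ b₂ b₁ b₀ g h : ℝ → ℝ → ℝ, Dat N T M b₂ b₁ b₀ g h →
    ∫ t in (0:ℝ)..T, SS N (m + 2) h t
      ≤ C * ((1 + ∫ t in (0:ℝ)..T, SS N (m + 1) g t) + bet T b₂ b₁ b₀ (m + 5) ^ 2) := by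
  induction m using Nat.strong_induction_on with
  | _ m ih =>
  obtain ⟨K, hKm, hK1, hK⟩ := CB_of
  obtain ⟨C0, hC0, h0⟩ := recur hN hT (K 1 * (1 + M) ^ 2) m
  have hterm : ∀ s, ∃ C > (0:ℝ), s ∈ Finset.Icc 2 (m + 1) →
      ∀ b₂ b₁ b₀ g h : ℝ → ℝ → ℝ, Dat N T M b₂ b₁ b₀ g h →
      (K s * bet T b₂ b₁ b₀ s ^ 2) * ∫ t in (0:ℝ)..T, SS N (m + 3 - s) h t
      ≤ C * ((1 + ∫ t in (0:ℝ)..T, SS N (m + 1) g t) + bet T b₂ b₁ b₀ (m + 5) ^ 2) := by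
    intro s
    by_cases hs : s ∈ Finset.Icc 2 (m + 1)
    · have hs' := Finset.mem_Icc.1 hs
      obtain ⟨i, rfl⟩ : ∃ i, s = i + 1 := ⟨s - 1, by omega⟩
      obtain ⟨l, hl⟩ : ∃ l, m = i + l := ⟨m - i, by omega⟩
      subst hl
      obtain ⟨C, hC, hc⟩ := ih l (by omega)
      obtain ⟨Y, hY, hy⟩ := products hN hT hM i l
      have hKp : 0 < K (i + 1) := zero_lt_one.trans_le (hK1 _)
      refine ⟨K (i + 1) * (C * (2 * Y)), by positivity, fun _ b₂ b₁ b₀ g h hd => ?_⟩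
      rw [show i + l + 3 - (i + 1) = l + 2 by omega]
      have e1 := hc b₂ b₁ b₀ g h hd
      obtain ⟨e2, e3⟩ := hy b₂ b₁ b₀ g h hd
      have hG := SS_int_nonneg' N (i + l + 1) g hT.le
      have q : 0 ≤ K (i + 1) * bet T b₂ b₁ b₀ (i + 1) ^ 2 := by positivity
      refine (mul_le_mul_of_nonneg_left e1 q).trans ?_
      have hq : 0 ≤ K (i + 1) * C := by positivity
      have e4 := mul_le_mul_of_nonneg_left (add_le_add e2 e3) hq
      have e5 : 0 ≤ K (i + 1) * C * Y * (1 + ∫ t in (0:ℝ)..T, SS N (i + l + 1) g t) := by positivity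
      linarith
    · exact ⟨1, one_pos, fun h => absurd h hs⟩
  choose C hC hc using hterm
  refine ⟨C0 * (1 + ∑ s ∈ Finset.Icc 2 (m + 1), C s), mul_pos hC0
    (add_pos_of_pos_of_nonneg one_pos (Finset.sum_nonneg fun s _ => (hC s).le)), ?_⟩
  intro b₂ b₁ b₀ g h hd
  have hs := hd.sol
  have hbp : ∀ j, 0 < bet T b₂ b₁ b₀ j := fun j => zero_lt_one.trans_le (one_le_bet _ _ _ _ _)
  have hbm := bet_mono (T := T) hs.hb2 hs.hb1 hs.hb0
  have l2 : ∀ s, supNT T s b₂ ≤ bet T b₂ b₁ b₀ s := fun s => by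
    have := supNT_nonneg T s b₁
    have := supNT_nonneg T s b₀
    unfold bet; linarith
  have l1 : ∀ s, supNT T s b₁ ≤ bet T b₂ b₁ b₀ s := fun s => by
    have := supNT_nonneg T s b₂
    have := supNT_nonneg T s b₀
    unfold bet; linarith
  have l0 : ∀ s, supNT T s b₀ ≤ bet T b₂ b₁ b₀ s := fun s => by
    have := supNT_nonneg T s b₁
    have := supNT_nonneg T s b₂
    unfold bet; linarith
  have r := h0 b₂ b₁ b₀ g h hs (fun s => K s * bet T b₂ b₁ b₀ s ^ 2)
    (fun s s' hss => mul_le_mul (hKm hss) (pow_le_pow_left₀ (hbp _).le (hbm hss) 2) (sq_nonneg _)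
      (zero_le_one.trans (hK1 _)))
    (one_le_mul_of_one_le_of_one_le (hK1 _) (one_le_pow₀ (one_le_bet _ _ _ _ _)))
    (mul_le_mul_of_nonneg_left (pow_le_pow_left₀ (hbp _).le ((hbm (by omega)).trans hd.bM) 2)
      (zero_le_one.trans (hK1 _)))
    (fun t ht => ⟨hK T b₂ _ hs.hb2 l2 t ht, hK T b₁ _ hs.hb1 l1 t ht, hK T b₀ _ hs.hb0 l0 t ht⟩)
  refine r.trans ?_
  rw [mul_assoc]
  refine mul_le_mul_of_nonneg_left ?_ hC0.le
  rw [add_mul, one_mul, Finset.sum_mul]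
  refine add_le_add ?_ (Finset.sum_le_sum fun s hs => hc s hs b₂ b₁ b₀ g h hd)
  nlinarith [sq_nonneg (bet T b₂ b₁ b₀ (m + 5))]

theorem stmt15 (N : ℝ) (hN : 4 ≤ N) (T : ℝ) (hT : 0 < T) (n : ℕ) (M : ℝ) (hM : 0 < M) :
    ∃ C > (0:ℝ), ∀ b₂ b₁ b₀ g h : ℝ → ℝ → ℝ, ∀ τ₂ : ℝ,
      ContDiff ℝ (⊤ : ℕ∞) (fun p : ℝ × ℝ => b₂ p.1 p.2) →
      ContDiff ℝ (⊤ : ℕ∞) (fun p : ℝ × ℝ => b₁ p.1 p.2) →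
      ContDiff ℝ (⊤ : ℕ∞) (fun p : ℝ × ℝ => b₀ p.1 p.2) →
      (∀ t ∈ Icc (0:ℝ) T, ∀ z ∈ Icc (0:ℝ) 1, |b₂ t z - 1| ≤ 1 / 2) →
      supNT T 6 b₂ + supNT T 6 b₁ + supNT T 6 b₀ ≤ M →
      τ₂ ∈ Ioo (0:ℝ) T →
      ContDiff ℝ (⊤ : ℕ∞) (fun p : ℝ × ℝ => g p.1 p.2) →
      (∀ t ∈ Icc (0:ℝ) τ₂, ∀ z : ℝ, g t z = 0) →
      normT N T 1 g ≤ M →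
      ContDiff ℝ (⊤ : ℕ∞) (fun p : ℝ × ℝ => h p.1 p.2) →
      (∀ t ∈ Icc (0:ℝ) T, ∀ z ∈ Ioo (0:ℝ) 1,
        dt (dt h) t z + opA N b₂ b₁ b₀ h t z = g t z) →
      (∀ t ∈ Icc (0:ℝ) T, h t 1 = 0) →
      (∀ t ∈ Icc (0:ℝ) τ₂, ∀ z : ℝ, h t z = 0) →
      normT N T (n + 2) h
        ≤ C * (1 + normT N T (n + 1) g
            + (supNT T (n + 5) b₂ + supNT T (n + 5) b₁ + supNT T (n + 5) b₀)) := by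

  obtain ⟨C, hC, hmain⟩ := main_ind hN hT hM n
  set D : ℝ := ((n + 2 : ℕ) + 1) ^ 3 * C with hD
  have hD0 : 0 < D := by positivity
  refine ⟨2 * (D + 1), by positivity, ?_⟩
  intro b₂ b₁ b₀ g h τ₂ hb2 hb1 hb0 hlo hbM hτ hg hg0 hgM hh heq hbd hh0
  have hs : Sol N T b₂ b₁ b₀ g h := by
    apply sol_of hτ <;> assumption
  have hn1 : 0 ≤ normT N T 1 g := Real.sqrt_nonneg _
  have hd : Dat N T M b₂ b₁ b₀ g h := ⟨hs,
    (normT_ge hN hT.le 1 hs.hg).trans (pow_le_pow_left₀ hn1 hgM 2), by unfold bet; linarith⟩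
  have e1 := hmain b₂ b₁ b₀ g h hd
  have e2 := normT_le hN hT.le (n + 2) hs.hh
  have e3 := normT_ge hN hT.le (n + 1) hs.hg
  have hnh : 0 ≤ normT N T (n + 2) h := Real.sqrt_nonneg _
  have hng : 0 ≤ normT N T (n + 1) g := Real.sqrt_nonneg _
  have hB : 1 ≤ bet T b₂ b₁ b₀ (n + 5) := one_le_bet _ _ _ _ _
  have e4 : normT N T (n + 2) h ^ 2
      ≤ D * ((1 + ∫ t in (0:ℝ)..T, SS N (n + 1) g t) + bet T b₂ b₁ b₀ (n + 5) ^ 2) := by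
    refine e2.trans ?_
    rw [hD, mul_assoc]
    exact mul_le_mul_of_nonneg_left e1 (by positivity)
  have e5 : bet T b₂ b₁ b₀ (n + 5)
      = 1 + (supNT T (n + 5) b₂ + supNT T (n + 5) b₁ + supNT T (n + 5) b₀) := rfl
  have e6 : 1 + normT N T (n + 1) g
            + (supNT T (n + 5) b₂ + supNT T (n + 5) b₁ + supNT T (n + 5) b₀)
      = normT N T (n + 1) g + bet T b₂ b₁ b₀ (n + 5) := by rw [e5]; ring
  rw [e6]
  refine abs_le_of_sq_le_sq' ?_ (by positivity) |>.2
  refine e4.trans ?_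
  generalize normT N T (n + 1) g = G at *
  generalize bet T b₂ b₁ b₀ (n + 5) = B at *
  have f1 : (1 + ∫ t in (0:ℝ)..T, SS N (n + 1) g t) + B ^ 2 ≤ 2 * (G + B) ^ 2 := by
    nlinarith [mul_nonneg hng (zero_le_one.trans hB)]
  have f2 := mul_le_mul_of_nonneg_left f1 hD0.le
  refine f2.trans ?_
  rw [mul_pow]
  have f3 : D * 2 ≤ (2 * (D + 1)) ^ 2 := by nlinarith
  have := mul_le_mul_of_nonneg_right f3 (sq_nonneg (G + B))
  linarith
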